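/- Let C > 0 be arbitrary. Then there is a constant K (depending only on C) such that for all x ≥ 2, |Σ_{p ≤ x} G_{g PR, h ANY}(p)/(p-1) − B · Li(x)| ≤ K · x / (log x)^C, where the sum is over primes p ≤ x and B = ∏_q (1 − 2q/(q³ − 1)), the product being over all primes q. -/

import Mathlib

namespace SW
open Complex MeasureTheory Filter Topology Asymptotics

/-- partial sums -/
noncomputable def S (f : ℕ → ℂ) (u : ℝ) : ℂ := ∑ k ∈ Finset.Icc 0 ⌊u⌋₊, f k

/-- error term of partial sums -/
noncomputable def E (f : ℕ → ℂ) (d : ℂ) (u : ℝ) : ℂ := S f u - d * u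

lemma measurable_S (f : ℕ → ℂ) : Measurable (S f) :=
  (measurable_from_nat (f := fun n => ∑ k ∈ Finset.Icc 0 n, f k)).comp Nat.measurable_floor

lemma measurable_E (f : ℕ → ℂ) (d : ℂ) : Measurable (E f d) :=
  (measurable_S f).sub (measurable_const.mul (Complex.measurable_ofReal))

lemma integrableOn_E (f : ℕ → ℂ) (d : ℂ) (Q : ℝ) (hE : ∀ u : ℝ, 1 ≤ u → ‖E f d u‖ ≤ Q)
    (N : ℝ) (hN : 1 ≤ N) (s : ℂ) (hs : 0 < s.re) :
    IntegrableOn (fun u : ℝ => E f d u * (u : ℂ) ^ (-(s + 1))) (Set.Ioi N) := by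
  have h1 : IntegrableOn (fun u : ℝ => (u : ℂ) ^ (-(s + 1))) (Set.Ioi N) :=
    integrableOn_Ioi_cpow_of_lt (by simp; linarith) (by linarith)
  refine Integrable.bdd_mul (c := Q) h1 (measurable_E f d).aestronglyMeasurable ?_
  filter_upwards [ae_restrict_mem measurableSet_Ioi] with u hu
  exact hE u (hN.trans (le_of_lt hu))

lemma norm_integral_E_le (f : ℕ → ℂ) (d : ℂ) (Q : ℝ) (hE : ∀ u : ℝ, 1 ≤ u → ‖E f d u‖ ≤ Q)
    (N : ℝ) (hN : 1 ≤ N) (s : ℂ) (hs : 0 < s.re) :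
    ‖∫ u in Set.Ioi N, E f d u * (u : ℂ) ^ (-(s + 1))‖ ≤ Q * N ^ (-s.re) / s.re := by
  have h2 : ∫ u in Set.Ioi N, Q * u ^ (-(s.re + 1)) = Q * N ^ (-s.re) / s.re := by
    rw [integral_const_mul, integral_Ioi_rpow_of_lt (by linarith) (by linarith)]
    have : -(s.re + 1) + 1 = - s.re := by ring
    rw [this]
    field_simp
  rw [← h2]
  apply norm_integral_le_of_norm_le
  · exact ((integrableOn_Ioi_rpow_of_lt (by linarith) (by linarith)).const_mul Q)
  · filter_upwards [ae_restrict_mem measurableSet_Ioi] with u hu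
    have hu' : 1 ≤ u := hN.trans (le_of_lt hu)
    rw [norm_mul, Complex.norm_cpow_eq_rpow_re_of_pos (by linarith)]
    have : (-(s + 1)).re = -(s.re + 1) := by simp
    rw [this]
    gcongr
    exact (hE u hu')

noncomputable def R (f : ℕ → ℂ) (d : ℂ) (N : ℕ) (s : ℂ) : ℂ :=
  ∑ n ∈ Finset.Icc 0 N, (n : ℂ) ^ (-s) * f n - E f d N * (N : ℂ) ^ (-s)
    + d * (N : ℂ) ^ (1 - s) / (s - 1)
    + s * ∫ u in Set.Ioi (N : ℝ), E f d u * (u : ℂ) ^ (-(s + 1))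

lemma LSeries_eq_R (f : ℕ → ℂ) (d : ℂ) (Q : ℝ) (hf0 : f 0 = 0) (hf : ∀ n, ‖f n‖ ≤ 1)
    (hE : ∀ u : ℝ, 1 ≤ u → ‖E f d u‖ ≤ Q) (N : ℕ) (hN : 1 ≤ N) (s : ℂ) (hs : 1 < s.re) :
    LSeries f s = R f d N s := by
  have hN' : (1 : ℝ) ≤ N := by exact_mod_cast hN
  have hN0 : (N : ℂ) ≠ 0 := by exact_mod_cast (by omega : N ≠ 0)
  have hs0 : s ≠ 0 := by rintro rfl; simp at hs; linarith
  have hs1 : s - 1 ≠ 0 := by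
    intro h
    have : s = 1 := by linear_combination h
    simp [this] at hs
  have hS1 : ∀ u : ℝ, ∑ k ∈ Finset.Icc 1 ⌊u⌋₊, f k = S f u := by
    intro u
    rw [S, ← Finset.insert_Icc_add_one_left_eq_Icc (Nat.zero_le _), Finset.sum_insert (by simp), hf0,
      zero_add, zero_add]
  have h1 : LSeries f s = s * ∫ t in Set.Ioi (1 : ℝ), S f t * (t : ℂ) ^ (-(s + 1)) := by
    rw [LSeries_eq_mul_integral' f zero_le_one hs]
    · simp_rw [hS1]
    · apply IsBigO.of_bound 1
      filter_upwards with n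
      rw [Real.norm_of_nonneg (by positivity), Real.norm_of_nonneg (by positivity), one_mul, Real.rpow_one]
      calc ∑ k ∈ Finset.Icc 1 n, ‖f k‖ ≤ ∑ k ∈ Finset.Icc 1 n, (1 : ℝ) :=
            Finset.sum_le_sum fun k _ => hf k
        _ = n := by simp
  have hintg : ∀ M : ℝ, 1 ≤ M → IntegrableOn (fun t : ℝ => d * (t : ℂ) ^ (-s)) (Set.Ioi M) := by
    intro M hM
    exact (integrableOn_Ioi_cpow_of_lt (by simp; linarith) (by linarith)).const_mul d
  have heq : ∀ M : ℝ, 1 ≤ M → Set.EqOn (fun t : ℝ => S f t * (t : ℂ) ^ (-(s + 1)))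
      (fun t : ℝ => E f d t * (t : ℂ) ^ (-(s + 1)) + d * (t : ℂ) ^ (-s)) (Set.Ioi M) := by
    intro M hM t ht
    have ht0 : (t : ℂ) ≠ 0 := by
      have : 0 < t := by have := Set.mem_Ioi.mp ht; linarith
      exact_mod_cast this.ne'
    have : (t : ℂ) ^ (-s) = t * (t : ℂ) ^ (-(s + 1)) := by
      rw [show -s = 1 + (-(s + 1)) by ring, Complex.cpow_add _ _ ht0, Complex.cpow_one]
    simp only [E, this]
    ring
  have hSint : ∀ M : ℝ, 1 ≤ M → IntegrableOn (fun t : ℝ => S f t * (t : ℂ) ^ (-(s + 1))) (Set.Ioi M) := by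
    intro M hM
    refine IntegrableOn.congr_fun ?_ (heq M hM).symm measurableSet_Ioi
    exact (integrableOn_E f d Q hE M hM s (by linarith)).add (hintg M hM)
  have h2 : ∫ t in Set.Ioi (1 : ℝ), S f t * (t : ℂ) ^ (-(s + 1)) =
      (∫ t in Set.Ioc (1 : ℝ) N, S f t * (t : ℂ) ^ (-(s + 1))) +
      ∫ t in Set.Ioi (N : ℝ), S f t * (t : ℂ) ^ (-(s + 1)) := by
    rw [← setIntegral_union (Set.Ioc_disjoint_Ioi le_rfl) measurableSet_Ioi
      ((hSint 1 le_rfl).mono_set Set.Ioc_subset_Ioi_self) (hSint N hN'),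
      Set.Ioc_union_Ioi_eq_Ioi hN']
  have h3 : ∫ t in Set.Ioi (N : ℝ), S f t * (t : ℂ) ^ (-(s + 1)) =
      (∫ t in Set.Ioi (N : ℝ), E f d t * (t : ℂ) ^ (-(s + 1))) + d * (N : ℂ) ^ (1 - s) / (s - 1) := by
    rw [setIntegral_congr_fun measurableSet_Ioi (heq N hN'),
      integral_add (integrableOn_E f d Q hE N hN' s (by linarith)) (hintg N hN'),
      integral_const_mul, integral_Ioi_cpow_of_lt (by simp; linarith) (by linarith)]
    have : -s + 1 ≠ 0 := by intro h; apply hs1; linear_combination -h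
    rw [show (1 - s) = -s + 1 by ring]
    push_cast
    field_simp
    ring
  have h4 : s * ∫ t in Set.Ioc (1 : ℝ) N, S f t * (t : ℂ) ^ (-(s + 1)) =
      ∑ n ∈ Finset.Icc 0 N, (n : ℂ) ^ (-s) * f n - (N : ℂ) ^ (-s) * S f N := by
    have hd : ∀ t ∈ Set.Icc (1 : ℝ) N, DifferentiableAt ℝ (fun x : ℝ ↦ (x : ℂ) ^ (-s)) t := by
      intro t ht
      exact differentiableAt_id.ofReal_cpow_const (zero_lt_one.trans_le ht.1).ne' (neg_ne_zero.mpr hs0)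
    have := sum_mul_eq_sub_integral_mul₀' (f := fun x : ℝ ↦ (x : ℂ) ^ (-s)) f hf0 N hd
      ((Iff.mpr integrableOn_Ici_iff_integrableOn_Ioi <|
      integrableOn_Ioi_deriv_ofReal_cpow zero_lt_one (s := -s)
        (by simp; linarith)).mono_set (Set.Icc_subset_Ici_self))
    simp only [Complex.ofReal_natCast] at this
    rw [this]
    simp only [S, Nat.floor_natCast]
    rw [sub_right_comm, sub_self, zero_sub, ← integral_const_mul, ← integral_neg]
    refine setIntegral_congr_fun measurableSet_Ioc fun t ht ↦ ?_
    rw [deriv_ofReal_cpow_const (zero_lt_one.trans ht.1).ne' (neg_ne_zero.mpr hs0)]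
    rw [show -s - 1 = -(s+1) by ring]
    ring
  have h5 : (N : ℂ) ^ (1 - s) = N * (N : ℂ) ^ (-s) := by
    rw [sub_eq_add_neg, Complex.cpow_add _ _ hN0, Complex.cpow_one]
  rw [h1, h2, h3, mul_add, h4, R, E, h5]
  push_cast
  field_simp
  ring

lemma differentiableAt_integral_E (f : ℕ → ℂ) (d : ℂ) (Q : ℝ) (hE : ∀ u : ℝ, 1 ≤ u → ‖E f d u‖ ≤ Q)
    (N : ℝ) (hN : 1 ≤ N) (s : ℂ) (hs : 0 < s.re) :
    DifferentiableAt ℂ (fun s : ℂ => ∫ u in Set.Ioi N, E f d u * (u : ℂ) ^ (-(s + 1))) s := by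
  set g : ℝ → ℂ := Set.indicator (Set.Ioi N) (E f d) with hg
  have hgb : ∀ u, ‖g u‖ ≤ Q := by
    intro u
    by_cases hu : u ∈ Set.Ioi N
    · rw [hg, Set.indicator_of_mem hu]; exact hE u (hN.trans (le_of_lt hu))
    · rw [hg, Set.indicator_of_notMem hu, norm_zero]; exact (norm_nonneg _).trans (hE 1 le_rfl)
  have hgm : Measurable g := (measurable_E f d).indicator measurableSet_Ioi
  have hm : (fun s : ℂ => ∫ u in Set.Ioi N, E f d u * (u : ℂ) ^ (-(s + 1))) =
      (mellin g) ∘ (fun s => -s) := by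
    funext z
    simp only [mellin, Function.comp]
    have : ∀ t : ℝ, (t : ℂ) ^ (-z - 1) • g t =
        Set.indicator (Set.Ioi N) (fun u : ℝ => E f d u * (u : ℂ) ^ (-(z + 1))) t := by
      intro t
      by_cases ht : t ∈ Set.Ioi N
      · rw [hg, Set.indicator_of_mem ht, Set.indicator_of_mem ht, smul_eq_mul, mul_comm]
        ring_nf
      · rw [hg, Set.indicator_of_notMem ht, Set.indicator_of_notMem ht, smul_zero]
    simp_rw [this]
    rw [setIntegral_indicator measurableSet_Ioi]
    congr 2
    ext u
    simp only [Set.mem_Ioi, Set.mem_inter_iff]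
    constructor
    · intro h; exact ⟨by linarith, h⟩
    · intro h; exact h.2
  rw [hm]
  refine DifferentiableAt.comp s ?_ (differentiable_neg.differentiableAt)
  refine mellin_differentiableAt_of_isBigO_rpow (a := 0) (b := -s.re - 1) ?_ ?_ (by simpa using hs) ?_
    (by simp)
  · refine LocallyIntegrable.locallyIntegrableOn ?_ _
    intro x
    refine ⟨Set.Icc (x - 1) (x + 1), Icc_mem_nhds (by linarith) (by linarith), ?_⟩
    refine Measure.integrableOn_of_bounded (M := Q) (by simp) hgm.aestronglyMeasurable ?_
    exact ae_of_all _ hgb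
  · apply IsBigO.of_bound Q
    filter_upwards with u
    simpa using hgb u
  · apply IsBigO.of_bound 0
    have : Set.Iio (1 : ℝ) ∈ 𝓝[>] (0 : ℝ) := mem_nhdsWithin_of_mem_nhds (Iio_mem_nhds one_pos)
    filter_upwards [this] with u hu
    rw [hg, Set.indicator_of_notMem]
    · simp
    · simp only [Set.mem_Ioi, not_lt]; have := Set.mem_Iio.mp hu; linarith

lemma differentiableAt_R (f : ℕ → ℂ) (d : ℂ) (Q : ℝ) (hf0 : f 0 = 0) (hE : ∀ u : ℝ, 1 ≤ u → ‖E f d u‖ ≤ Q)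
    (N : ℕ) (hN : 1 ≤ N) (s : ℂ) (hs : 0 < s.re) (hs1 : d = 0 ∨ s ≠ 1) :
    DifferentiableAt ℂ (R f d N) s := by
  have hN' : (1 : ℝ) ≤ N := by exact_mod_cast hN
  have hN0 : (N : ℂ) ≠ 0 := by exact_mod_cast (by omega : N ≠ 0)
  have hp : ∀ n : ℕ, n ≠ 0 → Differentiable ℂ (fun s : ℂ => (n : ℂ) ^ (-s)) := by
    intro n hn
    exact (differentiable_neg).const_cpow (Or.inl (by exact_mod_cast hn))
  unfold R
  refine DifferentiableAt.add (DifferentiableAt.add (DifferentiableAt.sub ?_ ?_) ?_) ?_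
  · refine DifferentiableAt.fun_sum fun n _ => ?_
    rcases Nat.eq_zero_or_pos n with rfl | hn
    · simp [hf0]
    · exact (hp n (by omega) s).mul_const _
  · exact ((hp N (by omega)) s).const_mul _
  · rcases hs1 with h | h
    · simp [h]
    · refine DifferentiableAt.div ?_ (by fun_prop) (sub_ne_zero.mpr h)
      refine DifferentiableAt.const_mul ?_ _
      exact (DifferentiableAt.const_cpow (by fun_prop) (Or.inl hN0))
  · exact differentiableAt_id.mul (differentiableAt_integral_E f d Q hE N hN' s hs)

lemma eq_R (F : ℂ → ℂ) (f : ℕ → ℂ) (d : ℂ) (Q : ℝ) (hf0 : f 0 = 0) (hf : ∀ n, ‖f n‖ ≤ 1)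
    (hE : ∀ u : ℝ, 1 ≤ u → ‖E f d u‖ ≤ Q) (N : ℕ) (hN : 1 ≤ N)
    (hF : ∀ s : ℂ, 1 < s.re → F s = LSeries f s)
    (hFd : ∀ s : ℂ, (d = 0 ∨ s ≠ 1) → DifferentiableAt ℂ F s)
    (s : ℂ) (hs : 0 < s.re) (hs1 : d = 0 ∨ s ≠ 1) : F s = R f d N s := by
  set U : Set ℂ := {z : ℂ | 0 < z.re} ∩ {z | d = 0 ∨ z ≠ 1} with hU
  have hUo : IsOpen U := by
    refine (isOpen_lt continuous_const Complex.continuous_re).inter ?_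
    by_cases h : d = 0
    · simp [h]
    · simp only [h, false_or]; exact isOpen_ne
  have hUc : IsPreconnected U := by
    have hc : Convex ℝ {z : ℂ | 0 < z.re} := convex_halfSpace_re_gt 0
    by_cases h : d = 0
    · simp only [hU, h, true_or, Set.ofPred_true, Set.inter_univ]
      exact hc.isPreconnected
    · have : U = {z : ℂ | 0 < z.re} \ {1} := by
        ext z; simp [hU, h]
      rw [this]
      have e : {z : ℂ | 0 < z.re} \ {1} = (({z : ℂ | 1 < z.re} ∪ ({z : ℂ | 0 < z.re} ∩ {z | 0 < z.im}))
          ∪ ({z : ℂ | 0 < z.re} ∩ {z | z.im < 0})) ∪ ({z : ℂ | 0 < z.re} ∩ {z | z.re < 1}) := by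
        ext z
        simp only [Set.mem_diff, Set.mem_setOf_eq, Set.mem_singleton_iff, Set.mem_union,
          Set.mem_inter_iff, Complex.ext_iff, Complex.one_re, Complex.one_im]
        constructor
        · rintro ⟨h0, h1⟩
          rcases lt_trichotomy z.im 0 with h | h | h
          · tauto
          · rcases lt_trichotomy z.re 1 with h' | h' | h' <;> tauto
          · tauto
        · rintro (((h | ⟨h, h'⟩) | ⟨h, h'⟩) | ⟨h, h'⟩)
          · exact ⟨by linarith, fun h' => by linarith [h'.1]⟩
          · exact ⟨h, fun h' => by linarith [h'.2]⟩
          · exact ⟨h, fun h' => by linarith [h'.2]⟩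
          · exact ⟨h, fun h' => by linarith [h'.1]⟩
      rw [e]
      refine IsPreconnected.union (⟨1/2, 1⟩ : ℂ) (by norm_num) (by norm_num) ?_ ?_
      · refine IsPreconnected.union (⟨2, -1⟩ : ℂ) (by norm_num) (by norm_num) ?_ ?_
        · refine IsPreconnected.union (⟨2, 1⟩ : ℂ) (by norm_num) (by norm_num) ?_ ?_
          · exact (convex_halfSpace_re_gt 1).isPreconnected
          · exact (hc.inter (convex_halfSpace_im_gt 0)).isPreconnected
        · exact (hc.inter (convex_halfSpace_im_lt 0)).isPreconnected
      · exact (hc.inter (convex_halfSpace_re_lt 1)).isPreconnected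
  have h1 : AnalyticOnNhd ℂ F U := by
    apply DifferentiableOn.analyticOnNhd _ hUo
    intro z hz
    exact (hFd z hz.2).differentiableWithinAt
  have h2 : AnalyticOnNhd ℂ (R f d N) U := by
    apply DifferentiableOn.analyticOnNhd _ hUo
    intro z hz
    exact (differentiableAt_R f d Q hf0 hE N hN z hz.1 hz.2).differentiableWithinAt
  have h3 : (2 : ℂ) ∈ U := by simp [hU]
  refine h1.eqOn_of_preconnected_of_eventuallyEq h2 hUc h3 ?_ ⟨hs, hs1⟩
  have : {z : ℂ | 1 < z.re} ∈ 𝓝 (2 : ℂ) :=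
    (isOpen_lt continuous_const Complex.continuous_re).mem_nhds (by simp)
  filter_upwards [this] with z hz
  rw [hF z hz, LSeries_eq_R f d Q hf0 hf hE N hN z hz]
end SW

namespace SW
open Complex MeasureTheory Filter Topology Asymptotics

lemma norm_R_le (ε : ℝ) (hε : 0 < ε) (hε2 : ε ≤ 1/2) (f : ℕ → ℂ) (d : ℂ) (Q : ℝ) (hQ : 1 ≤ Q)
    (hf0 : f 0 = 0) (hf : ∀ n, ‖f n‖ ≤ 1) (hE : ∀ u : ℝ, 1 ≤ u → ‖E f d u‖ ≤ Q)
    (s : ℂ) (hs : 1 - ε ≤ s.re) (hs3 : s.re ≤ 4) :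
    ∃ N : ℕ, 1 ≤ N ∧ ‖R f d N s‖ ≤ 2 * (6 + 1 / ε) * (Q * (|s.im| + 2)) ^ (2 * ε) * (1 + ‖d‖ / ‖s - 1‖) := by
  set T := |s.im| + 2 with hT
  have hT2 : 2 ≤ T := by have := abs_nonneg s.im; linarith
  have hQT : 2 ≤ Q * T := by nlinarith
  refine ⟨⌈Q * T⌉₊, Nat.one_le_ceil_iff.mpr (by linarith), ?_⟩
  set N := ⌈Q * T⌉₊ with hNdef
  have hNQ : Q * T ≤ N := Nat.le_ceil _
  have hN2 : (N : ℝ) ≤ 2 * (Q * T) := by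
    have := Nat.ceil_lt_add_one (by linarith : 0 ≤ Q * T); linarith
  have hN1 : (1 : ℝ) ≤ N := by linarith
  have hN0 : (0 : ℝ) < N := by linarith
  have hQN : Q ≤ N := by nlinarith
  have hσ : 0 < s.re := by linarith
  have hσ2 : 1 / 2 ≤ s.re := by linarith
  set A := (N : ℝ) ^ ε with hA
  have hA1 : 1 ≤ A := Real.one_le_rpow hN1 hε.le
  have hA2 : (N : ℝ) ^ (2 * ε) = A * A := by rw [hA, ← Real.rpow_add hN0]; ring_nf
  have hlog : Real.log N ≤ A / ε := Real.log_le_rpow_div hN0.le hε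
  have hpow : ∀ x : ℝ, 1 ≤ x → x ≤ N → x ^ (-s.re) ≤ A / x := by
    intro x hx hxN
    calc x ^ (-s.re) ≤ x ^ (ε - 1) := Real.rpow_le_rpow_of_exponent_le hx (by linarith)
      _ = x ^ ε / x := by rw [Real.rpow_sub (by linarith), Real.rpow_one]
      _ ≤ A / x := by rw [hA]; gcongr
  have hNs : (N : ℝ) ^ (-s.re) ≤ A / N := hpow N hN1 le_rfl
  have t1 : ‖∑ n ∈ Finset.Icc 0 N, (n : ℂ) ^ (-s) * f n‖ ≤ A * (1 + A / ε) := by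
    have : ∑ n ∈ Finset.Icc 0 N, (n : ℂ) ^ (-s) * f n = ∑ n ∈ Finset.Icc 1 N, (n : ℂ) ^ (-s) * f n := by
      rw [← Finset.insert_Icc_add_one_left_eq_Icc (Nat.zero_le _), Finset.sum_insert (by simp), hf0,
        mul_zero, zero_add, zero_add]
    rw [this]
    calc _ ≤ ∑ n ∈ Finset.Icc 1 N, ‖(n : ℂ) ^ (-s) * f n‖ := norm_sum_le _ _
      _ ≤ ∑ n ∈ Finset.Icc 1 N, A * (n : ℝ)⁻¹ := by
        refine Finset.sum_le_sum fun n hn => ?_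
        obtain ⟨h1, h2⟩ := Finset.mem_Icc.mp hn
        rw [norm_mul, Complex.norm_natCast_cpow_of_pos (by omega)]
        calc _ ≤ (n : ℝ) ^ (-s).re * 1 := by gcongr; exact hf n
          _ ≤ _ := by
            rw [mul_one, Complex.neg_re, ← div_eq_mul_inv]
            exact hpow n (by exact_mod_cast h1) (by exact_mod_cast h2)
      _ = A * (harmonic N : ℝ) := by
        rw [← Finset.mul_sum, harmonic_eq_sum_Icc]; push_cast; rfl
      _ ≤ A * (1 + Real.log N) := by gcongr; exact harmonic_le_one_add_log N
      _ ≤ _ := by gcongr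
  have t2 : ‖E f d N * (N : ℂ) ^ (-s)‖ ≤ A := by
    rw [norm_mul, Complex.norm_natCast_cpow_of_pos (by exact_mod_cast hN0)]
    calc _ ≤ Q * (A / N) := by
          gcongr
          · exact hE N hN1
          · simpa using hNs
      _ ≤ N * (A / N) := by gcongr
      _ = A := by field_simp
  have t3 : ‖d * (N : ℂ) ^ (1 - s) / (s - 1)‖ ≤ A * (‖d‖ / ‖s - 1‖) := by
    rw [norm_div, norm_mul, Complex.norm_natCast_cpow_of_pos (by exact_mod_cast hN0)]
    have : (N : ℝ) ^ (1 - s).re ≤ A := Real.rpow_le_rpow_of_exponent_le hN1 (by simp; linarith)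
    rw [mul_div_assoc', mul_comm A]
    gcongr
  have t4 : ‖s * ∫ u in Set.Ioi (N : ℝ), E f d u * (u : ℂ) ^ (-(s + 1))‖ ≤ 4 * A := by
    rw [norm_mul]
    have hns : ‖s‖ ≤ 2 * T := by
      have := Complex.norm_le_abs_re_add_abs_im s
      rw [abs_of_pos hσ] at this
      have := abs_nonneg s.im
      linarith
    calc _ ≤ (2 * T) * (Q * N ^ (-s.re) / s.re) := by
          gcongr
          exact norm_integral_E_le f d Q hE N hN1 s hσ
      _ ≤ (2 * T) * (Q * (A / N) / (1 / 2)) := by gcongr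
      _ = 4 * (Q * T) * (A / N) := by ring
      _ ≤ 4 * N * (A / N) := by gcongr
      _ = 4 * A := by field_simp
  have hD : 0 ≤ ‖d‖ / ‖s - 1‖ := by positivity
  set D := ‖d‖ / ‖s - 1‖
  have hfin : ‖R f d N s‖ ≤ A * (1 + A / ε) + A + A * D + 4 * A := by
    unfold R
    refine (norm_add_le _ _).trans (add_le_add ((norm_add_le _ _).trans (add_le_add ((norm_sub_le _ _).trans
      (add_le_add t1 t2)) t3)) t4)
  have hAA : A * A ≤ 2 * (Q * T) ^ (2 * ε) := by
    rw [← hA2]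
    calc (N : ℝ) ^ (2 * ε) ≤ (2 * (Q * T)) ^ (2 * ε) := by gcongr
      _ = 2 ^ (2 * ε) * (Q * T) ^ (2 * ε) := Real.mul_rpow (by norm_num) (by linarith)
      _ ≤ 2 ^ (1 : ℝ) * (Q * T) ^ (2 * ε) := by
        gcongr
        · norm_num
        · linarith
      _ = _ := by rw [Real.rpow_one]
  have he : 0 < 1 / ε := by positivity
  have hAle : A ≤ A * A := by nlinarith
  calc ‖R f d N s‖ ≤ A * (1 + A / ε) + A + A * D + 4 * A := hfin
    _ = (1 / ε) * (A * A) + 6 * A + A * D := by ring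
    _ ≤ (1 / ε) * (A * A) + 6 * (A * A) + (A * A) * D := by gcongr
    _ = (A * A) * ((6 + 1 / ε) + D) := by ring
    _ ≤ (A * A) * ((6 + 1 / ε) * (1 + D)) := by
      gcongr
      nlinarith
    _ ≤ (2 * (Q * T) ^ (2 * ε)) * ((6 + 1 / ε) * (1 + D)) := by gcongr
    _ = _ := by ring

lemma sum_char_Icc_mul {q : ℕ} [NeZero q] (χ : DirichletCharacter ℂ q) (hχ : χ ≠ 1) (n : ℕ) :
    ‖∑ k ∈ Finset.range n, χ (k : ZMod q)‖ ≤ q := by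
  have hper : Function.Periodic (fun k : ℕ => χ (k : ZMod q)) q := by
    intro k; simp
  have hz : ∑ k ∈ Finset.range q, χ (k : ZMod q) = 0 := by
    have h1 := MulChar.sum_eq_zero_of_ne_one hχ
    rw [← h1]
    refine Finset.sum_bij (fun k _ => (k : ZMod q)) (by simp) ?_ ?_ (by simp)
    · intro a ha b hb h
      have := (ZMod.natCast_eq_natCast_iff a b q).mp h
      exact Nat.ModEq.eq_of_lt_of_lt this (Finset.mem_range.mp ha) (Finset.mem_range.mp hb)
    · intro b _
      exact ⟨b.val, by simpa using ZMod.val_lt b, by simp⟩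
  have hmul : ∀ m : ℕ, ∑ k ∈ Finset.range (q * m), χ (k : ZMod q) = 0 := by
    intro m
    induction m with
    | zero => simp
    | succ m ih =>
      rw [Nat.mul_succ, Finset.sum_range_add, ih, zero_add]
      rw [← hz]
      refine Finset.sum_congr rfl fun k _ => ?_
      simp
  have : n = q * (n / q) + n % q := (Nat.div_add_mod n q).symm
  rw [this, Finset.sum_range_add, hmul, zero_add]
  calc _ ≤ ∑ k ∈ Finset.range (n % q), ‖χ ((q * (n / q) + k : ℕ) : ZMod q)‖ := norm_sum_le _ _
    _ ≤ ∑ k ∈ Finset.range (n % q), (1 : ℝ) := Finset.sum_le_sum fun k _ => χ.norm_le_one _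
    _ = ((n % q : ℕ) : ℝ) := by simp
    _ ≤ q := by exact_mod_cast (Nat.mod_lt n (NeZero.pos q)).le

lemma ne_one_char_zero {q : ℕ} [NeZero q] (χ : DirichletCharacter ℂ q) (hχ : χ ≠ 1) :
    χ ((0 : ℕ) : ZMod q) = 0 := by
  rcases eq_or_ne q 1 with rfl | h
  · exact absurd (Subsingleton.elim χ 1) hχ
  · apply χ.map_nonunit
    have : Fact (1 < q) := ⟨by have := NeZero.ne q; omega⟩
    simp

lemma char_E_bound {q : ℕ} [NeZero q] (χ : DirichletCharacter ℂ q) (hχ : χ ≠ 1) (u : ℝ) :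
    ‖E (fun n : ℕ => χ (n : ZMod q)) 0 u‖ ≤ q := by
  rw [E, S, zero_mul, sub_zero, ← Nat.range_succ_eq_Icc_zero]
  exact sum_char_Icc_mul χ hχ _

lemma norm_L_le (ε : ℝ) (hε : 0 < ε) (hε2 : ε ≤ 1/2) {q : ℕ} [NeZero q]
    (χ : DirichletCharacter ℂ q) (hχ : χ ≠ 1) (s : ℂ) (hs : 1 - ε ≤ s.re) (hs3 : s.re ≤ 4) :
    ‖χ.LFunction s‖ ≤ 2 * (6 + 1 / ε) * (q * (|s.im| + 2)) ^ (2 * ε) := by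
  have hq : (1 : ℝ) ≤ q := by exact_mod_cast NeZero.pos q
  obtain ⟨N, hN, h⟩ := norm_R_le ε hε hε2 (fun n : ℕ => χ (n : ZMod q)) 0 q hq (ne_one_char_zero χ hχ)
    (fun n => χ.norm_le_one _) (fun u _ => char_E_bound χ hχ u) s hs hs3
  rw [eq_R χ.LFunction (fun n : ℕ => χ (n : ZMod q)) 0 q (ne_one_char_zero χ hχ)
    (fun n => χ.norm_le_one _) (fun u _ => char_E_bound χ hχ u) N hN
    (fun s hs => DirichletCharacter.LFunction_eq_LSeries χ hs)
    (fun s _ => DirichletCharacter.differentiable_LFunction hχ s) s (by linarith) (Or.inl rfl)]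
  simpa using h

lemma norm_zeta_le (ε : ℝ) (hε : 0 < ε) (hε2 : ε ≤ 1/2) (s : ℂ) (hs : 1 - ε ≤ s.re) (hs3 : s.re ≤ 4)
    (hs1 : s ≠ 1) :
    ‖riemannZeta s‖ ≤ 2 * (6 + 1 / ε) * (|s.im| + 2) ^ (2 * ε) * (1 + 1 / ‖s - 1‖) := by
  set f : ℕ → ℂ := fun n => ((ArithmeticFunction.zeta n : ℕ) : ℂ) with hf
  have hf0 : f 0 = 0 := by simp [hf]
  have hfn : ∀ n, ‖f n‖ ≤ 1 := by
    intro n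
    simp only [hf, ArithmeticFunction.zeta_apply]
    split_ifs <;> simp
  have hE : ∀ u : ℝ, 1 ≤ u → ‖E f 1 u‖ ≤ 1 := by
    intro u hu
    have : S f u = (⌊u⌋₊ : ℂ) := by
      rw [S, ← Finset.insert_Icc_add_one_left_eq_Icc (Nat.zero_le _), Finset.sum_insert (by simp), hf0,
        zero_add, zero_add]
      rw [Finset.sum_congr rfl (g := fun _ => (1 : ℂ))]
      · simp
      · intro k hk
        have := (Finset.mem_Icc.mp hk).1
        simp [hf, ArithmeticFunction.zeta_apply, show k ≠ 0 by omega]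
    rw [E, this, one_mul]
    have h1 := Nat.floor_le (by linarith : 0 ≤ u)
    have h2 := Nat.lt_floor_add_one u
    rw [show ((⌊u⌋₊ : ℂ) - (u : ℂ)) = (((⌊u⌋₊ : ℝ) - u : ℝ) : ℂ) by push_cast; rfl, Complex.norm_real,
      Real.norm_eq_abs, abs_le]
    constructor <;> linarith
  obtain ⟨N, hN, h⟩ := norm_R_le ε hε hε2 f 1 1 le_rfl hf0 hfn hE s hs hs3
  rw [eq_R riemannZeta f 1 1 hf0 hfn hE N hN
    (fun s hs => (ArithmeticFunction.LSeries_zeta_eq_riemannZeta hs).symm)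
    (fun s h => differentiableAt_riemannZeta (by simpa using h)) s (by linarith) (Or.inr hs1)]
  simpa using h
end SW

namespace SW
open Complex ComplexOrder Topology

/-- `(s-1)ζ(s)` as an entire function. -/
noncomputable def W : ℂ → ℂ := DirichletCharacter.LFunctionTrivChar₁ 1

lemma W_diff : Differentiable ℂ W := DirichletCharacter.differentiable_LFunctionTrivChar₁ 1

lemma W_one : W 1 = 1 := by
  simp [W, DirichletCharacter.LFunctionTrivChar₁]

lemma W_ne {s : ℂ} (hs : s ≠ 1) : W s = (s - 1) * riemannZeta s := by
  simp [W, DirichletCharacter.LFunctionTrivChar₁, hs, DirichletCharacter.LFunctionTrivChar, DirichletCharacter.LFunction_modOne_eq]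

lemma iter_inv (n : ℕ) : iteratedDeriv n (fun s : ℂ => (s - 1)⁻¹) 2 = (-1)^n * n.factorial := by
  have := congrFun (iteratedDeriv_comp_sub_const n (fun s : ℂ => s⁻¹) 1) 2
  rw [this, iteratedDeriv_eq_iterate, iter_deriv_inv]
  norm_num

lemma estermann_coeff (P : ℂ → ℂ) (a : ℕ → ℂ) (hP : Differentiable ℂ P) (ha : 0 ≤ a)
    (hs : ∀ s : ℂ, 1 < s.re → LSeriesSummable a s ∧ LSeries a s = riemannZeta s * P s) (n : ℕ) :
    ∃ b : ℝ, 0 ≤ b ∧ (n = 0 → (a 1).re ≤ b) ∧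
    iteratedDeriv n (dslope (W * P) 1) 2 = (-1)^n * n.factorial * (b - P 1) := by
  have habs : LSeries.abscissaOfAbsConv a < (2:ℝ) := by
    refine lt_of_le_of_lt (LSeries.abscissaOfAbsConv_le_of_forall_lt_LSeriesSummable (x := 1) ?_) (by norm_cast)
    intro y hy
    exact (hs y (by simpa using hy)).1
  have hev : dslope (W * P) 1 =ᶠ[𝓝 2] fun s => LSeries a s - P 1 * (s - 1)⁻¹ := by
    have : ∀ᶠ s : ℂ in 𝓝 2, 1 < s.re := 
      (continuous_re.isOpen_preimage _ isOpen_Ioi).mem_nhds (by simp)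
    filter_upwards [this] with s h1
    have hne : s ≠ 1 := by rintro rfl; simp at h1
    have : s - 1 ≠ 0 := sub_ne_zero.2 hne
    rw [dslope_of_ne _ hne, slope_def_field, (hs s h1).2]
    simp only [Pi.mul_apply, W_ne hne, W_one]
    field_simp
  have hA : 0 ≤ (-1)^n * iteratedDeriv n (LSeries a) (2:ℝ) := LSeries.iteratedDeriv_alternating ha habs n
  obtain ⟨r, hr, hr2⟩ : ∃ r : ℝ, 0 ≤ r ∧ (-1)^n * iteratedDeriv n (LSeries a) (2:ℝ) = r := by
    rw [Complex.nonneg_iff] at hA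
    exact ⟨_, hA.1, Complex.ext rfl (by simpa using hA.2.symm)⟩
  refine ⟨r / n.factorial, by positivity, ?_, ?_⟩
  · rintro rfl
    have h3 : (LSeries a (2:ℝ)).re = r := by
      have := congrArg Complex.re hr2
      simpa using this
    simp only [Nat.factorial_zero, Nat.cast_one, div_one]
    rw [← h3]
    have hsum := (hs (2:ℝ) (by simp)).1
    unfold LSeriesSummable at hsum
    have hnn : ∀ n, 0 ≤ (LSeries.term a (2:ℝ) n) := fun n => LSeries.term_nonneg (ha n) 2
    have h4 : LSeries.term a (2:ℝ) 1 = a 1 := by simp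
    rw [LSeries, Complex.re_tsum hsum, ← h4]
    refine (Complex.hasSum_re hsum.hasSum).summable.le_tsum 1 ?_
    intro j _
    exact (Complex.nonneg_iff.1 (hnn j)).1
  · rw [hev.iteratedDeriv_eq]
    have hd1 : ContDiffAt ℂ n (LSeries a) 2 := by
      have : AnalyticAt ℂ (LSeries a) 2 := by
        refine LSeries_analyticOnNhd a _ ?_
        simpa using habs
      exact this.contDiffAt
    have hd2 : ContDiffAt ℂ n (fun s : ℂ => P 1 * (s - 1)⁻¹) 2 := by
      refine contDiffAt_const.mul (ContDiffAt.inv (by fun_prop) (by norm_num))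
    have e := iteratedDeriv_sub hd1 hd2
    have e2 : (fun s => LSeries a s - P 1 * (s - 1)⁻¹) = LSeries a - fun s : ℂ => P 1 * (s - 1)⁻¹ := rfl
    rw [e2, e, iteratedDeriv_const_mul_field, iter_inv]
    have h5 : ((-1:ℂ)^n)*(-1)^n = 1 := by rw [← mul_pow]; simp
    have h6 : iteratedDeriv n (LSeries a) 2 = (-1)^n * r := by
      rw [← hr2, ← mul_assoc, h5]; simp
    rw [h6]
    have : (n.factorial : ℂ) ≠ 0 := by exact_mod_cast n.factorial_ne_zero
    push_cast
    field_simp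

lemma estermann : ∃ c K : ℝ, 0 < c ∧ 0 < K ∧ ∀ (P : ℂ → ℂ) (a : ℕ → ℂ) (M β : ℝ),
    Differentiable ℂ P → 0 ≤ a → a 1 = 1 →
    (∀ s : ℂ, 1 < s.re → LSeriesSummable a s ∧ LSeries a s = riemannZeta s * P s) →
    1 ≤ M → (∀ s ∈ Metric.closedBall (2:ℂ) (3/2), ‖P s‖ ≤ M) → 3/4 ≤ β → β < 1 →
    (riemannZeta β * P β).re ≤ 0 → c * (1 - β) * M ^ (-(K * (1 - β))) ≤ (P 1).re := by
  obtain ⟨CW, hCW⟩ := (isCompact_closedBall (2:ℂ) (3/2)).exists_bound_of_continuousOn W_diff.continuous.continuousOn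
  have hCW0 : 0 ≤ CW := (norm_nonneg _).trans (hCW 2 (by simp; norm_num))
  have hl : 0 < Real.log (6/5) := Real.log_pos (by norm_num)
  set A := 24 * (CW + 1) with hA
  have hA1 : 1 ≤ A := by rw [hA]; linarith
  refine ⟨1/2 * Real.exp (-(Real.log A / Real.log (6/5) + 2)), 1 / Real.log (6/5), by positivity, by positivity, ?_⟩
  intro P a M β hP ha ha1 hs hM hPM hβ hβ1 hneg
  set F := W * P with hF
  have hFd : Differentiable ℂ F := W_diff.mul hP
  set g := dslope F 1 with hg
  have hgd : Differentiable ℂ g := by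
    rw [← differentiableOn_univ, hg]
    exact (Complex.differentiableOn_dslope Filter.univ_mem).2 hFd.differentiableOn
  have hsph : ∀ s ∈ Metric.sphere (2:ℂ) (3/2), ‖g s‖ ≤ 2 * (CW + 1) * M := by
    intro s hss
    have hcb := Metric.sphere_subset_closedBall hss
    have h1 : 1/2 ≤ ‖s - 1‖ := by
      have h2 : ‖s - 2‖ = 3/2 := by simpa [dist_eq_norm] using hss
      have h3 : ‖s - 2‖ ≤ ‖s - 1‖ + ‖(1:ℂ)‖ := by
        have := norm_sub_le (s-1) 1
        rwa [show s - 1 - 1 = s - 2 by ring] at this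
      simp at h3; linarith
    have hne : s ≠ 1 := by rintro rfl; norm_num at h1
    rw [hg, dslope_of_ne _ hne, slope_def_field, norm_div, div_le_iff₀ (by linarith)]
    have h4 : ‖F s‖ ≤ CW * M := by
      rw [hF, Pi.mul_apply, norm_mul]
      exact mul_le_mul (hCW s hcb) (hPM s hcb) (norm_nonneg _) hCW0
    have h5 : ‖F 1‖ ≤ M := by
      rw [hF, Pi.mul_apply, W_one, one_mul]
      refine hPM 1 ?_
      rw [Metric.mem_closedBall, dist_eq_norm]; norm_num
    calc _ ≤ ‖F s‖ + ‖F 1‖ := norm_sub_le _ _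
      _ ≤ (CW + 1) * M := by linarith
      _ ≤ _ := by
        have : 0 ≤ (CW+1)*M := by positivity
        nlinarith
  set C := 2 * (CW + 1) * M with hC
  have hCpos : 0 < C := by positivity
  choose b hb0 hb1 hb using estermann_coeff P a hP ha hs
  set lam := (P 1).re with hlam
  set y := 2 - β with hy
  have hy1 : 1 < y := by rw [hy]; linarith
  have hy2 : y ≤ 5/4 := by rw [hy]; linarith
  have hsum := Complex.hasSum_taylorSeries_of_entire hgd 2 (β:ℂ)
  have hterm : ∀ n : ℕ, ((n.factorial:ℂ)⁻¹ • ((β:ℂ) - 2)^n • iteratedDeriv n g 2) = (y:ℂ)^n * (b n - P 1) := by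
    intro n
    rw [hg, hF, hb n]
    have : (n.factorial : ℂ) ≠ 0 := by exact_mod_cast n.factorial_ne_zero
    have h2 : (y:ℂ)^n = (-1)^n * ((β:ℂ)-2)^n := by
      rw [← mul_pow]; congr 1; rw [hy]; push_cast; ring
    rw [h2]
    simp only [smul_eq_mul]
    field_simp
  have hre := Complex.hasSum_re hsum
  have hbd : ∀ n : ℕ, ‖((n.factorial:ℂ)⁻¹ • ((β:ℂ) - 2)^n • iteratedDeriv n g 2)‖ ≤ C * (5/6)^n := by
    intro n
    have h1 := Complex.norm_iteratedDeriv_le_of_forall_mem_sphere_norm_le n (by norm_num) hgd.diffContOnCl hsph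
    have h2 : ‖(β:ℂ) - 2‖ = y := by
      have : (β:ℂ) - 2 = ((-y:ℝ):ℂ) := by rw [hy]; push_cast; ring
      rw [this, Complex.norm_real, Real.norm_eq_abs, abs_neg, abs_of_pos (by linarith)]
    have hn : (0:ℝ) < n.factorial := by positivity
    rw [norm_smul, norm_smul, norm_inv, norm_pow, h2, Complex.norm_natCast]
    calc _ ≤ (n.factorial:ℝ)⁻¹ * (y^n * (n.factorial * C / (3/2)^n)) := by gcongr
      _ = C * (y / (3/2))^n := by rw [div_pow y]; field_simp
      _ ≤ _ := by
        have : y / (3/2) ≤ 5/6 := by rw [div_le_iff₀ (by norm_num)]; linarith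
        gcongr
  have hrt : ∀ n : ℕ, (((n.factorial:ℂ)⁻¹ • ((β:ℂ) - 2)^n • iteratedDeriv n g 2)).re = y^n * (b n - lam) := by
    intro n
    rw [hterm, ← ofReal_pow, re_ofReal_mul]; simp [hlam]
  have hgre : (g β).re ≤ lam / (1 - β) := by
    have hne : (β:ℂ) ≠ 1 := by
      intro h; have := congrArg Complex.re h; simp at this; linarith
    have hne' : (β:ℂ) - 1 ≠ 0 := sub_ne_zero.2 hne
    have : g β = riemannZeta β * P β + ((1/(1-β):ℝ):ℂ) * P 1 := by
      rw [hg, dslope_of_ne _ hne, slope_def_field, hF]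
      simp only [Pi.mul_apply, W_ne hne, W_one]
      have h3 : (1:ℂ) - β ≠ 0 := by rw [← neg_sub]; exact neg_ne_zero.2 hne'
      push_cast
      field_simp
      ring
    rw [this, add_re, re_ofReal_mul]
    have : 1/(1-β) * (P 1).re = lam/(1-β) := by rw [hlam]; ring
    linarith
  set m := ⌈Real.log (A * M) / Real.log (6/5)⌉₊ + 1 with hm
  have hAM : 1 ≤ A * M := by nlinarith
  have hm6 : A * M ≤ (6/5:ℝ)^m := by
    have : Real.log (A * M) / Real.log (6/5) ≤ m := by
      rw [hm]; push_cast
      have := Nat.le_ceil (Real.log (A * M) / Real.log (6/5))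
      linarith
    rw [div_le_iff₀ hl, ← Real.log_pow] at this
    exact (Real.log_le_log_iff (by linarith) (by positivity)).1 this
  have htail : ‖∑' n, (((n+m).factorial:ℂ)⁻¹ • ((β:ℂ) - 2)^(n+m) • iteratedDeriv (n+m) g 2)‖ ≤ 1/2 := by
    have hg2 : HasSum (fun n : ℕ => C * (5/6:ℝ)^m * (5/6)^n) (C * (5/6:ℝ)^m * (1-5/6)⁻¹) :=
      (hasSum_geometric_of_lt_one (by norm_num) (by norm_num)).mul_left _
    refine (tsum_of_norm_bounded hg2 ?_).trans ?_
    · intro n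
      refine (hbd (n+m)).trans (le_of_eq ?_)
      rw [pow_add]; ring
    · have h7 : (5/6:ℝ)^m * (6/5)^m = 1 := by rw [← mul_pow]; norm_num
      have h8 : 0 < (5/6:ℝ)^m := by positivity
      have h9 : (5/6:ℝ)^m * (A*M) ≤ 1 := by rw [← h7]; gcongr
      have : A * M = 12 * C := by rw [hA, hC]; ring
      rw [this] at h9
      norm_num
      linarith
  have hsplit := hsum.summable.sum_add_tsum_nat_add m
  rw [hsum.tsum_eq] at hsplit
  have hlow : 1 - lam * ∑ n ∈ Finset.range m, y^n ≤ (∑ n ∈ Finset.range m, (((n.factorial:ℂ)⁻¹ • ((β:ℂ) - 2)^n • iteratedDeriv n g 2))).re := by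
    rw [Complex.re_sum, Finset.mul_sum]
    simp only [hrt, mul_sub, Finset.sum_sub_distrib]
    have : 1 ≤ ∑ n ∈ Finset.range m, y^n * b n := by
      have h0 : (1:ℝ) ≤ y^0 * b 0 := by
        have := hb1 0 rfl
        rw [ha1] at this; simpa using this
      refine h0.trans (Finset.single_le_sum (f := fun n => y^n * b n) ?_ (Finset.mem_range.2 (by omega)))
      intro i _
      have := hb0 i
      positivity
    have e : ∑ n ∈ Finset.range m, y^n * lam = ∑ n ∈ Finset.range m, lam * y^n := Finset.sum_congr rfl fun _ _ => mul_comm _ _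
    linarith
  have hkey : 1/2 ≤ lam * y^m / (1-β) := by
    have h1 := congrArg Complex.re hsplit
    rw [add_re] at h1
    have h2 := (abs_le.1 ((Complex.abs_re_le_norm _).trans htail)).1
    have h3 : ∑ n ∈ Finset.range m, y^n = (y^m - 1)/(1-β) := by
      rw [geom_sum_eq (ne_of_gt hy1)]; congr 1; rw [hy]; ring
    rw [h3] at hlow
    have h4 : lam * ((y^m-1)/(1-β)) = lam*y^m/(1-β) - lam/(1-β) := by ring
    linarith
  rw [le_div_iff₀ (by linarith)] at hkey
  have hym : 0 < y^m := by positivity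
  have hlam0 : 0 < lam := by
    by_contra h
    push Not at h
    nlinarith
  have hexp : y^m ≤ Real.exp (Real.log A / Real.log (6/5) + 2) * M ^ (1 / Real.log (6/5) * (1-β)) := by
    have hml : (m:ℝ) ≤ Real.log A / Real.log (6/5) + Real.log M / Real.log (6/5) + 2 := by
      rw [hm]; push_cast
      have := Nat.ceil_lt_add_one (a := Real.log (A * M) / Real.log (6/5)) (div_nonneg (Real.log_nonneg hAM) hl.le)
      rw [Real.log_mul (by linarith) (by linarith), add_div] at this
      rw [Real.log_mul (by linarith) (by linarith), add_div]
      linarith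
    have hylog : y ≤ Real.exp (1-β) := by
      have := Real.add_one_le_exp (1-β)
      rw [hy]; linarith
    rw [Real.rpow_def_of_pos (by linarith), ← Real.exp_add]
    calc y^m ≤ (Real.exp (1-β))^m := by gcongr
      _ = Real.exp (m * (1-β)) := by rw [← Real.exp_nat_mul]
      _ ≤ _ := by
        apply Real.exp_le_exp.2
        have h1 : (m:ℝ) * (1-β) ≤ (Real.log A / Real.log (6/5) + Real.log M / Real.log (6/5) + 2) * (1-β) := by
          gcongr
        have h2 : 0 ≤ Real.log A / Real.log (6/5) := div_nonneg (Real.log_nonneg hA1) hl.le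
        have h3 : Real.log M * (1 / Real.log (6/5) * (1-β)) = Real.log M / Real.log (6/5) * (1-β) := by ring
        rw [h3]
        nlinarith
  rw [Real.exp_neg, Real.rpow_neg (by linarith)]
  set X := Real.exp (Real.log A / Real.log (6/5) + 2)
  set Y := M ^ (1 / Real.log (6/5) * (1-β))
  have hX : 0 < X := Real.exp_pos _
  have hY : 0 < Y := Real.rpow_pos_of_pos (by linarith) _
  have : 1/2*(1-β) ≤ lam * (X * Y) := hkey.trans (by gcongr)
  calc 1/2 * X⁻¹ * (1-β) * Y⁻¹ = (1/2*(1-β)) / (X*Y) := by field_simp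
    _ ≤ lam := by rw [div_le_iff₀ (by positivity)]; exact this

end SW

namespace SW
open Complex ComplexOrder Topology ArithmeticFunction
open scoped ComplexConjugate

/-- pointwise multiplication with log -/
noncomputable def DL (f : ArithmeticFunction ℂ) : ArithmeticFunction ℂ :=
  ⟨fun n => f n * Complex.log n, by simp⟩

lemma DL_apply (f : ArithmeticFunction ℂ) (n : ℕ) : DL f n = f n * Complex.log n := rfl

lemma DL_mul (f g : ArithmeticFunction ℂ) : DL (f * g) = DL f * g + f * DL g := by
  ext n
  simp only [DL_apply, ArithmeticFunction.add_apply, ArithmeticFunction.mul_apply, Finset.sum_mul, ← Finset.sum_add_distrib]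
  refine Finset.sum_congr rfl fun x hx => ?_
  have h := Nat.mem_divisorsAntidiagonal.1 hx
  have h1 : x.1 ≠ 0 := by rintro h1; rw [h1] at h; simp at h; exact h.2 h.1.symm
  have h2 : x.2 ≠ 0 := by rintro h1; rw [h1] at h; simp at h; exact h.2 h.1.symm
  have : Complex.log n = Complex.log x.1 + Complex.log x.2 := by
    rw [← h.1, ← ofReal_natCast, ← ofReal_natCast, ← ofReal_natCast, ← ofReal_log, ← ofReal_log, ← ofReal_log] <;> try positivity
    push_cast
    rw [Real.log_mul (by exact_mod_cast h1) (by exact_mod_cast h2)]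
    push_cast; rfl
  rw [this]; ring

lemma good_mul {f g b c : ArithmeticFunction ℂ} (hf : DL f = f * b) (hg : DL g = g * c) :
    DL (f * g) = (f * g) * (b + c) := by
  rw [DL_mul, hf, hg]; ring

lemma good_nonneg {f b : ArithmeticFunction ℂ} (hf : DL f = f * b) (hf1 : f 1 = 1) (hb1 : b 1 = 0)
    (hb : ∀ n, 0 ≤ b n) (n : ℕ) : 0 ≤ f n := by
  induction n using Nat.strong_induction_on with
  | _ n ih =>
  rcases Nat.lt_or_ge n 2 with h | h
  · interval_cases n
    · simp
    · rw [hf1]; exact zero_le_one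
  · have h1 := congrArg (fun F => F n) hf
    simp only [DL_apply, ArithmeticFunction.mul_apply] at h1
    have h2 : 0 ≤ f n * Complex.log n := by
      rw [h1]
      refine Finset.sum_nonneg fun x hx => ?_
      have hx := Nat.mem_divisorsAntidiagonal.1 hx
      rcases eq_or_ne x.2 1 with h3 | h3
      · rw [h3, hb1]; simp
      · refine mul_nonneg (ih _ ?_) (hb _)
        have : x.2 ≠ 0 := by rintro h1; rw [h1] at hx; simp at hx; omega
        have h4 : x.1 ≠ 0 := by rintro h1; rw [h1] at hx; simp at hx; omega
        rw [← hx.1]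
        have : 2 ≤ x.2 := by omega
        nlinarith [Nat.pos_of_ne_zero h4]
    have hl : 0 < Real.log n := Real.log_pos (by exact_mod_cast h)
    have : f n = (f n * Complex.log n) * ((Real.log n)⁻¹ : ℝ) := by
      have e : Complex.log n = (Real.log n : ℝ) := by
        rw [ofReal_log (by positivity), ofReal_natCast]
      rw [e, ofReal_inv]
      have : ((Real.log n : ℝ) : ℂ) ≠ 0 := by exact_mod_cast hl.ne'
      field_simp
    rw [this]
    exact mul_nonneg h2 (by exact_mod_cast (inv_pos.2 hl).le)

/-- arithmetic function of a character -/
noncomputable def AX {q : ℕ} (χ : DirichletCharacter ℂ q) : ArithmeticFunction ℂ :=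
  toArithmeticFunction (fun n => χ (n : ZMod q))

noncomputable def BX {q : ℕ} (χ : DirichletCharacter ℂ q) : ArithmeticFunction ℂ :=
  toArithmeticFunction (fun n => χ (n : ZMod q) * Λ n)

lemma AX_one {q : ℕ} (χ : DirichletCharacter ℂ q) : AX χ 1 = 1 := by
  simp [AX, toArithmeticFunction]

lemma BX_one {q : ℕ} (χ : DirichletCharacter ℂ q) : BX χ 1 = 0 := by
  simp [BX, toArithmeticFunction]

lemma BX_apply {q : ℕ} (χ : DirichletCharacter ℂ q) {n : ℕ} : BX χ n = χ n * Λ n := by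
  rcases eq_or_ne n 0 with rfl | h
  · simp [BX, toArithmeticFunction]
  · simp [BX, toArithmeticFunction, h]

lemma AX_apply {q : ℕ} (χ : DirichletCharacter ℂ q) {n : ℕ} (h : n ≠ 0) : AX χ n = χ n := by
  simp [AX, toArithmeticFunction, h]

lemma one_mod_one (n : ℕ) : (1 : DirichletCharacter ℂ 1) (n : ZMod 1) = 1 := by
  rw [MulChar.one_apply]
  exact isUnit_of_subsingleton _

lemma good_AX {q : ℕ} (χ : DirichletCharacter ℂ q) : DL (AX χ) = AX χ * BX χ := by
  have h := DirichletCharacter.convolution_twist_vonMangoldt χ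
  ext n
  have h2 := congrFun h n
  rw [mul_comm]
  rcases eq_or_ne n 0 with rfl | hn
  · simp
  rw [DL_apply, AX_apply _ hn]
  exact h2.symm

lemma AX_LSeries {q : ℕ} [NeZero q] (χ : DirichletCharacter ℂ q) {s : ℂ} (hs : 1 < s.re) :
    LSeriesHasSum (AX χ) s (χ.LFunction s) := by
  rw [χ.LFunction_eq_LSeries hs]
  have h := (LSeriesSummable_of_bounded_of_one_lt_re (f := fun n : ℕ => χ n) (m := 1) (fun n _ => χ.norm_le_one _) hs).LSeriesHasSum
  have : ∀ {n : ℕ}, n ≠ 0 → (fun n : ℕ => χ n) n = AX χ n := fun {n} hn => (AX_apply χ hn).symm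
  rw [show LSeries (fun n : ℕ => χ n) s = LSeries (AX χ) s from LSeries_congr this s]
  refine LSeriesSummable.LSeriesHasSum ?_
  refine (LSeriesSummable_congr s this).1 h.LSeriesSummable

lemma real_val {q : ℕ} {χ : DirichletCharacter ℂ q} (h : χ^2 = 1) (n : ZMod q) :
    χ n = 0 ∨ χ n = 1 ∨ χ n = -1 := MulChar.isQuadratic_iff_sq_eq_one.mpr h n

lemma nonneg_two {q : ℕ} [NeZero q] {χ : DirichletCharacter ℂ q} (h : χ^2 = 1) :
    ∃ a : ℕ → ℂ, 0 ≤ a ∧ a 1 = 1 ∧ ∀ s : ℂ, 1 < s.re → LSeriesSummable a s ∧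
      LSeries a s = riemannZeta s * χ.LFunction s := by
  refine ⟨(AX (1 : DirichletCharacter ℂ 1) * AX χ : ArithmeticFunction ℂ), ?_, ?_, ?_⟩
  · intro n
    refine good_nonneg (good_mul (good_AX _) (good_AX _)) ?_ ?_ ?_ n
    · simp [ArithmeticFunction.mul_apply, AX_one]
    · simp [BX_one]
    · intro n
      rw [ArithmeticFunction.add_apply, BX_apply, BX_apply, ← add_mul]
      have : (0:ℂ) ≤ Λ n := by exact_mod_cast vonMangoldt_nonneg
      refine mul_nonneg ?_ this
      rw [one_mod_one]
      rcases real_val h (n : ZMod q) with h | h | h <;> rw [h] <;> norm_num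
  · simp [ArithmeticFunction.mul_apply, AX_one]
  · intro s hs
    have := LSeriesHasSum_mul (AX_LSeries (1 : DirichletCharacter ℂ 1) hs) (AX_LSeries χ hs)
    rw [DirichletCharacter.LFunction_modOne_eq] at this
    exact ⟨this.LSeriesSummable, this.LSeries_eq⟩

/-- product of characters of different level -/
noncomputable def prodC {q r : ℕ} (χ : DirichletCharacter ℂ q) (ψ : DirichletCharacter ℂ r) :
    DirichletCharacter ℂ (q * r) :=
  DirichletCharacter.changeLevel (dvd_mul_right q r) χ * DirichletCharacter.changeLevel (dvd_mul_left r q) ψ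

lemma changeLevel_val {q N : ℕ} (h : q ∣ N) (χ : DirichletCharacter ℂ q) (n : ℕ) (hn : n.Coprime N) :
    DirichletCharacter.changeLevel h χ n = χ n := by
  have := DirichletCharacter.changeLevel_eq_cast_of_dvd χ h (ZMod.unitOfCoprime n hn)
  rw [ZMod.coe_unitOfCoprime] at this
  rw [this]
  congr 1
  rw [ZMod.cast_natCast h]

lemma char_zero {q : ℕ} (χ : DirichletCharacter ℂ q) (n : ℕ) (hn : ¬ n.Coprime q) : χ n = 0 := by
  refine MulChar.map_nonunit _ ?_
  rwa [ZMod.isUnit_iff_coprime]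

lemma prodC_val {q r : ℕ} (χ : DirichletCharacter ℂ q) (ψ : DirichletCharacter ℂ r) (n : ℕ) :
    prodC χ ψ n = χ n * ψ n := by
  by_cases hn : n.Coprime (q * r)
  · rw [prodC, MulChar.mul_apply, changeLevel_val _ _ _ hn, changeLevel_val _ _ _ hn]
  · rw [char_zero _ _ hn]
    rw [Nat.coprime_mul_iff_right, not_and_or] at hn
    rcases hn with hn | hn <;> rw [char_zero _ _ hn] <;> simp

lemma nonneg_four {q r : ℕ} [NeZero q] [NeZero r] {χ : DirichletCharacter ℂ q} {ψ : DirichletCharacter ℂ r}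
    (h : χ^2 = 1) (h' : ψ^2=1) :
    ∃ a : ℕ → ℂ, 0 ≤ a ∧ a 1 = 1 ∧ ∀ s : ℂ, 1 < s.re → LSeriesSummable a s ∧
      LSeries a s = riemannZeta s * (χ.LFunction s * ψ.LFunction s * (prodC χ ψ).LFunction s) := by
  refine ⟨(AX (1 : DirichletCharacter ℂ 1) * (AX χ * AX ψ * AX (prodC χ ψ)) : ArithmeticFunction ℂ), ?_, ?_, ?_⟩
  · intro n
    refine good_nonneg (good_mul (good_AX _) (good_mul (good_mul (good_AX _) (good_AX _)) (good_AX _))) ?_ ?_ ?_ n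
    · simp [ArithmeticFunction.mul_apply, AX_one]
    · simp [BX_one]
    · intro n
      simp only [ArithmeticFunction.add_apply, BX_apply, ← add_mul]
      have : (0:ℂ) ≤ Λ n := by exact_mod_cast vonMangoldt_nonneg
      refine mul_nonneg ?_ this
      rw [prodC_val, one_mod_one]
      rcases real_val h (n : ZMod q) with h | h | h <;> rcases real_val h' (n : ZMod r) with h' | h' | h' <;> rw [h, h'] <;> norm_num
  · simp [ArithmeticFunction.mul_apply, AX_one]
  · intro s hs
    have := LSeriesHasSum_mul (AX_LSeries (1 : DirichletCharacter ℂ 1) hs) (LSeriesHasSum_mul (LSeriesHasSum_mul (AX_LSeries χ hs) (AX_LSeries ψ hs)) (AX_LSeries (prodC χ ψ) hs))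
    rw [DirichletCharacter.LFunction_modOne_eq] at this
    exact ⟨this.LSeriesSummable, this.LSeries_eq⟩

lemma conj_LSeries {f : ℕ → ℂ} (hf : ∀ n, conj (f n) = f n) (s : ℂ) : conj (LSeries f (conj s)) = LSeries f s := by
  rw [LSeries, Complex.conj_tsum, LSeries]
  congr 1; ext n
  rcases eq_or_ne n 0 with rfl | hn
  · simp
  rw [LSeries.term_of_ne_zero hn, LSeries.term_of_ne_zero hn, map_div₀, hf]
  congr 1
  have := Complex.cpow_conj (n:ℂ) s (by rw [Complex.natCast_arg]; exact Real.pi_pos.ne)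
  rw [this]; simp

lemma real_of_entire {F : ℂ → ℂ} (hF : Differentiable ℂ F) (h : ∀ s : ℂ, 1 < s.re → conj (F (conj s)) = F s)
    (x : ℝ) : F x = (F x).re := by
  have h1 : Differentiable ℂ (conj ∘ F ∘ conj) := fun s => by
    have := (hF (conj s)).conj_conj
    simpa using this
  have h2 : (conj ∘ F ∘ conj) = F := by
    refine AnalyticOnNhd.eq_of_eventuallyEq (z₀ := 2) (h1.differentiableOn.analyticOnNhd isOpen_univ) (hF.differentiableOn.analyticOnNhd isOpen_univ) ?_
    have : ∀ᶠ s : ℂ in 𝓝 2, 1 < s.re := 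
      (continuous_re.isOpen_preimage _ isOpen_Ioi).mem_nhds (by simp)
    filter_upwards [this] with s hs
    exact h s hs
  have h3 := congrFun h2 x
  simp only [Function.comp, conj_ofReal] at h3
  exact (Complex.conj_eq_iff_re.1 h3).symm

lemma W_real (x : ℝ) : W x = (W x).re := by
  refine real_of_entire W_diff (fun s hs => ?_) x
  have h1 : s ≠ 1 := by rintro rfl; simp at hs
  have h2 : conj s ≠ 1 := by intro h; apply h1; rw [← conj_conj s, h]; simp
  rw [W_ne h1, W_ne h2, map_mul]
  have hs' : 1 < (conj s).re := by simpa using hs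
  rw [← LSeries_one_eq_riemannZeta hs, ← LSeries_one_eq_riemannZeta hs', conj_LSeries (by simp)]
  simp

lemma L_real {q : ℕ} [NeZero q] {χ : DirichletCharacter ℂ q} (h : χ^2 = 1) (h1 : χ ≠ 1) (x : ℝ) :
    χ.LFunction x = (χ.LFunction x).re := by
  refine real_of_entire (DirichletCharacter.differentiable_LFunction h1) (fun s hs => ?_) x
  have hs' : 1 < (conj s).re := by simpa using hs
  rw [χ.LFunction_eq_LSeries hs, χ.LFunction_eq_LSeries hs', conj_LSeries]
  intro n
  rcases real_val h (n : ZMod q) with h | h | h <;> rw [h] <;> simp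

lemma L_one_pos {q : ℕ} [NeZero q] {χ : DirichletCharacter ℂ q} (h : χ^2 = 1) (h1 : χ ≠ 1) :
    0 < (χ.LFunction 1).re := by
  have hne := DirichletCharacter.LFunction_apply_one_ne_zero h1
  have hr := L_real h h1 1
  rw [ofReal_one] at hr
  refine lt_of_le_of_ne ?_ (fun h2 => hne (by rw [hr, ← h2]; simp))
  obtain ⟨a, ha, ha1, hs⟩ := nonneg_two h
  have hcont : Continuous fun x : ℝ => (W x * χ.LFunction x).re := by
    have hc1 := (DirichletCharacter.differentiable_LFunction h1).continuous
    have := W_diff.continuous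
    exact continuous_re.comp ((this.comp continuous_ofReal).mul (hc1.comp continuous_ofReal))
  have h3 : Filter.Tendsto (fun x : ℝ => (W x * χ.LFunction x).re) (𝓝[>] 1) (𝓝 (χ.LFunction 1).re) := by
    have := hcont.tendsto 1
    simp only [ofReal_one, W_one, one_mul] at this
    exact this.mono_left nhdsWithin_le_nhds
  refine ge_of_tendsto h3 ?_
  filter_upwards [self_mem_nhdsWithin] with x (hx : 1 < x)
  have hxne : (x:ℂ) ≠ 1 := by exact_mod_cast hx.ne'
  rw [W_ne hxne, mul_assoc, ← (hs x (by simpa using hx)).2]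
  have : (0:ℂ) ≤ LSeries a x := by
    rw [LSeries]
    exact tsum_nonneg fun n => LSeries.term_nonneg (ha n) x
  have h5 : (x:ℂ) - 1 = ((x - 1 : ℝ):ℂ) := by push_cast; rfl
  rw [h5, re_ofReal_mul]
  exact mul_nonneg (by linarith) (Complex.nonneg_iff.1 this).1

end SW

namespace SW
open Complex ComplexOrder Topology

lemma L_ball {q : ℕ} [NeZero q] {χ : DirichletCharacter ℂ q} (h1 : χ ≠ 1) (s : ℂ) 
    (hs : s ∈ Metric.closedBall (2:ℂ) (3/2)) : ‖χ.LFunction s‖ ≤ 56 * q := by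
  rw [Metric.mem_closedBall, dist_eq_norm] at hs
  have hre := abs_le.1 ((Complex.abs_re_le_norm _).trans hs)
  have him := (Complex.abs_im_le_norm _).trans hs
  simp at hre him
  have := norm_L_le (1/2) (by norm_num) (by norm_num) χ h1 s (by linarith) (by linarith)
  refine this.trans ?_
  norm_num
  have hq : (0:ℝ) ≤ q := by positivity
  nlinarith

lemma zero_lift {q r : ℕ} [NeZero q] [NeZero r] {χ : DirichletCharacter ℂ q} {ψ : DirichletCharacter ℂ r}
    (h' : ψ^2=1) (hχ1 : χ ≠ 1) (hψ1 : ψ ≠ 1) (hp : prodC χ ψ = 1) {β : ℝ} (hβ : 0 < β)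
    (hz : χ.LFunction β = 0) : ψ.LFunction β = 0 := by
  have : NeZero (q * r) := ⟨mul_ne_zero (NeZero.ne q) (NeZero.ne r)⟩
  have h2 : DirichletCharacter.changeLevel (dvd_mul_left r q) ψ * DirichletCharacter.changeLevel (dvd_mul_left r q) ψ = 1 := by
    rw [← map_mul, ← pow_two, h', map_one]
  have e : DirichletCharacter.changeLevel (dvd_mul_right q r) χ = DirichletCharacter.changeLevel (dvd_mul_left r q) ψ := by
    have h3 : DirichletCharacter.changeLevel (dvd_mul_right q r) χ * DirichletCharacter.changeLevel (dvd_mul_left r q) ψ = 1 := hp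
    calc _ = DirichletCharacter.changeLevel (dvd_mul_right q r) χ * DirichletCharacter.changeLevel (dvd_mul_left r q) ψ * DirichletCharacter.changeLevel (dvd_mul_left r q) ψ := by
          rw [mul_assoc, h2, mul_one]
      _ = _ := by rw [h3, one_mul]
  have e1 := DirichletCharacter.LFunction_changeLevel (dvd_mul_right q r) χ (s := β) (Or.inl hχ1)
  have e2 := DirichletCharacter.LFunction_changeLevel (dvd_mul_left r q) ψ (s := β) (Or.inl hψ1)
  rw [e, e2, hz, zero_mul] at e1
  refine (mul_eq_zero.1 e1).resolve_right ?_
  refine Finset.prod_ne_zero_iff.2 ?_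
  intro p hp
  have hpp := Nat.prime_of_mem_primeFactors hp
  intro h0
  have h4 : ‖ψ p * (p:ℂ)^(-(β:ℂ))‖ < 1 := by
    rw [norm_mul, ← Complex.ofReal_neg, Complex.norm_natCast_cpow_of_pos hpp.pos]
    have h5 := ψ.norm_le_one p
    have h6 : (p:ℝ)^((-β:ℝ):ℂ).re < 1 := by
      rw [ofReal_re]
      exact Real.rpow_lt_one_of_one_lt_of_neg (by exact_mod_cast hpp.one_lt) (by linarith)
    have h7 : 0 ≤ (p:ℝ)^((-β:ℝ):ℂ).re := by positivity
    nlinarith [norm_nonneg (ψ p)]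
  rw [← sub_eq_zero.1 h0] at h4
  simp at h4

/-- Theorem of Siegel -/
theorem siegel (ε : ℝ) (hε : 0 < ε) : ∃ c : ℝ, 0 < c ∧ ∀ (q : ℕ) [NeZero q] (χ : DirichletCharacter ℂ q),
    χ^2 = 1 → χ ≠ 1 → c * (q:ℝ)^(-(3*ε)) ≤ (χ.LFunction 1).re := by
  wlog hε2 : ε ≤ 1/2 generalizing ε
  · obtain ⟨c, hc, h⟩ := this (1/2) (by norm_num) le_rfl
    refine ⟨c, hc, fun q _ χ h1 h2 => le_trans ?_ (h q χ h1 h2)⟩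
    have : (1:ℝ) ≤ q := by exact_mod_cast NeZero.one_le
    gcongr
    linarith
  obtain ⟨c, K, hc, hK, hest⟩ := estermann
  have hWc : ∀ᶠ η : ℝ in 𝓝 0, 0 < (W ((1 - η : ℝ) : ℂ)).re := by
    have hcont : Continuous fun η : ℝ => (W ((1 - η : ℝ) : ℂ)).re :=
      continuous_re.comp (W_diff.continuous.comp (continuous_ofReal.comp (by fun_prop)))
    refine hcont.continuousAt.eventually (lt_mem_nhds ?_)
    simp [W_one]
  obtain ⟨δ, hδ, hδW⟩ := Metric.eventually_nhds_iff.1 hWc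
  set η := min (min (1/4) (ε/(3*K))) (δ/2) with hη
  have hη0 : 0 < η := by positivity
  have hη1 : η ≤ 1/4 := (min_le_left _ _).trans (min_le_left _ _)
  have hηK : 3 * K * η ≤ ε := by
    have : η ≤ ε/(3*K) := (min_le_left _ _).trans (min_le_right _ _)
    rw [le_div_iff₀ (by positivity)] at this; linarith
  have hηW : 0 < (W ((1 - η : ℝ) : ℂ)).re := by
    refine hδW ?_
    rw [Real.dist_eq, sub_zero, abs_of_pos hη0]
    exact (min_le_right _ _).trans_lt (by linarith)
  have hζ : ∃ z : ℝ, z < 0 ∧ riemannZeta ((1 - η : ℝ) : ℂ) = z := by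
    have hne : ((1 - η : ℝ) : ℂ) ≠ 1 := by
      intro h; have := congrArg Complex.re h; simp at this; linarith
    refine ⟨-((W ((1 - η : ℝ) : ℂ)).re / η), by have := div_pos hηW hη0; linarith, ?_⟩
    have h1 := W_ne hne
    rw [W_real] at h1
    have h2 : ((1 - η : ℝ) : ℂ) - 1 = -η := by push_cast; ring
    rw [h2] at h1
    have h3 : (η:ℂ) ≠ 0 := by exact_mod_cast hη0.ne'
    push_cast at h1 ⊢
    rw [h1]
    field_simp
  obtain ⟨z, hz0, hz⟩ := hζ
  -- single-character consequence
  have hsingle : ∀ β : ℝ, 1 - η ≤ β → β < 1 → ∀ (q : ℕ) [NeZero q] (χ : DirichletCharacter ℂ q),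
    χ^2 = 1 → χ ≠ 1 → (riemannZeta β * χ.LFunction β).re ≤ 0 → 
      c * (1-β) * (56:ℝ)^(-ε) * (q:ℝ)^(-(3*ε)) ≤ (χ.LFunction 1).re := by
    intro β hβ hβ1 q _ χ h h1 hneg
    obtain ⟨a, ha, ha1, hs⟩ := nonneg_two h
    have hq : (1:ℝ) ≤ q := by exact_mod_cast NeZero.one_le
    have := hest χ.LFunction a (56*q) β (DirichletCharacter.differentiable_LFunction h1) ha ha1 hs (by linarith) (L_ball h1) (by linarith) hβ1 hneg
    refine le_trans ?_ this
    rw [mul_assoc (c * (1-β))]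
    have hcb : 0 ≤ c * (1-β) := mul_nonneg hc.le (by linarith)
    refine mul_le_mul_of_nonneg_left ?_ hcb
    have h3 : K * (1-β) ≤ ε := by nlinarith
    calc (56:ℝ)^(-ε) * (q:ℝ)^(-(3*ε)) ≤ (56:ℝ)^(-ε) * (q:ℝ)^(-ε) := by
          gcongr
          linarith
      _ = (56 * (q:ℝ))^(-ε) := (Real.mul_rpow (by norm_num) (by linarith)).symm
      _ ≤ _ := by
        gcongr
        linarith
  by_cases hA : ∀ (q : ℕ) [NeZero q] (χ : DirichletCharacter ℂ q), χ^2 = 1 → χ ≠ 1 → 0 ≤ (χ.LFunction ((1 - η : ℝ) : ℂ)).re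
  · refine ⟨c * (1-(1-η)) * (56:ℝ)^(-ε), by simp; positivity, fun q _ χ h h1 => ?_⟩
    refine hsingle (1-η) le_rfl (by linarith) q χ h h1 ?_
    rw [hz, re_ofReal_mul]
    exact mul_nonpos_of_nonpos_of_nonneg hz0.le (hA q χ h h1)
  push Not at hA
  obtain ⟨q1, hq1i, χ1, h, h1, hneg⟩ := hA
  -- a zero
  obtain ⟨β, hβ, hβz⟩ : ∃ β ∈ Set.Icc (1-η) 1, (χ1.LFunction β).re = 0 := by
    have hcont : Continuous fun x : ℝ => (χ1.LFunction x).re :=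
      continuous_re.comp ((DirichletCharacter.differentiable_LFunction h1).continuous.comp continuous_ofReal)
    have := intermediate_value_Icc (by linarith : 1-η ≤ 1) hcont.continuousOn
    have h2 := L_one_pos h h1
    obtain ⟨β, hb, hb2⟩ := this (show (0:ℝ) ∈ _ from ⟨hneg.le, by simpa using h2.le⟩)
    exact ⟨β, hb, hb2⟩
  have hz1 : χ1.LFunction β = 0 := by rw [L_real h h1, hβz]; simp
  have hβ1 : β < 1 := by
    refine lt_of_le_of_ne hβ.2 ?_
    rintro rfl
    exact DirichletCharacter.LFunction_apply_one_ne_zero h1 (by simpa using hz1)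
  have hb0 : 0 < 1 - β := by linarith
  have hβη : 1 - η ≤ β := hβ.1
  have hq1 : (1:ℝ) ≤ q1 := by exact_mod_cast NeZero.one_le
  set B := 2 * (6 + 1/ε) * 2^(2*ε) * (q1:ℝ)^(2*ε) with hB
  have hB0 : 0 < B := by positivity
  refine ⟨min (c * (1-β) * (56:ℝ)^(-ε)) (c * (1-β) * (56:ℝ)^(-ε) * (q1:ℝ)^(-ε) / (56 * q1) / B), ?_, ?_⟩
  · positivity
  intro q _ χ h' h1'
  have hq : (1:ℝ) ≤ q := by exact_mod_cast NeZero.one_le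
  by_cases hp : prodC χ1 χ = 1
  · refine le_trans ?_ (hsingle β hβη hβ1 q χ h' h1' ?_)
    · gcongr
      exact min_le_left _ _
    · rw [zero_lift h' h1 h1' hp (by linarith) hz1]; simp
  · have : NeZero (q1 * q) := ⟨mul_ne_zero (NeZero.ne q1) (NeZero.ne q)⟩
    obtain ⟨a, ha, ha1, hs⟩ := nonneg_four h h'
    set Q : ℝ := 56 * (q1 * q) with hQ
    have hQ1 : 1 ≤ Q := by rw [hQ]; nlinarith
    have := hest (fun s => χ1.LFunction s * χ.LFunction s * (prodC χ1 χ).LFunction s) a (Q^3) β 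
      (((DirichletCharacter.differentiable_LFunction h1).mul (DirichletCharacter.differentiable_LFunction h1')).mul (DirichletCharacter.differentiable_LFunction hp)) ha ha1 hs
      (one_le_pow₀ hQ1) ?_ (by linarith) hβ1 (by simp [hz1])
    swap
    · intro s hs
      have e1 := L_ball h1 s hs
      have e2 := L_ball h1' s hs
      have e3 := L_ball hp s hs
      push_cast at e3
      have e1' : ‖χ1.LFunction s‖ ≤ Q := e1.trans (by rw [hQ]; nlinarith)
      have e2' : ‖χ.LFunction s‖ ≤ Q := e2.trans (by rw [hQ]; nlinarith)
      rw [norm_mul, norm_mul]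
      calc _ ≤ Q * Q * Q := by gcongr
        _ = _ := by ring
    have hR : c * (1-β) * ((56:ℝ)^(-ε) * ((q1:ℝ)^(-ε) * (q:ℝ)^(-ε))) ≤ c * (1-β) * (Q^3)^(-(K*(1-β))) := by
      refine mul_le_mul_of_nonneg_left ?_ (by positivity)
      rw [← Real.mul_rpow (by positivity) (by positivity), ← Real.mul_rpow (by positivity) (by positivity), ← hQ,
        ← Real.rpow_natCast, ← Real.rpow_mul (by linarith)]
      apply Real.rpow_le_rpow_of_exponent_le hQ1
      push_cast
      nlinarith
    have hn := (hR.trans this).trans ((le_abs_self _).trans (Complex.abs_re_le_norm _))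
    rw [norm_mul, norm_mul] at hn
    have e1 := L_ball h1 1 (by rw [Metric.mem_closedBall, dist_eq_norm]; norm_num)
    have e3 := norm_L_le ε hε hε2 (prodC χ1 χ) hp 1 (by simp; linarith) (by norm_num)
    have e3' : ‖(prodC χ1 χ).LFunction 1‖ ≤ B * (q:ℝ)^(2*ε) := by
      refine e3.trans (le_of_eq ?_)
      simp only [one_im, abs_zero, zero_add]
      push_cast
      rw [Real.mul_rpow (by positivity) (by positivity), Real.mul_rpow (by positivity) (by positivity), hB]
      ring
    have e2 : ‖χ.LFunction 1‖ = (χ.LFunction 1).re := by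
      have hr := L_real h' h1' 1
      rw [ofReal_one] at hr
      rw [hr, Complex.norm_real, Real.norm_eq_abs, abs_of_pos (L_one_pos h' h1')]; simp
    have hL := L_one_pos h' h1'
    rw [e2] at hn
    have hn2 : c * (1-β) * ((56:ℝ)^(-ε) * ((q1:ℝ)^(-ε) * (q:ℝ)^(-ε))) ≤ (56*q1) * (χ.LFunction 1).re * (B * (q:ℝ)^(2*ε)) := 
      hn.trans (by gcongr)
    have hqe : (q:ℝ)^(-(3*ε)) = (q:ℝ)^(-ε) / (q:ℝ)^(2*ε) := by
      rw [← Real.rpow_sub (by linarith)]; congr 1; ring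
    have hq2 : 0 < (q:ℝ)^(2*ε) := by positivity
    calc _ ≤ (c * (1-β) * (56:ℝ)^(-ε) * (q1:ℝ)^(-ε) / (56 * q1) / B) * (q:ℝ)^(-(3*ε)) := by
          gcongr
          exact min_le_right _ _
      _ = (c * (1-β) * ((56:ℝ)^(-ε) * ((q1:ℝ)^(-ε) * (q:ℝ)^(-ε)))) / (56*q1*(B * (q:ℝ)^(2*ε))) := by
          rw [hqe]; field_simp
      _ ≤ _ := by
        rw [div_le_iff₀ (by positivity)]
        linarith
end SW

namespace SW
open Complex Topology

lemma two_pow_omega (ε : ℝ) (hε : 0 < ε) : ∃ C : ℝ, 1 ≤ C ∧ ∀ q : ℕ, q ≠ 0 → (2:ℝ)^q.primeFactors.card ≤ C * (q:ℝ)^ε := by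
  set P := ⌈(2:ℝ)^(1/ε)⌉₊ with hP
  refine ⟨2^P, one_le_pow₀ (by norm_num), fun q hq => ?_⟩
  have h1 : ∀ p ∈ q.primeFactors, (2:ℝ) ≤ (if p < P then 2 else 1) * (p:ℝ)^ε := by
    intro p hp
    have hpp := Nat.prime_of_mem_primeFactors hp
    have hp1 : (1:ℝ) ≤ p := by exact_mod_cast hpp.one_lt.le
    split_ifs with h
    · have := Real.one_le_rpow hp1 hε.le
      linarith
    · have : (2:ℝ)^(1/ε) ≤ p := (Nat.le_ceil _).trans (by exact_mod_cast not_lt.1 h)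
      have := Real.rpow_le_rpow (by positivity) this hε.le
      rw [← Real.rpow_mul (by norm_num), one_div_mul_cancel hε.ne', Real.rpow_one] at this
      linarith
  calc (2:ℝ)^q.primeFactors.card = ∏ p ∈ q.primeFactors, (2:ℝ) := by rw [Finset.prod_const]
    _ ≤ ∏ p ∈ q.primeFactors, ((if p < P then 2 else 1) * (p:ℝ)^ε) := Finset.prod_le_prod (by intros; norm_num) h1
    _ = (∏ p ∈ q.primeFactors, (if p < P then (2:ℝ) else 1)) * ∏ p ∈ q.primeFactors, (p:ℝ)^ε := Finset.prod_mul_distrib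
    _ ≤ 2^P * (q:ℝ)^ε := by
      gcongr
      · rw [← Finset.prod_filter, Finset.prod_const]
        refine pow_le_pow_right₀ (by norm_num) ?_
        calc _ ≤ (Finset.range P).card := Finset.card_le_card (fun p hp => by
                simp only [Finset.mem_filter] at hp; simpa using hp.2)
          _ = P := by simp
      · rw [Real.finsetProd_rpow _ _ (by intros; positivity)]
        refine Real.rpow_le_rpow (Finset.prod_nonneg (by intros; positivity)) ?_ hε.le
        have := Nat.le_of_dvd (Nat.pos_of_ne_zero hq) (Nat.prod_primeFactors_dvd q)
        calc ∏ i ∈ q.primeFactors, (i:ℝ) = ((∏ i ∈ q.primeFactors, i : ℕ) : ℝ) := by push_cast; rfl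
          _ ≤ q := by exact_mod_cast this

/-- derivative bound by Cauchy -/
lemma deriv_bound {f : ℂ → ℂ} {s : ℂ} {r M : ℝ} (hr : 0 < r) 
    (hf : ∀ w ∈ Metric.closedBall s r, DifferentiableAt ℂ f w) (hM : ∀ w ∈ Metric.closedBall s r, ‖f w‖ ≤ M) :
    ‖deriv f s‖ ≤ M / r := by
  refine Complex.norm_deriv_le_of_forall_mem_sphere_norm_le hr ?_ (fun w hw => hM w (Metric.sphere_subset_closedBall hw))
  refine DifferentiableOn.diffContOnCl ?_
  rw [closure_ball _ hr.ne']
  exact fun w hw => (hf w hw).differentiableWithinAt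

lemma ball_re_im {s w : ℂ} {r : ℝ} (hw : w ∈ Metric.closedBall s r) :
    s.re - r ≤ w.re ∧ w.re ≤ s.re + r ∧ |w.im| ≤ |s.im| + r ∧ |s.im| ≤ |w.im| + r := by
  rw [Metric.mem_closedBall, dist_eq_norm] at hw
  have hre := abs_le.1 ((Complex.abs_re_le_norm _).trans hw)
  have him := (Complex.abs_im_le_norm _).trans hw
  simp only [sub_re, sub_im] at hre him
  have h1 := abs_sub_abs_le_abs_sub w.im s.im
  have h2 := abs_sub_abs_le_abs_sub s.im w.im
  rw [abs_sub_comm] at h2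
  refine ⟨by linarith, by linarith, by linarith, by linarith⟩

lemma rpow_two_mul_le {X Y ε : ℝ} (hX : 0 ≤ X) (hY : 0 ≤ Y) (h : Y ≤ 2 * X) (hε : 0 < ε) (hε2 : ε ≤ 1/2) :
    Y^(2*ε) ≤ 2 * X^(2*ε) := by
  calc Y^(2*ε) ≤ (2*X)^(2*ε) := by gcongr
    _ = 2^(2*ε) * X^(2*ε) := Real.mul_rpow (by norm_num) hX
    _ ≤ 2^(1:ℝ) * X^(2*ε) := by gcongr; norm_num; linarith
    _ = _ := by simp

lemma L_upper (ε : ℝ) (hε : 0 < ε) (hε2 : ε ≤ 1/2) : ∃ A : ℝ, 1 ≤ A ∧ ∀ (q : ℕ) [NeZero q] (χ : DirichletCharacter ℂ q),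
    χ ≠ 1 → ∀ s : ℂ, 1 - ε/2 ≤ s.re → s.re ≤ 3 → ‖χ.LFunction s‖ ≤ A * (q * (|s.im| + 2))^(2*ε) ∧
    ‖deriv χ.LFunction s‖ ≤ A * (q * (|s.im| + 2))^(2*ε) := by
  refine ⟨8 * (6 + 1/ε) / ε, ?_, ?_⟩
  · rw [le_div_iff₀ hε]
    have : 0 < 1/ε := by positivity
    nlinarith
  intro q _ χ hχ s hs hs3
  have hall : ∀ w ∈ Metric.closedBall s (ε/2), ‖χ.LFunction w‖ ≤ 4 * (6+1/ε) * (q * (|s.im| + 2))^(2*ε) := by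
    intro w hw
    obtain ⟨h1, h2, h3, h4⟩ := ball_re_im hw
    refine (norm_L_le ε hε hε2 χ hχ w (by linarith) (by linarith)).trans ?_
    have : (q * (|w.im| + 2))^(2*ε) ≤ 2 * (q * (|s.im| + 2))^(2*ε) := by
      refine rpow_two_mul_le (by positivity) (by positivity) ?_ hε hε2
      have : (0:ℝ) ≤ q := by positivity
      have := abs_nonneg s.im
      nlinarith
    have h0 : 0 < 6 + 1/ε := by positivity
    nlinarith
  have hX : 0 ≤ (q * (|s.im| + 2))^(2*ε) := by positivity
  constructor
  · refine (hall s (Metric.mem_closedBall_self (by positivity))).trans ?_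
    gcongr
    rw [le_div_iff₀ hε]
    have h0 : 0 < 6 + 1/ε := by positivity
    nlinarith
  · refine (deriv_bound (by positivity) (fun w _ => DirichletCharacter.differentiable_LFunction hχ w) hall).trans (le_of_eq ?_)
    field_simp; ring

lemma zeta_upper (ε : ℝ) (hε : 0 < ε) (hε2 : ε ≤ 1/2) : ∃ A : ℝ, 1 ≤ A ∧ ∀ s : ℂ, 1/2 ≤ |s.im| → 
    1 - ε/2 ≤ s.re → s.re ≤ 3 → ‖riemannZeta s‖ ≤ A * (|s.im| + 2)^(2*ε) ∧
    ‖deriv riemannZeta s‖ ≤ A * (|s.im| + 2)^(2*ε) := by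
  refine ⟨40 * (6 + 1/ε) / ε, ?_, ?_⟩
  · rw [le_div_iff₀ hε]
    have : 0 < 1/ε := by positivity
    nlinarith
  intro s him hs hs3
  have hne : ∀ w ∈ Metric.closedBall s (ε/2), 1/4 ≤ ‖w - 1‖ ∧ w ≠ 1 := by
    intro w hw
    obtain ⟨h1, h2, h3, h4⟩ := ball_re_im hw
    have h5 := Complex.abs_im_le_norm (w - 1)
    simp at h5
    refine ⟨by linarith, ?_⟩
    rintro rfl
    simp at h4; linarith
  have hall : ∀ w ∈ Metric.closedBall s (ε/2), ‖riemannZeta w‖ ≤ 20 * (6+1/ε) * (|s.im| + 2)^(2*ε) := by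
    intro w hw
    obtain ⟨h1, h2, h3, h4⟩ := ball_re_im hw
    obtain ⟨h5, h6⟩ := hne w hw
    refine (norm_zeta_le ε hε hε2 w (by linarith) (by linarith) h6).trans ?_
    have h7 : (|w.im| + 2)^(2*ε) ≤ 2 * (|s.im| + 2)^(2*ε) := by
      refine rpow_two_mul_le (by positivity) (by positivity) ?_ hε hε2
      have := abs_nonneg s.im
      nlinarith
    have h8 : 1 / ‖w - 1‖ ≤ 4 := by rw [div_le_iff₀ (by linarith)]; linarith
    calc _ ≤ 2 * (6+1/ε) * (2 * (|s.im| + 2)^(2*ε)) * (1 + 4) := by gcongr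
      _ = _ := by ring
  constructor
  · refine (hall s (Metric.mem_closedBall_self (by positivity))).trans ?_
    gcongr
    rw [le_div_iff₀ hε]
    have h0 : 0 < 6 + 1/ε := by positivity
    nlinarith
  · refine (deriv_bound (by positivity) (fun w hw => differentiableAt_riemannZeta (hne w hw).2) hall).trans (le_of_eq ?_)
    field_simp; ring

/-- abstract 3-4-1 -/
lemma abs341 {g : ℝ → ℝ} {A V : ℝ} (hA : 1 ≤ A) (hV : 1 ≤ V) (hg : ∀ x, 0 ≤ g x)
    (h1 : ∀ x, 0 < x → x ≤ 1 → 1 ≤ (64/x)^3 * g x ^ 4 * V)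
    (h2 : ∀ x y, 0 < x → x ≤ y → y ≤ 1 → g y - g x ≤ A * (y - x)) {x : ℝ} (hx : 0 < x) (hx1 : x ≤ 1) :
    1 / (2^22 * A^4 * V) ≤ g x := by
  set x0 := 1 / (2^22 * A^4 * V) with hx0
  have hA4 : 1 ≤ A^4 := one_le_pow₀ hA
  have hAV : 1 ≤ A^4 * V := by nlinarith
  have hx0p : 0 < x0 := by positivity
  have hx01 : x0 ≤ 1 := by
    rw [hx0, div_le_one (by positivity)]
    nlinarith
  have hx0e : 2^22 * A^4 * V * x0 = 1 := by rw [hx0]; field_simp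
  have hbig : ∀ y, x0 ≤ y → y ≤ 1 → 2 * A * x0 ≤ g y := by
    intro y hy hy1
    have hyp : 0 < y := hx0p.trans_le hy
    have := h1 y hyp hy1
    have h3 : y^3 ≤ 64^3 * g y^4 * V := by
      have e : (64/y)^3 * g y ^ 4 * V = (64^3 * g y^4 * V)/y^3 := by field_simp
      rw [e, le_div_iff₀ (by positivity)] at this
      linarith
    have h4 : x0^3 ≤ y^3 := by gcongr
    have h5 : (2*A*x0)^4 ≤ g y^4 := by
      have e : x0^3 = 64^3 * (2*A*x0)^4 * V := by
        calc x0^3 = (2^22 * A^4 * V * x0) * x0^3 := by rw [hx0e, one_mul]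
          _ = _ := by ring
      have h6 : 64^3 * (2*A*x0)^4 * V ≤ 64^3 * g y^4 * V := by rw [← e]; exact h4.trans h3
      have h7 : 0 < 64^3 * V := by positivity
      nlinarith
    exact le_of_pow_le_pow_left₀ (by norm_num) (hg y) h5
  rcases le_or_gt x0 x with h | h
  · have := hbig x h hx1
    nlinarith
  · have h3 := hbig x0 le_rfl hx01
    have h4 := h2 x x0 hx h.le hx01
    nlinarith

lemma triv_bound {q : ℕ} [NeZero q] {x : ℝ} (hx : 0 < x) (hx1 : x ≤ 1) :
    ‖DirichletCharacter.LFunctionTrivChar q (1 + x)‖ ≤ 64 / x := by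
  have hne : (1:ℂ) + x ≠ 1 := by simpa using hx.ne'
  rw [DirichletCharacter.LFunctionTrivChar_eq_mul_riemannZeta hne, norm_mul]
  have h1 : ‖∏ p ∈ q.primeFactors, (1 - (p : ℂ) ^ (-(1 + x:ℂ)))‖ ≤ 1 := by
    rw [norm_prod]
    refine Finset.prod_le_one (fun _ _ => norm_nonneg _) fun p hp => ?_
    have hpp := Nat.prime_of_mem_primeFactors hp
    have e : (1 - (p : ℂ) ^ (-(1 + x:ℂ))) = ((1 - (p:ℝ)^(-(1+x)) : ℝ) : ℂ) := by
      push_cast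
      rw [ofReal_cpow (by positivity)]
      push_cast; rfl
    rw [e, Complex.norm_real, Real.norm_eq_abs, abs_le]
    have h3 : 0 ≤ (p:ℝ)^(-(1+x)) := by positivity
    have h4 : (p:ℝ)^(-(1+x)) ≤ 1 := Real.rpow_le_one_of_one_le_of_nonpos (by exact_mod_cast hpp.one_lt.le) (by linarith)
    constructor <;> linarith
  have h2 := norm_zeta_le (1/2) (by norm_num) (by norm_num) (1 + x) (by simp; linarith) (by simp; linarith) hne
  have h3 : ‖(1:ℂ) + x - 1‖ = x := by simp [abs_of_pos hx]
  rw [h3] at h2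
  norm_num at h2
  calc _ ≤ 1 * (32 * (1 + x⁻¹)) := by gcongr
    _ ≤ 64 / x := by
      rw [le_div_iff₀ hx]
      have : x⁻¹ * x = 1 := inv_mul_cancel₀ hx.ne'
      nlinarith

lemma triv_bound2 (ε : ℝ) (hε : 0 < ε) (hε2 : ε ≤ 1/2) : ∃ C : ℝ, 1 ≤ C ∧ ∀ (q : ℕ) [NeZero q] (s : ℂ), 1 < s.re → s.re ≤ 2 →
    ‖DirichletCharacter.LFunctionTrivChar q s‖ ≤ C * (q * (|s.im| + 2))^(2*ε) * (1 + 1/‖s-1‖) := by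
  obtain ⟨C, hC, hom⟩ := two_pow_omega (2*ε) (by positivity)
  refine ⟨C * (2*(6+1/ε)), ?_, ?_⟩
  · have : 0 < 1/ε := by positivity
    nlinarith
  intro q _ s hs hs2
  have hne : s ≠ 1 := by rintro rfl; simp at hs
  rw [DirichletCharacter.LFunctionTrivChar_eq_mul_riemannZeta hne, norm_mul]
  have h1 : ‖∏ p ∈ q.primeFactors, (1 - (p : ℂ) ^ (-s))‖ ≤ 2^q.primeFactors.card := by
    rw [norm_prod, ← Finset.prod_const]
    refine Finset.prod_le_prod (fun _ _ => norm_nonneg _) fun p hp => ?_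
    have hpp := Nat.prime_of_mem_primeFactors hp
    refine (norm_sub_le _ _).trans ?_
    rw [Complex.norm_natCast_cpow_of_pos hpp.pos]
    have h4 : (p:ℝ)^(-s).re ≤ 1 := Real.rpow_le_one_of_one_le_of_nonpos (by exact_mod_cast hpp.one_lt.le) (by simp; linarith)
    simp only [norm_one]; linarith
  have h2 := norm_zeta_le ε hε hε2 s (by linarith) (by linarith) hne
  have h3 := hom q (NeZero.ne q)
  rw [Real.mul_rpow (by positivity) (by positivity)]
  calc _ ≤ (C * (q:ℝ)^(2*ε)) * (2*(6+1/ε)*(|s.im| + 2)^(2*ε) * (1 + 1/‖s-1‖)) := by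
        gcongr
        exact h1.trans h3
    _ = _ := by ring

end SW

namespace SW
open Complex Topology

lemma mvt_seg {f : ℂ → ℂ} {a b : ℂ} {A : ℝ} (hf : ∀ w ∈ segment ℝ a b, DifferentiableAt ℂ f w) 
    (h : ∀ w ∈ segment ℝ a b, ‖deriv f w‖ ≤ A) : ‖f b - f a‖ ≤ A * ‖b - a‖ :=
  (convex_segment a b).norm_image_sub_le_of_norm_deriv_le hf h (left_mem_segment ℝ a b) (right_mem_segment ℝ a b)

lemma seg_re_im {a b w : ℂ} (hw : w ∈ segment ℝ a b) : min a.re b.re ≤ w.re ∧ w.re ≤ max a.re b.re ∧ 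
    |w.im| ≤ max |a.im| |b.im| ∧ min a.im b.im ≤ w.im ∧ w.im ≤ max a.im b.im := by
  obtain ⟨u, v, hu, hv, huv, rfl⟩ := hw
  simp only [add_re, add_im, Complex.smul_re, Complex.smul_im, smul_eq_mul]
  have hv' : v = 1 - u := by linarith
  subst hv'
  have e1 := min_le_left a.re b.re
  have e2 := min_le_right a.re b.re
  have e3 := le_max_left a.re b.re
  have e4 := le_max_right a.re b.re
  have e5 := le_max_left |a.im| |b.im|
  have e6 := le_max_right |a.im| |b.im|
  have f1 := min_le_left a.im b.im
  have f2 := min_le_right a.im b.im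
  have f3 := le_max_left a.im b.im
  have f4 := le_max_right a.im b.im
  refine ⟨by nlinarith, by nlinarith, ?_, by nlinarith, by nlinarith⟩
  calc _ ≤ |u * a.im| + |(1-u) * b.im| := abs_add_le _ _
    _ = u * |a.im| + (1-u) * |b.im| := by rw [abs_mul, abs_mul, abs_of_nonneg hu, abs_of_nonneg hv]
    _ ≤ _ := by nlinarith

/-- 3-4-1 in packaged form: bound for the squared character gives lower bound -/
lemma lower_of_bounds {q : ℕ} [NeZero q] (χ : DirichletCharacter ℂ q) {t A V : ℝ} (hA : 1 ≤ A) (hV : 1 ≤ V)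
    (hd : ∀ w : ℂ, 1 < w.re → w.re ≤ 2 → w.im = t → DifferentiableAt ℂ χ.LFunction w ∧ ‖deriv χ.LFunction w‖ ≤ A)
    (hV2 : ∀ x : ℝ, 0 < x → x ≤ 1 → ‖(χ^2).LFunction (1 + x + 2 * I * t)‖ ≤ V) {x : ℝ} (hx : 0 < x) (hx1 : x ≤ 1) :
    1 / (2^22 * A^4 * V) ≤ ‖χ.LFunction (1 + x + I * t)‖ := by
  refine abs341 (g := fun x : ℝ => ‖χ.LFunction (1 + x + I * t)‖) hA hV (fun _ => norm_nonneg _) ?_ ?_ hx hx1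
  · intro x hx hx1
    refine (χ.norm_LFunction_product_ge_one hx t).le.trans ?_
    rw [norm_mul, norm_mul, norm_pow, norm_pow]
    gcongr
    · exact triv_bound hx hx1
    · exact hV2 x hx hx1
  · intro x y hx hxy hy
    have := mvt_seg (f := χ.LFunction) (a := 1 + x + I * t) (b := 1 + y + I * t) (A := A) ?_ ?_
    · refine ((norm_sub_norm_le _ _).trans this).trans (le_of_eq ?_)
      congr 1
      have : (1:ℂ) + y + I * t - (1 + x + I * t) = ((y - x : ℝ):ℂ) := by push_cast; ring
      rw [this, Complex.norm_real, Real.norm_eq_abs, abs_of_nonneg (by linarith)]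
    all_goals
      intro w hw
      obtain ⟨h1, h2, _, h3, h4⟩ := seg_re_im hw
      simp at h1 h2 h3 h4
    · exact (hd w (by rcases h1 with h | h <;> linarith) (by rcases h2 with h | h <;> linarith) (by linarith)).1
    · exact (hd w (by rcases h1 with h | h <;> linarith) (by rcases h2 with h | h <;> linarith) (by linarith)).2

lemma s_form (s : ℂ) : s = 1 + ((s.re - 1 : ℝ) : ℂ) + I * (s.im : ℂ) := by
  apply Complex.ext <;> simp

lemma zeta_lower (ε : ℝ) (hε : 0 < ε) (hε2 : ε ≤ 1/2) : ∃ c : ℝ, 0 < c ∧ ∀ s : ℂ, 1/2 ≤ |s.im| → 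
    1 < s.re → s.re ≤ 2 → c * (|s.im| + 2)^(-(10*ε)) ≤ ‖riemannZeta s‖ := by
  obtain ⟨A, hA, hup⟩ := zeta_upper ε hε hε2
  refine ⟨1 / (2^22 * A^4 * (2*A)), by positivity, ?_⟩
  intro s him hs hs2
  set X := (|s.im| + 2)^(2*ε) with hX
  have hX1 : 1 ≤ X := Real.one_le_rpow (by linarith [abs_nonneg s.im]) (by positivity)
  have hAX : 1 ≤ A * X := by nlinarith
  have := lower_of_bounds (1 : DirichletCharacter ℂ 1) (t := s.im) (A := A * X) (V := 2 * A * X) hAX (by linarith) ?_ ?_ (x := s.re - 1) (by linarith) (by linarith)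
  · rw [← s_form, DirichletCharacter.LFunction_modOne_eq] at this
    refine le_trans (le_of_eq ?_) this
    have e : (|s.im| + 2)^(-(10*ε)) = 1 / X^5 := by
      rw [hX, ← Real.rpow_natCast, ← Real.rpow_mul (by positivity), one_div, ← Real.rpow_neg (by positivity)]
      congr 1; push_cast; ring
    rw [e]; field_simp
  · intro w h1 h2 h3
    rw [DirichletCharacter.LFunction_modOne_eq]
    refine ⟨differentiableAt_riemannZeta (by rintro rfl; simp at h1), ?_⟩
    have := (hup w (by rw [h3]; exact him) (by linarith) (by linarith)).2
    rwa [h3] at this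
  · intro x hx hx1
    rw [DirichletCharacter.LFunction_modOne_eq]
    have him' : (1 + x + 2 * I * (s.im:ℂ)).im = 2 * s.im := by simp
    have hre' : (1 + x + 2 * I * (s.im:ℂ)).re = 1 + x := by simp
    refine (hup _ (by rw [him', abs_mul]; norm_num; linarith) (by rw [hre']; linarith) (by rw [hre']; linarith)).1.trans ?_
    rw [him']
    have := rpow_two_mul_le (X := |s.im| + 2) (Y := |2*s.im| + 2) (by positivity) (by positivity) (by rw [abs_mul]; norm_num; linarith) hε hε2
    nlinarith

set_option maxHeartbeats 2000000 in
lemma L_lower (ε : ℝ) (hε : 0 < ε) (hε2 : ε ≤ 1/2) : ∃ c : ℝ, 0 < c ∧ ∀ (q : ℕ) [NeZero q] (χ : DirichletCharacter ℂ q),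
    χ ≠ 1 → ∀ s : ℂ, 1 < s.re → s.re ≤ 2 → c * (q * (|s.im| + 2))^(-(14*ε)) ≤ ‖χ.LFunction s‖ := by
  obtain ⟨A, hA, hup⟩ := L_upper ε hε hε2
  obtain ⟨B, hB, htr⟩ := triv_bound2 ε hε hε2
  obtain ⟨c', hc', hsieg'⟩ := siegel (2*ε/3) (by positivity)
  set c := min c' 1 with hc
  have hc0 : 0 < c := by positivity
  have hc1 : c ≤ 1 := min_le_right _ _
  set τ0 := c/(4*A) with hτ0
  have htau_pos : 0 < τ0 := by positivity
  have hτ01 : τ0 ≤ 1/4 := by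
    rw [hτ0, div_le_iff₀ (by positivity)]; nlinarith
  set c1 := 1/(2^22 * A^4 * (2*A)) with hc1d
  set c2 := 1/(2^22 * A^4 * (4*B/τ0)) with hc2d
  set c3 := τ0/(64 * (4*B/τ0)) with hc3d
  refine ⟨min (min c1 c2) (min c3 (c/2)), by positivity, ?_⟩
  intro q _ χ hχ s hs hs2
  have hq : (1:ℝ) ≤ q := by exact_mod_cast NeZero.one_le
  set Y := (q * (|s.im| + 2)) with hY
  have hY1 : 1 ≤ Y := by have := abs_nonneg s.im; nlinarith
  set X := Y^(2*ε) with hX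
  have hX1 : 1 ≤ X := Real.one_le_rpow hY1 (by positivity)
  have hX0 : 0 < X := by linarith
  have e : Y^(-(14*ε)) = 1 / X^7 := by
    rw [hX, ← Real.rpow_natCast, ← Real.rpow_mul (by positivity), one_div, ← Real.rpow_neg (by positivity)]
    congr 1; push_cast; ring
  rw [e]
  have hpow : ∀ n : ℕ, n ≤ 7 → 1/X^7 ≤ 1/X^n := fun n hn => one_div_le_one_div_of_le (by positivity) (pow_le_pow_right₀ hX1 hn)
  have hAX : 1 ≤ A * X := by nlinarith
  have hder : ∀ w : ℂ, 1 < w.re → w.re ≤ 2 → w.im = s.im → DifferentiableAt ℂ χ.LFunction w ∧ ‖deriv χ.LFunction w‖ ≤ A * X := by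
    intro w h1 h2 h3
    refine ⟨DirichletCharacter.differentiable_LFunction hχ w, ?_⟩
    have := (hup q χ hχ w (by linarith) (by linarith)).2
    rwa [h3] at this
  have hY2 : (q * (|2 * s.im| + 2))^(2*ε) ≤ 2 * X := by
    refine rpow_two_mul_le (by positivity) (by positivity) ?_ hε hε2
    rw [hY, abs_mul]; norm_num
    nlinarith
  by_cases hsq : χ^2 = 1
  swap
  · have := lower_of_bounds χ (t := s.im) (A := A * X) (V := 2 * A * X) hAX (by linarith) hder ?_ (x := s.re - 1) (by linarith) (by linarith)
    · rw [← s_form] at this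
      refine le_trans ?_ this
      calc _ ≤ c1 * (1/X^5) := by
            gcongr ?_ * ?_
            · exact (min_le_left _ _).trans (min_le_left _ _)
            · exact hpow 5 (by norm_num)
        _ = _ := by rw [hc1d]; field_simp
    · intro x hx hx1
      have him' : (1 + x + 2 * I * (s.im:ℂ)).im = 2 * s.im := by simp
      have hre' : (1 + x + 2 * I * (s.im:ℂ)).re = 1 + x := by simp
      refine (hup q _ hsq _ (by rw [hre']; linarith) (by rw [hre']; linarith)).1.trans ?_
      rw [him']
      nlinarith
  -- quadratic case
  set τ := τ0 / X^2 with hτ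
  have hτp : 0 < τ := by positivity
  have hτ1 : τ ≤ 1/4 := (div_le_self htau_pos.le (one_le_pow₀ hX1)).trans hτ01
  set V := 4 * B * X / τ with hV
  have hV1 : 1 ≤ V := by rw [hV, le_div_iff₀ hτp]; nlinarith
  have hVe : V = (4*B/τ0) * X^3 := by rw [hV, hτ]; field_simp
  have hVb : ∀ x : ℝ, 0 < x → x ≤ 1 → (τ ≤ x ∨ τ ≤ |s.im|) → ‖(χ^2).LFunction (1 + x + 2 * I * s.im)‖ ≤ V := by
    intro x hx hx1 hor
    have him' : (1 + x + 2 * I * (s.im:ℂ)).im = 2 * s.im := by simp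
    have hre' : (1 + x + 2 * I * (s.im:ℂ)).re = 1 + x := by simp
    have h1 := htr q (1 + x + 2 * I * (s.im:ℂ)) (by rw [hre']; linarith) (by rw [hre']; linarith)
    rw [DirichletCharacter.LFunctionTrivChar] at h1
    rw [hsq]
    refine h1.trans ?_
    have h2 : τ ≤ ‖(1 + x + 2 * I * (s.im:ℂ)) - 1‖ := by
      rcases hor with h | h
      · have := Complex.re_le_norm ((1 + x + 2 * I * (s.im:ℂ)) - 1)
        rw [sub_re, hre'] at this; simp only [one_re] at this; linarith
      · have := Complex.abs_im_le_norm ((1 + x + 2 * I * (s.im:ℂ)) - 1)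
        rw [sub_im, him'] at this
        simp only [one_im, sub_zero, abs_mul] at this
        norm_num at this; linarith
    rw [him']
    have h3 : 1 + 1/‖(1 + x + 2 * I * (s.im:ℂ)) - 1‖ ≤ 2/τ := by
      have : 1/‖(1 + x + 2 * I * (s.im:ℂ)) - 1‖ ≤ 1/τ := one_div_le_one_div_of_le hτp h2
      have h5 : 1 ≤ 1/τ := by rw [le_div_iff₀ hτp]; linarith
      have h6 : 2/τ = 1/τ + 1/τ := by ring
      linarith
    calc _ ≤ B * (2 * X) * (2/τ) := by gcongr
      _ = _ := by rw [hV]; ring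
  rcases le_or_gt τ |s.im| with hcase | hcase
  · have := lower_of_bounds χ (t := s.im) (A := A * X) (V := V) hAX hV1 hder (fun x h1 h2 => hVb x h1 h2 (Or.inr hcase)) (x := s.re - 1) (by linarith) (by linarith)
    rw [← s_form] at this
    refine le_trans ?_ this
    calc _ ≤ c2 * (1/X^7) := by
          gcongr ?_ * ?_
          exact (min_le_left _ _).trans (min_le_right _ _)
      _ = _ := by rw [hc2d, hVe]; field_simp
  rcases le_or_gt τ (s.re - 1) with hcase2 | hcase2
  · have h1 := (χ.norm_LFunction_product_ge_one (x := s.re - 1) (by linarith) s.im).le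
    rw [norm_mul, norm_mul, norm_pow, norm_pow, ← s_form] at h1
    have h2 := triv_bound (q := q) (x := s.re - 1) (by linarith) (by linarith)
    have h3 := hVb (s.re - 1) (by linarith) (by linarith) (Or.inl hcase2)
    set g := ‖χ.LFunction s‖ with hg
    have hg0 : 0 ≤ g := norm_nonneg _
    have h4 : 64/(s.re-1) ≤ 64/τ := by gcongr
    have h5 : 1 ≤ (64/τ)^3 * g^4 * V := h1.trans (by gcongr; exact h2.trans h4)
    have h6 : (τ/(64*V))^4 ≤ g^4 := by
      have e1 : (64/τ)^3 * g^4 * V = g^4 * (64^3 * V/ τ^3) := by ring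
      rw [e1] at h5
      have h7 : 0 < 64^3*V/τ^3 := by positivity
      have h8 : 1 / (64^3*V/τ^3) ≤ g^4 := by rw [div_le_iff₀ h7]; exact h5
      refine le_trans ?_ h8
      have e2 : 1 / (64^3*V/τ^3) = τ^3/(64^3*V) := by field_simp
      rw [e2, div_pow, div_le_div_iff₀ (by positivity) (by positivity)]
      have h9 : V ≤ V^4 := le_self_pow₀ hV1 (by norm_num)
      have h10 : τ^4 ≤ τ^3 := pow_le_pow_of_le_one hτp.le (by linarith) (by norm_num)
      calc τ^4 * (64^3*V) ≤ τ^3 * (64^3 * V^4) := by gcongr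
        _ ≤ τ^3 * (64 * V)^4 := by rw [mul_pow]; gcongr; norm_num; norm_num
    have h7 := le_of_pow_le_pow_left₀ (by norm_num) hg0 h6
    refine le_trans ?_ h7
    calc _ ≤ c3 * (1/X^5) := by
          gcongr ?_ * ?_
          · exact (min_le_right _ _).trans (min_le_left _ _)
          · exact hpow 5 (by norm_num)
      _ = _ := by rw [hc3d, hVe, hτ]; field_simp
  -- Siegel
  have hS := hsieg' q χ hsq hχ
  have hS2 : c / X ≤ ‖χ.LFunction 1‖ := by
    refine le_trans ?_ (hS.trans ((le_abs_self _).trans (Complex.abs_re_le_norm _)))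
    have h1 : (q:ℝ)^(-(3*(2*ε/3))) = 1/(q:ℝ)^(2*ε) := by
      rw [one_div, ← Real.rpow_neg (by positivity)]; congr 1; ring
    rw [h1, div_eq_mul_one_div]
    gcongr
    · exact min_le_left _ _
    · rw [hX]
      gcongr
      rw [hY]
      have := abs_nonneg s.im
      nlinarith
  have hm := mvt_seg (f := χ.LFunction) (a := s) (b := 1) (A := A * X) (fun w _ => DirichletCharacter.differentiable_LFunction hχ w) ?_
  · have h1 := norm_le_insert' (χ.LFunction 1) (χ.LFunction s)
    have h2 : ‖1 - s‖ ≤ 2 * τ := by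
      have := Complex.norm_le_abs_re_add_abs_im (1 - s)
      simp only [sub_re, sub_im, one_re, one_im, zero_sub, abs_neg] at this
      rw [abs_sub_comm, abs_of_pos (by linarith)] at this
      linarith
    have h3 : A * X * ‖1 - s‖ ≤ c/(2*X) := by
      calc _ ≤ A * X * (2*τ) := by gcongr
        _ = _ := by rw [hτ, hτ0]; field_simp; norm_num
    have h4 : c / X = c/(2*X) + c/(2*X) := by field_simp; norm_num
    have h5 : c/(2*X) ≤ ‖χ.LFunction s‖ := by linarith
    refine le_trans ?_ h5
    calc _ ≤ (c/2) * (1/X^1) := by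
          gcongr ?_ * ?_
          · exact (min_le_right _ _).trans (min_le_right _ _)
          · exact hpow 1 (by norm_num)
      _ = _ := by field_simp
  · intro w hw
    obtain ⟨h1, h2, h3, _, _⟩ := seg_re_im hw
    simp at h1 h2 h3
    refine (hup q χ hχ w (by rcases h1 with h | h <;> linarith) (by rcases h2 with h | h <;> linarith)).2.trans ?_
    rw [hX, hY]
    gcongr
end SW

namespace SW
open Complex Topology

lemma iter_bound {f g : ℂ → ℂ} {s : ℂ} {ρ A m : ℝ} (k : ℕ) (hρ : 0 < ρ) (hρ1 : ρ ≤ 1) (hA : 1 ≤ A) (hm : 0 < m) (hm1 : m ≤ 1)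
    (hf : ∀ w ∈ Metric.closedBall s ρ, DifferentiableAt ℂ f w) (hf' : ∀ w ∈ Metric.closedBall s ρ, DifferentiableAt ℂ (deriv f) w)
    (hg : ∀ w ∈ Metric.closedBall s ρ, DifferentiableAt ℂ g w) 
    (hfA : ∀ w ∈ Metric.closedBall s ρ, ‖deriv f w‖ ≤ A) (hgA : ∀ w ∈ Metric.closedBall s ρ, ‖g w‖ ≤ A) (hfm : m ≤ ‖f s‖) :
    ‖iteratedDeriv k (fun w => - deriv f w / f w - g w) s‖ ≤ k.factorial * (3*A/m)^(k+1) / ρ^k := by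
  set r := ρ * (m/(2*A)) with hr
  have hr0 : 0 < r := by positivity
  have h0 : m/(2*A) ≤ 1 := by rw [div_le_one (by positivity)]; linarith
  have hrρ : r ≤ ρ := by rw [hr]; nlinarith
  have hsub : Metric.closedBall s r ⊆ Metric.closedBall s ρ := Metric.closedBall_subset_closedBall hrρ
  have hlow : ∀ w ∈ Metric.closedBall s r, m/2 ≤ ‖f w‖ := by
    intro w hw
    have h1 := (convex_closedBall s r).norm_image_sub_le_of_norm_deriv_le (fun x hx => hf x (hsub hx)) (fun x hx => hfA x (hsub hx)) (Metric.mem_closedBall_self hr0.le) hw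
    rw [Metric.mem_closedBall, dist_eq_norm] at hw
    have h2 : A * ‖w - s‖ ≤ m/2 := by
      calc A * ‖w - s‖ ≤ A * r := by gcongr
        _ = ρ * (m/2) := by rw [hr]; field_simp
        _ ≤ m/2 := by nlinarith
    have h3 := norm_le_insert (f w) (f s)
    linarith
  have hne : ∀ w ∈ Metric.closedBall s r, f w ≠ 0 := by
    intro w hw h
    have := hlow w hw
    rw [h, norm_zero] at this
    linarith
  have hd : DiffContOnCl ℂ (fun w => - deriv f w / f w - g w) (Metric.ball s r) := by
    refine DifferentiableOn.diffContOnCl ?_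
    rw [closure_ball _ hr0.ne']
    intro w hw
    exact ((((hf' w (hsub hw)).neg).div (hf w (hsub hw)) (hne w hw)).sub (hg w (hsub hw))).differentiableWithinAt
  have hb := Complex.norm_iteratedDeriv_le_of_forall_mem_sphere_norm_le (C := 3*A/m) k hr0 hd ?_
  · refine hb.trans ?_
    rw [hr, mul_pow]
    rw [div_le_div_iff₀ (by positivity) (by positivity)]
    have h1 : 1 ≤ (3*A/m)^k * (m/(2*A))^k := by
      rw [← mul_pow]
      apply one_le_pow₀
      rw [div_mul_div_comm, le_div_iff₀ (by positivity)]
      nlinarith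
    have h2 : 0 ≤ k.factorial * (3*A/m) * ρ^k := by positivity
    calc k.factorial * (3*A/m) * ρ^k ≤ (k.factorial * (3*A/m) * ρ^k) * ((3*A/m)^k * (m/(2*A))^k) := le_mul_of_one_le_right h2 h1
      _ = _ := by ring
  · intro w hw
    have hw' := Metric.sphere_subset_closedBall hw
    calc ‖- deriv f w / f w - g w‖ ≤ ‖- deriv f w / f w‖ + ‖g w‖ := norm_sub_le _ _
      _ ≤ A / (m/2) + A/m := by
        rw [norm_div, norm_neg]
        have := hgA w (hsub hw')
        gcongr
        · exact hfA w (hsub hw')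
        · exact hlow w hw'
        · exact this.trans (by rw [le_div_iff₀ hm]; nlinarith)
      _ = _ := by field_simp; norm_num

lemma ratio_pow {Y A c : ℝ} (k : ℕ) (hY : 1 ≤ Y) (hA : 1 ≤ A) (hc : 0 < c) (a : ℝ) (ha2 : a ≤ 16):
    (3*(A * Y^(2*(1/(32*(k+1):ℝ))))/(c * Y^(-(a - 2)*(1/(32*(k+1):ℝ)))))^(k+1) ≤ (3*A/c)^(k+1) * Y^(1/2:ℝ) := by
  have hY0 : 0 < Y := by linarith
  have e : 3*(A * Y^(2*(1/(32*(k+1):ℝ))))/(c * Y^(-(a - 2)*(1/(32*(k+1):ℝ)))) = (3*A/c) * Y^(a*(1/(32*(k+1):ℝ))) := by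
    have : Y^(a*(1/(32*(k+1):ℝ))) * Y^(-(a - 2)*(1/(32*(k+1):ℝ))) = Y^(2*(1/(32*(k+1):ℝ))) := by
      rw [← Real.rpow_add hY0]; congr 1; ring
    rw [← this]
    have := Real.rpow_pos_of_pos hY0 (-(a - 2)*(1/(32*(k+1):ℝ)))
    field_simp
  rw [e, mul_pow]
  gcongr
  rw [← Real.rpow_natCast, ← Real.rpow_mul hY0.le]
  apply Real.rpow_le_rpow_of_exponent_le hY
  push_cast
  have : (0:ℝ) < k + 1 := by positivity
  field_simp
  linarith

open ArithmeticFunction in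
noncomputable def tw {q : ℕ} (χ : DirichletCharacter ℂ q) : ℕ → ℂ := (fun n : ℕ => χ n) * (fun n : ℕ => (vonMangoldt n : ℂ))

open LSeries ArithmeticFunction in
lemma twist_bound (k : ℕ) : ∃ C : ℝ, 0 < C ∧ ∀ (q : ℕ) [NeZero q] (χ : DirichletCharacter ℂ q), χ ≠ 1 → ∀ s : ℂ, 1 < s.re → s.re ≤ 2 →
    ‖LSeries (logMul^[k] (tw χ)) s‖ ≤ C * (q * (|s.im| + 2))^(1/2:ℝ) := by
  set ε : ℝ := 1/(32*(k+1):ℝ) with hε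
  have hk : (0:ℝ) < k + 1 := by positivity
  have hk0 : (0:ℝ) ≤ k := by positivity
  have hε0 : 0 < ε := by positivity
  have hε2 : ε ≤ 1/2 := by rw [hε, div_le_div_iff₀ (by positivity) (by norm_num)]; linarith
  obtain ⟨A, hA, hup⟩ := L_upper ε hε0 hε2
  obtain ⟨c, hc, hlow⟩ := L_lower ε hε0 hε2
  refine ⟨k.factorial * (3*(2*A)/min c 1)^(k+1) / (ε/4)^k, by have : 0 < min c 1 := lt_min hc one_pos
                                                              positivity, ?_⟩
  intro q _ χ hχ s hs hs2
  have hc0 : 0 < min c 1 := lt_min hc one_pos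
  have hq : (1:ℝ) ≤ q := by exact_mod_cast Nat.pos_of_neZero q
  set Y : ℝ := q * (|s.im| + 2) with hY
  have hY1 : 1 ≤ Y := by
    have := abs_nonneg s.im
    nlinarith
  have hY0 : 0 < Y := by linarith
  have hab : LSeries.abscissaOfAbsConv (tw χ) ≤ 1 := by
    refine LSeries.abscissaOfAbsConv_le_of_forall_lt_LSeriesSummable' fun y hy => ?_
    exact DirichletCharacter.LSeriesSummable_twist_vonMangoldt χ (by exact_mod_cast hy)
  have h1 := LSeries_iteratedDeriv (f := tw χ) k (s := s) (lt_of_le_of_lt hab (by exact_mod_cast hs))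
  have h2 : ‖LSeries (logMul^[k] (tw χ)) s‖ = 
     ‖iteratedDeriv k (LSeries (tw χ)) s‖ := by
    rw [h1]; simp
  rw [h2]
  have hLe : ∀ z : ℂ, 1 < z.re → LSeries (fun n : ℕ => χ n) =ᶠ[𝓝 z] χ.LFunction := by
    intro z hz
    filter_upwards [(isOpen_lt continuous_const continuous_re).mem_nhds hz] with w hw
    exact (DirichletCharacter.LFunction_eq_LSeries χ hw).symm
  have h3 : LSeries (tw χ) =ᶠ[𝓝 s] (fun w => - deriv χ.LFunction w / χ.LFunction w - (0:ℂ → ℂ) w) := by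
    filter_upwards [(isOpen_lt continuous_const continuous_re).mem_nhds hs] with w hw
    have := DirichletCharacter.LSeries_twist_vonMangoldt_eq χ hw
    rw [tw, this, (hLe w hw).deriv_eq, (hLe w hw).eq_of_nhds]
    simp
  rw [h3.iteratedDeriv_eq]
  have hρ : ε/4 ≤ 1 := by linarith
  have hdiff := DirichletCharacter.differentiable_LFunction hχ
  have hball : ∀ w ∈ Metric.closedBall s (ε/4), ‖deriv χ.LFunction w‖ ≤ 2 * A * Y^(2*ε) := by
    intro w hw
    obtain ⟨b1, b2, b3, b4⟩ := ball_re_im hw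
    refine (hup q χ hχ w (by linarith) (by linarith)).2.trans ?_
    have : (q * (|w.im| + 2))^(2*ε) ≤ 2 * Y^(2*ε) := by
      refine rpow_two_mul_le (by positivity) (by positivity) ?_ hε0 hε2
      rw [hY]
      have := abs_nonneg s.im
      nlinarith
    nlinarith
  have hYp : 1 ≤ Y^(2*ε) := Real.one_le_rpow hY1 (by positivity)
  have hYm : Y^(-(16-2)*ε) ≤ 1 := Real.rpow_le_one_of_one_le_of_nonpos hY1 (by nlinarith)
  have hYm0 : 0 < Y^(-(16-2)*ε) := by positivity
  have hb := iter_bound (f := χ.LFunction) (g := 0) (s := s) (ρ := ε/4) (A := 2 * A * Y^(2*ε)) (m := min c 1 * Y^(-(16-2)*ε)) k (by positivity) hρ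
    (by nlinarith) (by positivity) (by nlinarith [min_le_right c 1]) (fun w _ => hdiff w) (fun w _ => hdiff.deriv w) (fun w _ => differentiableAt_const _) hball
    (fun w _ => by simp; positivity) ?_
  · refine hb.trans ?_
    have := ratio_pow (Y := Y) (A := 2*A) (c := min c 1) k hY1 (by linarith) hc0 16 le_rfl
    rw [← hε] at this
    calc _ ≤ k.factorial * ((3*(2*A)/min c 1)^(k+1) * Y^(1/2:ℝ)) / (ε/4)^k := by gcongr
      _ = _ := by ring
  · refine le_trans ?_ (hlow q χ hχ s hs hs2)
    have : -(16-2)*ε = -(14*ε) := by ring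
    rw [this]
    gcongr
    exact min_le_left _ _
end SW

namespace SW
open Complex Topology

open ArithmeticFunction in
noncomputable def zw : ℕ → ℂ := (fun n : ℕ => (vonMangoldt n : ℂ)) - 1

lemma zw_summable {s : ℂ} (hs : 1 < s.re) : LSeriesSummable zw s := 
  (ArithmeticFunction.LSeriesSummable_vonMangoldt hs).sub (LSeriesSummable_one_iff.2 hs)

lemma zw_LSeries {s : ℂ} (hs : 1 < s.re) : LSeries zw s = - deriv riemannZeta s / riemannZeta s - riemannZeta s := by
  rw [zw, LSeries_sub (ArithmeticFunction.LSeriesSummable_vonMangoldt hs) (LSeriesSummable_one_iff.2 hs),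
    ArithmeticFunction.LSeries_vonMangoldt_eq_deriv_riemannZeta_div hs, LSeries_one_eq_riemannZeta hs]

lemma zeta_H {s : ℂ} (hs : 1 < s.re) : - deriv riemannZeta s / riemannZeta s - riemannZeta s = - deriv W s / W s - dslope W 1 s := by
  have hs1 : s ≠ 1 := by rintro rfl; simp at hs
  have h0 : s - 1 ≠ 0 := sub_ne_zero.2 hs1
  have hz : riemannZeta s ≠ 0 := riemannZeta_ne_zero_of_one_lt_re hs
  have hd : deriv W s = riemannZeta s + (s - 1) * deriv riemannZeta s := by
    have : W =ᶠ[𝓝 s] fun w => (w - 1) * riemannZeta w := by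
      filter_upwards [isOpen_ne.mem_nhds hs1] with w hw using W_ne hw
    rw [this.deriv_eq]
    have h1 := ((hasDerivAt_id s).sub_const 1).mul (differentiableAt_riemannZeta hs1).hasDerivAt
    have := h1.deriv
    simp only [id] at this
    rw [show (fun w => (w - 1) * riemannZeta w) = ((fun w => w - 1) * riemannZeta) from rfl]
    simpa using this
  rw [dslope_of_ne _ hs1, slope_def_field, W_one, hd, W_ne hs1]
  field_simp
  ring

lemma W_ne_zero {s : ℂ} (hs : 1 ≤ s.re) : W s ≠ 0 := by
  by_cases h : s = 1
  · rw [h, W_one]; exact one_ne_zero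
  · rw [W_ne h]
    exact mul_ne_zero (sub_ne_zero.2 h) (riemannZeta_ne_zero_of_one_le_re hs)

lemma H_compact (k : ℕ) : ∃ C : ℝ, ∀ s : ℂ, 1 ≤ s.re → s.re ≤ 2 → |s.im| ≤ 1 → 
    ‖iteratedDeriv k (fun s => - deriv W s / W s - dslope W 1 s) s‖ ≤ C := by
  set U : Set ℂ := {s | W s ≠ 0} with hU
  have hUo : IsOpen U := isOpen_ne_fun W_diff.continuous continuous_const
  have hds : Differentiable ℂ (dslope W 1) := by
    rw [← differentiableOn_univ, Complex.differentiableOn_dslope Filter.univ_mem]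
    exact W_diff.differentiableOn
  have hH : DifferentiableOn ℂ (fun s => - deriv W s / W s - dslope W 1 s) U := by
    intro w hw
    exact ((((W_diff.deriv w).neg).div (W_diff w) hw).sub (hds w)).differentiableWithinAt
  have hcd := hH.analyticOnNhd hUo
  have hc : ContinuousOn (iteratedDeriv k (fun s => - deriv W s / W s - dslope W 1 s)) U := 
    (hcd.iterated_deriv k).continuousOn.congr (fun x _ => by rw [iteratedDeriv_eq_iterate])
  have hK : IsCompact (Set.Icc (1:ℝ) 2 ×ℂ Set.Icc (-1:ℝ) 1) := isCompact_Icc.reProdIm isCompact_Icc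
  obtain ⟨C, hC⟩ := hK.exists_bound_of_continuousOn (hc.mono (fun s hs => by
    rw [Complex.mem_reProdIm] at hs
    exact W_ne_zero hs.1.1))
  refine ⟨C, fun s h1 h2 h3 => hC s ?_⟩
  rw [Complex.mem_reProdIm]
  exact ⟨⟨h1, h2⟩, abs_le.1 h3⟩

open LSeries ArithmeticFunction in
lemma zw_bound (k : ℕ) : ∃ C : ℝ, 0 < C ∧ ∀ s : ℂ, 1 < s.re → s.re ≤ 2 →
    ‖LSeries (logMul^[k] zw) s‖ ≤ C * (|s.im| + 2)^(1/2:ℝ) := by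
  set ε : ℝ := 1/(32*(k+1):ℝ) with hε
  have hk : (0:ℝ) < k + 1 := by positivity
  have hk0 : (0:ℝ) ≤ k := by positivity
  have hε0 : 0 < ε := by positivity
  have hε2 : ε ≤ 1/2 := by rw [hε, div_le_div_iff₀ (by positivity) (by norm_num)]; linarith
  obtain ⟨A, hA, hup⟩ := zeta_upper ε hε0 hε2
  obtain ⟨c, hc, hlow⟩ := zeta_lower ε hε0 hε2
  obtain ⟨C0, hC0⟩ := H_compact k
  have hc0 : 0 < min c 1 := lt_min hc one_pos
  set C1 := k.factorial * (3*(2*A)/min c 1)^(k+1) / (ε/4)^k with hC1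
  have hC1p : 0 < C1 := by positivity
  refine ⟨C1 + |C0|, by positivity, ?_⟩
  intro s hs hs2
  set Y : ℝ := (|s.im| + 2) with hY
  have hY1 : 1 ≤ Y := by
    have := abs_nonneg s.im
    linarith
  have hY0 : 0 < Y := by linarith
  have hY12 : 1 ≤ Y^(1/2:ℝ) := Real.one_le_rpow hY1 (by positivity)
  have hab : LSeries.abscissaOfAbsConv zw ≤ 1 := by
    refine LSeries.abscissaOfAbsConv_le_of_forall_lt_LSeriesSummable' fun y hy => ?_
    exact zw_summable (by exact_mod_cast hy)
  have h1 := LSeries_iteratedDeriv (f := zw) k (s := s) (lt_of_le_of_lt hab (by exact_mod_cast hs))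
  have h2 : ‖LSeries (logMul^[k] zw) s‖ = 
     ‖iteratedDeriv k (LSeries zw) s‖ := by
    rw [h1]; simp
  rw [h2]
  rcases le_or_gt |s.im| 1 with hsm | hbig
  · have h3 : LSeries zw =ᶠ[𝓝 s] (fun s => - deriv W s / W s - dslope W 1 s) := by
      filter_upwards [(isOpen_lt continuous_const continuous_re).mem_nhds hs] with w hw
      rw [zw_LSeries hw, zeta_H hw]
    rw [h3.iteratedDeriv_eq]
    refine (hC0 s hs.le hs2 hsm).trans ?_
    have := le_abs_self C0
    nlinarith [abs_nonneg C0]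
  have h3 : LSeries zw =ᶠ[𝓝 s] (fun w => - deriv riemannZeta w / riemannZeta w - riemannZeta w) := by
    filter_upwards [(isOpen_lt continuous_const continuous_re).mem_nhds hs] with w hw
    rw [zw_LSeries hw]
  rw [h3.iteratedDeriv_eq]
  have hρ : ε/4 ≤ 1/8 := by linarith
  have hball : ∀ w ∈ Metric.closedBall s (ε/4), w ≠ 1 ∧ ‖riemannZeta w‖ ≤ 2 * A * Y^(2*ε) ∧ ‖deriv riemannZeta w‖ ≤ 2 * A * Y^(2*ε) := by
    intro w hw
    obtain ⟨b1, b2, b3, b4⟩ := ball_re_im hw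
    refine ⟨?_, ?_⟩
    · rintro rfl
      simp at b4
      linarith
    have h1 := hup w (by linarith) (by linarith) (by linarith)
    have : (|w.im| + 2)^(2*ε) ≤ 2 * Y^(2*ε) := by
      refine rpow_two_mul_le (by positivity) (by positivity) ?_ hε0 hε2
      rw [hY]
      linarith
    have h2 : A * (|w.im| + 2)^(2*ε) ≤ 2 * A * Y^(2*ε) := by nlinarith
    exact ⟨h1.1.trans h2, h1.2.trans h2⟩
  have hYp : 1 ≤ Y^(2*ε) := Real.one_le_rpow hY1 (by positivity)
  have hYm : Y^(-(12-2)*ε) ≤ 1 := Real.rpow_le_one_of_one_le_of_nonpos hY1 (by nlinarith)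
  have hYm0 : 0 < Y^(-(12-2)*ε) := by positivity
  have hdd : ∀ w : ℂ, w ≠ 1 → DifferentiableAt ℂ (deriv riemannZeta) w := by
    intro w hw
    have : DifferentiableOn ℂ riemannZeta {1}ᶜ := fun z hz => (differentiableAt_riemannZeta hz).differentiableWithinAt
    exact (this.deriv isOpen_compl_singleton).differentiableAt (isOpen_compl_singleton.mem_nhds hw)
  have hb := iter_bound (f := riemannZeta) (g := riemannZeta) (s := s) (ρ := ε/4) (A := 2 * A * Y^(2*ε)) (m := min c 1 * Y^(-(12-2)*ε)) k (by positivity) (by linarith)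
    (by nlinarith) (by positivity) (by nlinarith [min_le_right c 1]) (fun w hw => differentiableAt_riemannZeta (hball w hw).1) (fun w hw => hdd w (hball w hw).1) (fun w hw => differentiableAt_riemannZeta (hball w hw).1) (fun w hw => (hball w hw).2.2)
    (fun w hw => (hball w hw).2.1) ?_
  · refine hb.trans ?_
    have := ratio_pow (Y := Y) (A := 2*A) (c := min c 1) k hY1 (by linarith) hc0 12 (by norm_num)
    rw [← hε] at this
    calc _ ≤ k.factorial * ((3*(2*A)/min c 1)^(k+1) * Y^(1/2:ℝ)) / (ε/4)^k := by gcongr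
      _ = C1 * Y^(1/2:ℝ) := by rw [hC1]; ring
      _ ≤ _ := by gcongr; linarith [abs_nonneg C0]
  · refine le_trans ?_ (hlow s (by linarith) hs hs2)
    have : -(12-2)*ε = -(10*ε) := by ring
    rw [this]
    gcongr
    exact min_le_left _ _
end SW

namespace SW
open Complex Topology MeasureTheory Set

noncomputable def PK (s : ℂ) : ℂ := 1/s - 1/(s+1)

lemma PK_norm {c : ℝ} (hc : 1 ≤ c) (t : ℝ) : ‖PK (c + t * I)‖ ≤ (1 + t^2)⁻¹ := by
  set s : ℂ := c + t * I with hs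
  have hre : s.re = c := by simp [hs]
  have him : s.im = t := by simp [hs]
  have h0 : s ≠ 0 := by intro h; rw [h] at hre; simp at hre; linarith
  have h1 : s + 1 ≠ 0 := by intro h; have := congrArg Complex.re h; simp [hre] at this; linarith
  have e : PK s = (s * (s+1))⁻¹ := by rw [PK]; field_simp; ring
  have n1 : 1 + t^2 ≤ ‖s‖^2 := by rw [← Complex.normSq_eq_norm_sq, Complex.normSq_apply, hre, him]; nlinarith
  have n2 : 1 + t^2 ≤ ‖s+1‖^2 := by rw [← Complex.normSq_eq_norm_sq, Complex.normSq_apply]; simp [hre, him]; nlinarith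
  rw [e, norm_inv, norm_mul]
  have h3 : 1 + t^2 ≤ ‖s‖*‖s+1‖ := by
    apply le_of_sq_le_sq _ (by positivity)
    rw [mul_pow]
    calc (1+t^2)^2 = (1+t^2)*(1+t^2) := by ring
      _ ≤ _ := by gcongr
  exact inv_anti₀ (by positivity) h3

lemma PK_cont {c : ℝ} (hc : 1 ≤ c) : Continuous (fun t : ℝ => PK (c + t * I)) := by
  unfold PK
  have h0 : ∀ t : ℝ, (c + t * I : ℂ) ≠ 0 := by intro t h; have := congrArg Complex.re h; simp at this; linarith
  have h1 : ∀ t : ℝ, (c + t * I + 1 : ℂ) ≠ 0 := by intro t h; have := congrArg Complex.re h; simp at this; linarith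
  refine (Continuous.div (by fun_prop) (by fun_prop) h0).sub (Continuous.div (by fun_prop) (by fun_prop) h1)

lemma PK_int {c : ℝ} (hc : 1 ≤ c) : Integrable (fun t : ℝ => PK (c + t * I)) := 
  integrable_inv_one_add_sq.mono' (PK_cont hc).aestronglyMeasurable (Filter.Eventually.of_forall (PK_norm hc))

lemma perron_g {c y : ℝ} (hc : 1 ≤ c) (hy : 0 < y) : 
    (1/(2*Real.pi)) • ∫ t : ℝ, (y:ℂ)^(-(c + t * I)) • PK (c + t * I) = ((max 0 (1 - y) : ℝ) : ℂ) := by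
  set f : ℝ → ℂ := fun t => indicator (Ioc 0 1) (fun _ => 1 : ℝ → ℂ) t - indicator (Ioc 0 1) (fun t => ↑t ^ (1:ℂ) : ℝ → ℂ) t with hf
  have hM : ∀ s : ℂ, 0 < s.re → HasMellin f s (PK s) := by
    intro s hs
    have h1 := hasMellin_one_Ioc hs
    have h2 := hasMellin_cpow_Ioc 1 (s := s) (by simp; linarith)
    have := hasMellin_sub h1.1 h2.1
    rw [h1.2, h2.2] at this
    exact this
  have hfe : ∀ t : ℝ, 0 < t → f t = ((max 0 (1 - t) : ℝ) : ℂ) := by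
    intro t ht
    rw [hf]
    by_cases h : t ≤ 1
    · have : t ∈ Ioc (0:ℝ) 1 := ⟨ht, h⟩
      simp [indicator_of_mem this, max_eq_right (sub_nonneg.2 h)]
    · have : t ∉ Ioc (0:ℝ) 1 := fun h' => h h'.2
      simp only [indicator_of_notMem this]
      rw [max_eq_left (by linarith)]; simp
  have hc0 : 0 < c := by linarith
  have hPe : ∀ t : ℝ, mellin f (c + t * I) = PK (c + t * I) := fun t => (hM _ (by simpa using hc0)).2
  have := mellinInv_mellin_eq c f hy (hM c (by simpa using hc0)).1 ?_ ?_
  · rw [hfe y hy, mellinInv] at this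
    simp_rw [hPe] at this
    exact this
  · unfold VerticalIntegrable
    simp_rw [hPe]
    exact PK_int hc
  · have h1 : ContinuousAt (fun t : ℝ => ((max 0 (1 - t) : ℝ) : ℂ)) y := by fun_prop
    refine h1.congr ?_
    filter_upwards [Ioi_mem_nhds hy] with t ht using (hfe t ht).symm

lemma perron {a : ℕ → ℂ} {c x : ℝ} (hc : 1 ≤ c) (hx : 0 < x) (ha : LSeriesSummable a c) :
    HasSum (fun n : ℕ => if n = 0 then 0 else a n * ((max 0 (1 - n/x) : ℝ) : ℂ)) 
      ((1/(2*Real.pi)) • ∫ t : ℝ, (x:ℂ)^(c + t * I) * LSeries a (c + t * I) * PK (c + t * I)) := by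
  set F : ℕ → ℝ → ℂ := fun n t => LSeries.term a (c + t * I) n * ((x:ℂ)^(c + t * I) * PK (c + t * I)) with hF
  have hxn : ∀ t : ℝ, ‖(x:ℂ)^(c + t * I)‖ = x^c := by
    intro t; rw [Complex.norm_cpow_eq_rpow_re_of_pos hx]; simp
  have hcont : ∀ n, Continuous (F n) := by
    intro n
    by_cases hn : n = 0
    · simp [hF, hn]; exact continuous_const
    · simp only [hF, LSeries.term_of_ne_zero hn]
      have : (n:ℂ) ≠ 0 := by exact_mod_cast hn
      have hx' : (x:ℂ) ≠ 0 := by exact_mod_cast hx.ne'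
      refine (Continuous.div continuous_const (Continuous.const_cpow (by fun_prop) (Or.inl this)) ?_).mul ((Continuous.const_cpow (by fun_prop) (Or.inl hx')).mul (PK_cont hc))
      intro t; simp [this]
  have hnorm : ∀ n t, ‖F n t‖ ≤ ‖LSeries.term a c n‖ * x^c * (1+t^2)⁻¹ := by
    intro n t
    simp only [hF]
    rw [norm_mul, norm_mul, hxn, mul_assoc]
    have : ‖LSeries.term a (c + t * I) n‖ = ‖LSeries.term a c n‖ := by
      rw [LSeries.norm_term_eq, LSeries.norm_term_eq]; simp
    rw [this]
    gcongr
    exact PK_norm hc t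
  have hintg : ∀ n, Integrable (F n) := fun n => 
    (integrable_inv_one_add_sq.const_mul (‖LSeries.term a c n‖ * x^c)).mono' (hcont n).aestronglyMeasurable (Filter.Eventually.of_forall (hnorm n))
  have hsum : Summable fun n => ∫ t, ‖F n t‖ := by
    refine Summable.of_nonneg_of_le (fun n => integral_nonneg fun t => norm_nonneg _) (fun n => integral_mono (hintg n).norm ((integrable_inv_one_add_sq.const_mul (‖LSeries.term a c n‖ * x^c))) (hnorm n)) ?_
    simp_rw [integral_const_mul]
    exact ((Summable.norm ha).mul_right _).mul_right _
  have h1 := (hasSum_integral_of_summable_integral_norm hintg hsum).const_smul (1/(2*Real.pi))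
  have e1 : (fun n : ℕ => if n = 0 then 0 else a n * ((max 0 (1 - n/x) : ℝ) : ℂ)) = fun i => (1 / (2 * Real.pi)) • ∫ t : ℝ, F i t := by
    funext n
    by_cases hn : n = 0
    · simp [hn, hF]
    · rw [if_neg hn]
      have hn0 : (0:ℝ) < n := by exact_mod_cast Nat.pos_of_ne_zero hn
      rw [← perron_g hc (div_pos hn0 hx)]
      have : ∀ t : ℝ, F n t = a n * (((n/x:ℝ):ℂ)^(-(c + t * I)) • PK (c + t * I)) := by
        intro t
        simp only [hF, LSeries.term_of_ne_zero hn, smul_eq_mul]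
        rw [Complex.cpow_neg]
        have e : ((n/x:ℝ):ℂ)^(c + t * I) = (n:ℂ)^(c + t * I) / (x:ℂ)^(c + t * I) := by
          have : ((n/x:ℝ):ℂ) = ((n:ℝ):ℂ) * ((x⁻¹:ℝ):ℂ) := by push_cast; ring
          rw [this, Complex.mul_cpow_ofReal_nonneg hn0.le (by positivity), Complex.ofReal_inv, Complex.inv_cpow]
          · simp [div_eq_mul_inv]
          · rw [Complex.arg_ofReal_of_nonneg hx.le]; exact Real.pi_pos.ne
        rw [e, inv_div]
        ring
      simp_rw [this]
      rw [integral_const_mul, mul_smul_comm]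
  have e2 : (1/(2*Real.pi)) • ∫ t : ℝ, (x:ℂ)^(c + t * I) * LSeries a (c + t * I) * PK (c + t * I) = (1 / (2 * Real.pi)) • ∫ t : ℝ, ∑' i, F i t := by
    congr 1
    refine integral_congr_ae (Filter.Eventually.of_forall fun t => ?_)
    simp only [hF]
    rw [tsum_mul_right, LSeries]
    ring
  rw [e1, e2]
  exact h1

lemma int_const : ∃ K : ℝ, 0 < K ∧ Integrable (fun t : ℝ => (|t| + 2)^(1/2:ℝ) * (1+t^2)⁻¹) ∧ ∫ t : ℝ, (|t| + 2)^(1/2:ℝ) * (1+t^2)⁻¹ ≤ K := by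
  refine ⟨|∫ t : ℝ, (|t| + 2)^(1/2:ℝ) * (1+t^2)⁻¹| + 1, by positivity, ?_, (le_abs_self _).trans (by linarith)⟩
  have := (integrable_rpow_neg_one_add_norm_sq (E := ℝ) (μ := volume) (r := 3/2) (by simp; norm_num)).const_mul 3
  refine this.mono' ?_ (Filter.Eventually.of_forall fun t => ?_)
  · have : Continuous (fun t : ℝ => (|t| + 2)^(1/2:ℝ) * (1+t^2)⁻¹) := by
      refine Continuous.mul (Continuous.rpow_const (by fun_prop) (fun _ => Or.inr (by norm_num))) (Continuous.inv₀ (by fun_prop) (fun t => by positivity))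
    exact this.aestronglyMeasurable
  · rw [Real.norm_of_nonneg (by positivity), Real.norm_eq_abs, sq_abs]
    have e : (1+t^2)^(-(3/2)/2:ℝ) = (1+t^2)^(1/4:ℝ) * (1+t^2)⁻¹ := by
      rw [← Real.rpow_neg_one, ← Real.rpow_add (by positivity)]; norm_num
    rw [e, ← mul_assoc]
    gcongr
    have h1 : |t| + 2 ≤ 9 * (1+t^2)^(1/2:ℝ) := by
      rw [← Real.sqrt_eq_rpow]
      have : |t| ≤ √(1+t^2) := Real.abs_le_sqrt (by linarith)
      have h2 : 1 ≤ √(1+t^2) := by rw [Real.one_le_sqrt]; nlinarith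
      linarith
    calc (|t|+2)^(1/2:ℝ) ≤ (9 * (1+t^2)^(1/2:ℝ))^(1/2:ℝ) := by gcongr
      _ = _ := by
        rw [Real.mul_rpow (by norm_num) (by positivity), ← Real.rpow_mul (by positivity), ← Real.sqrt_eq_rpow]
        rw [show (9:ℝ) = 3^2 by norm_num, Real.sqrt_sq (by norm_num)]; norm_num

lemma perron_bound : ∃ K : ℝ, 0 < K ∧ ∀ (a : ℕ → ℂ) (M : ℝ), (∀ s : ℂ, 1 < s.re → LSeriesSummable a s) → 
    (∀ s : ℂ, 1 < s.re → s.re ≤ 2 → ‖LSeries a s‖ ≤ M * (|s.im| + 2)^(1/2:ℝ)) → ∀ x : ℝ, Real.exp 1 ≤ x →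
    ‖∑ n ∈ Finset.Icc 1 ⌊x⌋₊, a n * (x - n)‖ ≤ K * M * x^2 := by
  obtain ⟨K, hK, hi, hKi⟩ := int_const
  refine ⟨Real.exp 1 * K, by positivity, fun a M ha hM x hx => ?_⟩
  have hx0 : 0 < x := (Real.exp_pos 1).trans_le hx
  have hl : 1 ≤ Real.log x := by rwa [Real.le_log_iff_exp_le hx0]
  set c : ℝ := 1 + 1/Real.log x with hc
  have hc1 : 1 < c := by rw [hc]; have : 0 < 1/Real.log x := by positivity
                         linarith
  have hc2 : c ≤ 2 := by rw [hc]; have : 1/Real.log x ≤ 1 := by rw [div_le_one (by positivity)]; exact hl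
                         linarith
  have hxc : x^c = x * Real.exp 1 := by
    rw [hc, Real.rpow_add hx0, Real.rpow_one, Real.rpow_def_of_pos hx0]
    congr 2
    field_simp
  have hp := perron hc1.le hx0 (ha c (by simpa using hc1))
  have hs : ∑ n ∈ Finset.Icc 1 ⌊x⌋₊, a n * (x - n) = x * ((1/(2*Real.pi)) • ∫ t : ℝ, (x:ℂ)^(c + t * I) * LSeries a (c + t * I) * PK (c + t * I)) := by
    rw [← hp.tsum_eq, tsum_eq_sum (s := Finset.Icc 1 ⌊x⌋₊), Finset.mul_sum]
    · refine Finset.sum_congr rfl fun n hn => ?_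
      rw [Finset.mem_Icc] at hn
      have hnx : (n:ℝ) ≤ x := (Nat.le_floor_iff hx0.le).1 hn.2
      rw [if_neg (by omega), max_eq_right (by rw [sub_nonneg, div_le_one hx0]; exact hnx)]
      have hx' : (x:ℂ) ≠ 0 := by exact_mod_cast hx0.ne'
      push_cast
      field_simp
    · intro n hn
      rw [Finset.mem_Icc] at hn
      by_cases h0 : n = 0
      · simp [h0]
      · rw [if_neg h0, max_eq_left]; simp
        have : x < n := by
          apply (Nat.floor_lt hx0.le).1
          omega
        rw [sub_nonpos, one_le_div hx0]; exact this.le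
  have hbd : ‖∫ t : ℝ, (x:ℂ)^(c + t * I) * LSeries a (c + t * I) * PK (c + t * I)‖ ≤ x^c * M * K := by
    calc _ ≤ ∫ t : ℝ, x^c * M * ((|t| + 2)^(1/2:ℝ) * (1+t^2)⁻¹) := by
          refine norm_integral_le_of_norm_le (hi.const_mul _) (Filter.Eventually.of_forall fun t => ?_)
          rw [norm_mul, norm_mul, Complex.norm_cpow_eq_rpow_re_of_pos hx0]
          have h1 := hM (c + t * I) (by simpa using hc1) (by simpa using hc2)
          have h2 := PK_norm hc1.le t
          simp at h1
          simp only [add_re, ofReal_re, mul_re, I_re, mul_zero, ofReal_im, I_im, mul_one, sub_zero, add_zero]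
          calc x^c * ‖LSeries a (c + t * I)‖ * ‖PK (c + t * I)‖ ≤ x^c * (M * (|t|+2)^(1/2:ℝ)) * (1+t^2)⁻¹ := by
                have h3 : ‖LSeries a (c + t * I)‖ ≤ M * (|t|+2)^(1/2:ℝ) := by simpa using h1
                have h4 := (norm_nonneg _).trans h3
                gcongr
            _ = _ := by ring
      _ = x^c * M * ∫ t : ℝ, ((|t| + 2)^(1/2:ℝ) * (1+t^2)⁻¹) := integral_const_mul _ _
      _ ≤ _ := by
        have hM0 : 0 ≤ M := by
          have h1 := (norm_nonneg _).trans (hM 2 (by simp) (by simp))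
          have h2 : 0 < (|(2:ℂ).im| + 2)^(1/2:ℝ) := by positivity
          exact le_of_mul_le_mul_right (by simpa using h1) h2
        gcongr
  rw [hs, norm_mul, norm_smul]
  have hM0 : 0 ≤ x^c * M * K := (norm_nonneg _).trans hbd
  have hpi : ‖(1/(2*Real.pi):ℝ)‖ ≤ 1 := by
    rw [Real.norm_of_nonneg (by positivity), div_le_one (by positivity)]
    linarith [Real.pi_gt_three]
  have : ‖(x:ℂ)‖ = x := by simp [abs_of_pos hx0]
  rw [this]
  calc _ ≤ x * (1 * (x^c * M * K)) := by gcongr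
    _ = _ := by rw [hxc]; ring
end SW

namespace SW
open Complex Topology Set

lemma abel_ineq {c : ℕ → ℂ} {w : ℕ → ℝ} {m N : ℕ} {B : ℝ} (hmN : m ≤ N) (hw0 : ∀ n, m ≤ n → 0 ≤ w n) 
    (hw : ∀ n, m ≤ n → w (n+1) ≤ w n) (hB : ∀ i, m ≤ i → i ≤ N → ‖∑ n ∈ Finset.Ico m i, c n‖ ≤ B) :
    ‖∑ n ∈ Finset.Ico m N, w n * c n‖ ≤ B * w m := by
  have key : ∀ i, m ≤ i → i ≤ N → ‖∑ n ∈ Finset.Ico m i, w n * c n - w i * ∑ n ∈ Finset.Ico m i, c n‖ ≤ B * (w m - w i) := by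
    intro i hi
    induction i, hi using Nat.le_induction with
    | base => intro _; simp
    | succ i hi ih =>
      intro hiN
      have h1 := ih (by omega)
      have h2 := hB (i+1) (by omega) hiN
      have e : ∑ n ∈ Finset.Ico m (i+1), w n * c n - w (i+1) * ∑ n ∈ Finset.Ico m (i+1), c n = 
        (∑ n ∈ Finset.Ico m i, w n * c n - w i * ∑ n ∈ Finset.Ico m i, c n) + ((w i - w (i+1) : ℝ):ℂ) * ∑ n ∈ Finset.Ico m (i+1), c n := by
        rw [Finset.sum_Ico_succ_top hi, Finset.sum_Ico_succ_top hi]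
        push_cast; ring
      rw [e]
      refine (norm_add_le _ _).trans ?_
      rw [norm_mul, Complex.norm_real, Real.norm_of_nonneg (sub_nonneg.2 (hw i hi))]
      have := mul_le_mul_of_nonneg_left h2 (sub_nonneg.2 (hw i hi))
      linarith
  have h1 := key N hmN le_rfl
  have h2 := hB N hmN le_rfl
  have h3 := norm_le_insert' (∑ n ∈ Finset.Ico m N, w n * c n) (w N * ∑ n ∈ Finset.Ico m N, c n)
  rw [norm_mul, Complex.norm_real, Real.norm_of_nonneg (hw0 N hmN)] at h3
  have := mul_le_mul_of_nonneg_left h2 (hw0 N hmN)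
  linarith

lemma partial_bound (j : ℕ) : ∃ K : ℝ, 0 < K ∧ ∀ (a : ℕ → ℂ) (M : ℝ), 1 ≤ M → (∀ s : ℂ, 1 < s.re → LSeriesSummable a s) → 
    (∀ s : ℂ, 1 < s.re → s.re ≤ 2 → ‖LSeries a s‖ ≤ M * (|s.im| + 2)^(1/2:ℝ)) → 
    (∀ n : ℕ, 1 ≤ n → ‖a n‖ ≤ (1 + Real.log n)^(2*j)) → ∀ N : ℕ, 3 ≤ N →
    ‖∑ n ∈ Finset.Icc 1 N, a n‖ ≤ K * M * N * (Real.log N)^j := by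
  obtain ⟨K, hK, hp⟩ := perron_bound
  refine ⟨5 * K + 3^(2*j), by positivity, fun a M hM1 ha hM hal N hN => ?_⟩
  have hN3 : (3:ℝ) ≤ N := by exact_mod_cast hN
  have he : Real.exp 1 ≤ N := by linarith [Real.exp_one_lt_d9]
  have hl : 1 ≤ Real.log N := by rwa [Real.le_log_iff_exp_le (by linarith)]
  have hlj : 1 ≤ (Real.log N)^j := one_le_pow₀ hl
  set h : ℝ := N/(Real.log N)^j with hh
  have hh0 : 0 < h := by positivity
  have hhN : h ≤ N := by rw [hh]; exact div_le_self (by positivity) hlj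
  have h1 := hp a M ha hM N he
  have h2 := hp a M ha hM (N + h) (by linarith)
  rw [Nat.floor_natCast] at h1
  have hfl : N ≤ ⌊(N:ℝ) + h⌋₊ := Nat.le_floor (by linarith)
  set N' := ⌊(N:ℝ) + h⌋₊ with hN'
  have hN'2 : (N':ℝ) ≤ N + h := Nat.floor_le (by positivity)
  have hsplit : ∀ f : ℕ → ℂ, ∑ n ∈ Finset.Icc 1 N', f n = ∑ n ∈ Finset.Icc 1 N, f n + ∑ n ∈ Finset.Ioc N N', f n := by
    intro f
    have e1 : ∀ k, Finset.Icc 1 k = Finset.Ioc 0 k := fun k => rfl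
    rw [e1, e1, ← Finset.sum_Ioc_consecutive f (Nat.zero_le N) hfl]
  have e : (h:ℂ) * ∑ n ∈ Finset.Icc 1 N, a n = ∑ n ∈ Finset.Icc 1 N', a n * (((N + h : ℝ):ℂ) - n) - ∑ n ∈ Finset.Icc 1 N, a n * (((N:ℝ):ℂ) - n) 
      - ∑ n ∈ Finset.Ioc N N', a n * (((N + h : ℝ):ℂ) - n) := by
    rw [hsplit, add_sub_right_comm, add_sub_cancel_right, ← Finset.sum_sub_distrib, Finset.mul_sum]
    refine Finset.sum_congr rfl fun n _ => ?_
    push_cast; ring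
  have h3 : ‖∑ n ∈ Finset.Ioc N N', a n * (((N + h : ℝ):ℂ) - n)‖ ≤ h * (h * (3 * Real.log N)^(2*j)) := by
    refine (norm_sum_le _ _).trans ?_
    have : ∀ n ∈ Finset.Ioc N N', ‖a n * (((N + h : ℝ):ℂ) - n)‖ ≤ (3 * Real.log N)^(2*j) * h := by
      intro n hn
      rw [Finset.mem_Ioc] at hn
      have hn1 : (N:ℝ) < n := by exact_mod_cast hn.1
      have hn2 : (n:ℝ) ≤ N' := by exact_mod_cast hn.2
      rw [norm_mul]
      gcongr
      · refine (hal n (by omega)).trans ?_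
        have : Real.log n ≤ Real.log 2 + Real.log N := by
          rw [← Real.log_mul (by norm_num) (by positivity)]
          exact Real.log_le_log (by linarith) (by linarith)
        have hn0 : 0 ≤ Real.log n := Real.log_natCast_nonneg _
        have := Real.log_two_lt_d9
        gcongr
        linarith
      · have : (((N + h : ℝ):ℂ) - n) = ((N + h - n : ℝ) : ℂ) := by push_cast; ring
        rw [this, Complex.norm_real, Real.norm_of_nonneg (by linarith)]
        linarith
    refine (Finset.sum_le_card_nsmul _ _ _ this).trans ?_
    rw [Nat.card_Ioc, nsmul_eq_mul, Nat.cast_sub hfl]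
    have : (N':ℝ) - N ≤ h := by linarith
    calc _ ≤ h * ((3 * Real.log N)^(2*j) * h) := by gcongr
      _ = _ := by ring
  have h4 : h * ‖∑ n ∈ Finset.Icc 1 N, a n‖ ≤ K * M * (N + h)^2 + K * M * N^2 + h * (h * (3 * Real.log N)^(2*j)) := by
    have : ‖(h:ℂ) * ∑ n ∈ Finset.Icc 1 N, a n‖ = h * ‖∑ n ∈ Finset.Icc 1 N, a n‖ := by
      rw [norm_mul, Complex.norm_real, Real.norm_of_nonneg hh0.le]
    rw [← this, e]
    refine (norm_sub_le _ _).trans (add_le_add ((norm_sub_le _ _).trans (add_le_add h2 h1)) h3)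
  have hKM : 0 < K * M := by positivity
  have h5 : K * M * (N + h)^2 ≤ K * M * (4 * N^2) := by gcongr; nlinarith
  have h6 : h * ‖∑ n ∈ Finset.Icc 1 N, a n‖ ≤ h * ((5 * K + 3^(2*j)) * M * N * (Real.log N)^j) := by
    have e1 : h * (Real.log N)^j = N := by rw [hh]; field_simp
    have e2 : h * ((5 * K + 3^(2*j)) * M * N * (Real.log N)^j) = 5 * (K * M) * N^2 + 3^(2*j) * M * N^2 := by
      calc _ = (5 * K + 3^(2*j)) * M * N * (h * (Real.log N)^j) := by ring
        _ = _ := by rw [e1]; ring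
    have e3 : h * (h * (3 * Real.log N)^(2*j)) = 3^(2*j) * N^2 := by
      rw [mul_pow, mul_comm 2 j, pow_mul (Real.log N)]
      calc _ = 3^(j*2) * (h * (Real.log N)^j)^2 := by ring
        _ = _ := by rw [e1]
    rw [e2]
    rw [e3] at h4
    have : (3:ℝ)^(2*j) * N^2 ≤ 3^(2*j) * M * N^2 := by
      have : (0:ℝ) ≤ 3^(2*j) * N^2 := by positivity
      nlinarith
    linarith
  exact le_of_mul_le_mul_left h6 hh0

lemma logMul_iter (b : ℕ → ℂ) (k n : ℕ) : (LSeries.logMul^[k] b) n = (Real.log n : ℂ)^k * b n := by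
  induction k with
  | zero => simp
  | succ k ih => 
    rw [Function.iterate_succ_apply', LSeries.logMul, ih, Complex.natCast_log]
    ring

lemma log_pow_le (j : ℕ) (hj : 1 ≤ j) {x : ℝ} (hx : 1 ≤ x) : (Real.log x)^j ≤ (2*j)^j * x^(1/2:ℝ) := by
  have hj0 : (0:ℝ) < j := by exact_mod_cast hj
  have h := Real.log_le_rpow_div (x := x) (by linarith) (ε := 1/(2*j)) (by positivity)
  have h0 : 0 ≤ Real.log x := Real.log_nonneg hx
  calc (Real.log x)^j ≤ (x^(1/(2*j):ℝ)/(1/(2*j)))^j := by gcongr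
    _ = (2*j)^j * (x^(1/(2*j):ℝ))^j := by rw [← mul_pow]; congr 1; field_simp
    _ = _ := by 
      rw [← Real.rpow_natCast (x^(1/(2*j):ℝ)), ← Real.rpow_mul (by linarith)]
      congr 2
      field_simp

lemma sum_main (j : ℕ) (hj : 1 ≤ j) : ∃ K : ℝ, 0 < K ∧ ∀ (b : ℕ → ℂ) (M : ℝ), 1 ≤ M → (∀ s : ℂ, 1 < s.re → LSeriesSummable b s) → 
    (∀ s : ℂ, 1 < s.re → s.re ≤ 2 → ‖LSeries (LSeries.logMul^[2*j-1] b) s‖ ≤ M * (|s.im| + 2)^(1/2:ℝ)) → 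
    (∀ n : ℕ, 1 ≤ n → ‖b n‖ ≤ (1 + Real.log n)) → ∀ N : ℕ, 3 ≤ N →
    ‖∑ n ∈ Finset.Icc 2 N, b n / Real.log n‖ ≤ K * M * (N / (Real.log N)^j) := by
  obtain ⟨K, hK, hp⟩ := partial_bound j
  refine ⟨18 * (2*j)^j + 2 * K * 2^(2*j), by positivity, fun b M hM1 hb hM hbl N hN => ?_⟩
  set a := LSeries.logMul^[2*j-1] b with ha
  have hN3 : (3:ℝ) ≤ N := by exact_mod_cast hN
  have he : Real.exp 1 ≤ N := by linarith [Real.exp_one_lt_d9]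
  have hl : 1 ≤ Real.log N := by rwa [Real.le_log_iff_exp_le (by linarith)]
  have hlj : 1 ≤ (Real.log N)^j := one_le_pow₀ hl
  have hb1 : LSeries.abscissaOfAbsConv b ≤ 1 := LSeries.abscissaOfAbsConv_le_of_forall_lt_LSeriesSummable' fun y hy => hb y (by exact_mod_cast hy)
  have hasum : ∀ s : ℂ, 1 < s.re → LSeriesSummable a s := by
    intro s hs
    apply LSeriesSummable_of_abscissaOfAbsConv_lt_re
    rw [ha, LSeries.absicssaOfAbsConv_logPowMul]
    exact lt_of_le_of_lt hb1 (by exact_mod_cast hs)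
  have hal : ∀ n : ℕ, 1 ≤ n → ‖a n‖ ≤ (1 + Real.log n)^(2*j) := by
    intro n hn
    have h0 : 0 ≤ Real.log n := Real.log_natCast_nonneg _
    rw [ha, logMul_iter, norm_mul, norm_pow, Complex.norm_real, Real.norm_of_nonneg h0]
    calc _ ≤ (1 + Real.log n)^(2*j-1) * (1 + Real.log n) := by gcongr; linarith; exact hbl n hn
      _ = _ := by rw [← pow_succ]; congr 1; omega
  have hS := hp a M hM1 hasum hM hal
  have htriv : ∀ m : ℕ, ‖∑ n ∈ Finset.Ico 2 m, b n / Real.log n‖ ≤ 3 * m := by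
    intro m
    refine (norm_sum_le _ _).trans ?_
    have : ∀ n ∈ Finset.Ico 2 m, ‖b n / Real.log n‖ ≤ 3 := by
      intro n hn
      rw [Finset.mem_Ico] at hn
      have h2 : Real.log 2 ≤ Real.log n := Real.log_le_log (by norm_num) (by exact_mod_cast hn.1)
      have := Real.log_two_gt_d9
      rw [norm_div, Complex.norm_real, Real.norm_of_nonneg (by linarith), div_le_iff₀ (by linarith)]
      have := hbl n (by omega)
      linarith
    refine (Finset.sum_le_card_nsmul _ _ _ this).trans ?_
    rw [Nat.card_Ico, nsmul_eq_mul, mul_comm]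
    gcongr
    omega
  have hsq : 18 * √(N:ℝ) ≤ 18 * (2*j)^j * M * (N/(Real.log N)^j) := by
    have := log_pow_le j hj (x := N) (by linarith)
    rw [← Real.sqrt_eq_rpow] at this
    have h2 : √(N:ℝ) * √(N:ℝ) = N := Real.mul_self_sqrt (by positivity)
    have h3 : √(N:ℝ) ≤ (2*j)^j * (N/(Real.log N)^j) := by
      rw [← mul_div_assoc, le_div_iff₀ (by positivity)]
      calc _ ≤ √(N:ℝ) * ((2*j)^j * √(N:ℝ)) := by gcongr
        _ = (2*j)^j * (√(N:ℝ) * √(N:ℝ)) := by ring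
        _ = _ := by rw [h2]
    have h4 : (0:ℝ) ≤ (2*j)^j * (N/(Real.log N)^j) := by positivity
    nlinarith
  have hsq1 : 1 ≤ √(N:ℝ) := by rw [Real.one_le_sqrt]; linarith
  set m := ⌈√(N:ℝ)⌉₊ + 4 with hm
  have hm1 : (m:ℝ) ≤ 6 * √(N:ℝ) := by
    rw [hm]; push_cast
    have := Nat.ceil_lt_add_one (Real.sqrt_nonneg (N:ℝ))
    linarith
  have hm2 : √(N:ℝ) ≤ m := by
    rw [hm]; push_cast
    have := Nat.le_ceil (√(N:ℝ))
    linarith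
  have hIcc : Finset.Icc 2 N = Finset.Ico 2 (N+1) := rfl
  have hpos2 : 0 ≤ 2 * K * 2^(2*j) * M * (N/(Real.log N)^j) := by positivity
  rw [add_mul, add_mul]
  rcases le_or_gt (N+1) m with hcase | hcase
  · rw [hIcc]
    refine (htriv (N+1)).trans ?_
    have : ((N+1:ℕ):ℝ) ≤ m := by exact_mod_cast hcase
    linarith
  · rw [hIcc, ← Finset.sum_Ico_consecutive _ (by omega : 2 ≤ m) hcase.le]
    refine (norm_add_le _ _).trans ?_
    have h1 : ‖∑ n ∈ Finset.Ico 2 m, b n / Real.log n‖ ≤ 18 * √(N:ℝ) := (htriv m).trans (by linarith)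
    have hlog : ∀ n, m ≤ n → 0 < Real.log n := fun n hn => Real.log_pos (by
      have : m ≤ n := hn
      have : 1 < n := by omega
      exact_mod_cast this)
    have h2 : ‖∑ n ∈ Finset.Ico m (N+1), ((1/(Real.log n)^(2*j) : ℝ):ℂ) * a n‖ ≤ (2 * (K * M * N * (Real.log N)^j)) * (1/(Real.log m)^(2*j)) := by
      refine abel_ineq (w := fun n : ℕ => 1/(Real.log n)^(2*j)) hcase.le (fun n hn => by have := hlog n hn; positivity) (fun n hn => ?_) ?_
      · have := hlog n hn
        gcongr
        · have : m ≤ n := hn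
          have : 0 < n := by omega
          exact_mod_cast this
        · linarith
      · intro i hi hiN
        have hmono : ∀ r : ℕ, 3 ≤ r → r ≤ N → ‖∑ n ∈ Finset.Icc 1 r, a n‖ ≤ K * M * N * (Real.log N)^j := by
          intro r hr hrN
          refine (hS r hr).trans ?_
          have : (0:ℝ) < r := by exact_mod_cast (by omega : 0 < r)
          have h0 : 0 ≤ Real.log r := Real.log_natCast_nonneg _
          gcongr
        have e : ∑ n ∈ Finset.Ico m i, a n = ∑ n ∈ Finset.Icc 1 (i-1), a n - ∑ n ∈ Finset.Icc 1 (m-1), a n := by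
          have e1 : ∀ k, 1 ≤ k → Finset.Icc 1 (k-1) = Finset.Ico 1 k := by
            intro k hk; ext y; simp; omega
          rw [e1 i (by omega), e1 m (by omega), ← Finset.sum_Ico_consecutive _ (by omega : 1 ≤ m) hi]
          ring
        rw [e]
        refine (norm_sub_le _ _).trans ?_
        have r1 := hmono (i-1) (by omega) (by omega)
        have r2 := hmono (m-1) (by omega) (by omega)
        linarith
    have h3 : ∑ n ∈ Finset.Ico m (N+1), b n / Real.log n = ∑ n ∈ Finset.Ico m (N+1), ((1/(Real.log n)^(2*j) : ℝ):ℂ) * a n := by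
      refine Finset.sum_congr rfl fun n hn => ?_
      rw [Finset.mem_Ico] at hn
      have hl0 : (Real.log n : ℂ) ≠ 0 := by exact_mod_cast (hlog n hn.1).ne'
      rw [ha, logMul_iter]
      rw [Complex.ofReal_div, Complex.ofReal_pow, Complex.ofReal_one]
      have : (Real.log n : ℂ)^(2*j) = (Real.log n : ℂ)^(2*j-1) * Real.log n := by rw [← pow_succ]; congr 1; omega
      rw [this]
      field_simp
    rw [h3]
    have h4 : (2 * (K * M * N * (Real.log N)^j)) * (1/(Real.log m)^(2*j)) ≤ 2 * K * 2^(2*j) * M * (N/(Real.log N)^j) := by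
      have hlm : Real.log N / 2 ≤ Real.log m := by
        rw [← Real.log_sqrt (by positivity)]
        exact Real.log_le_log (by positivity) hm2
      have h5 : 1/(Real.log m)^(2*j) ≤ 1/(Real.log N / 2)^(2*j) := by gcongr
      calc _ ≤ (2 * (K * M * N * (Real.log N)^j)) * (1/(Real.log N / 2)^(2*j)) := by gcongr
        _ = _ := by rw [div_pow, two_mul j, pow_add (Real.log N)]; field_simp
    linarith
end SW

namespace SW
open Complex Topology Set

noncomputable def Li (N : ℕ) : ℝ := ∫ t in (2 : ℝ)..N, 1 / Real.log t

noncomputable def rj (j N : ℕ) : ℝ := N / (Real.log N)^j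

lemma log3 {N : ℕ} (hN : 3 ≤ N) : 1 ≤ Real.log N := by
  have hN3 : (3:ℝ) ≤ N := by exact_mod_cast hN
  have he : Real.exp 1 ≤ N := by linarith [Real.exp_one_lt_d9]
  rwa [Real.le_log_iff_exp_le (by linarith)]

lemma rj_ge (j : ℕ) : ∃ K : ℝ, 0 < K ∧ ∀ N : ℕ, 3 ≤ N → √(N:ℝ) * Real.log N ≤ K * rj j N ∧ 1 ≤ K * rj j N := by
  refine ⟨(2*(j+1:ℕ))^(j+1), by positivity, fun N hN => ?_⟩
  have hl := log3 hN
  have hN3 : (3:ℝ) ≤ N := by exact_mod_cast hN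
  have h1 : √(N:ℝ) * Real.log N ≤ (2*(j+1:ℕ))^(j+1) * rj j N := by
    have := log_pow_le (j+1) (by omega) (x := N) (by linarith)
    rw [← Real.sqrt_eq_rpow] at this
    have h2 : √(N:ℝ) * √(N:ℝ) = N := Real.mul_self_sqrt (by positivity)
    rw [rj, ← mul_div_assoc, le_div_iff₀ (by positivity)]
    calc _ = √(N:ℝ) * (Real.log N)^(j+1) := by ring
      _ ≤ √(N:ℝ) * ((2*(j+1:ℕ))^(j+1) * √(N:ℝ)) := by gcongr
      _ = (2*(j+1:ℕ))^(j+1) * (√(N:ℝ) * √(N:ℝ)) := by ring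
      _ = _ := by rw [h2]
  refine ⟨h1, le_trans ?_ h1⟩
  have hsq1 : 1 ≤ √(N:ℝ) := by rw [Real.one_le_sqrt]; linarith
  nlinarith

open ArithmeticFunction in
lemma prime_sum {f : ℕ → ℂ} (hf : ∀ n, ‖f n‖ ≤ 1) {N : ℕ} (hN : 3 ≤ N) : 
    ‖∑ p ∈ Finset.filter Nat.Prime (Finset.Icc 2 N), f p - ∑ n ∈ Finset.Icc 2 N, f n * (vonMangoldt n : ℂ) / Real.log n‖ ≤ 4 * (√(N:ℝ) * Real.log N) := by
  have hl2 := Real.log_two_gt_d9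
  have hlog : ∀ n ∈ Finset.Icc 2 N, Real.log 2 ≤ Real.log n := fun n hn => Real.log_le_log (by norm_num) (by exact_mod_cast (Finset.mem_Icc.1 hn).1)
  have e : ∑ p ∈ Finset.filter Nat.Prime (Finset.Icc 2 N), f p - ∑ n ∈ Finset.Icc 2 N, f n * (vonMangoldt n : ℂ) / Real.log n = 
     - ∑ n ∈ Finset.filter (fun n => ¬ Nat.Prime n) (Finset.Icc 2 N), f n * (vonMangoldt n : ℂ) / Real.log n := by
    rw [← Finset.sum_filter_add_sum_filter_not (Finset.Icc 2 N) Nat.Prime (fun n => f n * (vonMangoldt n : ℂ) / Real.log n)]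
    have : ∑ p ∈ Finset.filter Nat.Prime (Finset.Icc 2 N), f p = ∑ p ∈ Finset.filter Nat.Prime (Finset.Icc 2 N), f p * (vonMangoldt p : ℂ) / Real.log p := by
      refine Finset.sum_congr rfl fun p hp => ?_
      rw [Finset.mem_filter] at hp
      rw [vonMangoldt_apply_prime hp.2]
      have : (Real.log p : ℂ) ≠ 0 := by
        have := hlog p hp.1
        exact_mod_cast (by linarith : (0:ℝ) < Real.log p).ne'
      field_simp
    rw [this]; ring
  rw [e, norm_neg]
  refine (norm_sum_le _ _).trans ?_
  have h1 : ∀ n ∈ Finset.filter (fun n => ¬ Nat.Prime n) (Finset.Icc 2 N), ‖f n * (vonMangoldt n : ℂ) / Real.log n‖ ≤ 2 * vonMangoldt n := by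
    intro n hn
    rw [Finset.mem_filter] at hn
    have := hlog n hn.1
    have hv : 0 ≤ vonMangoldt n := vonMangoldt_nonneg
    rw [norm_div, norm_mul, Complex.norm_real, Complex.norm_real, Real.norm_of_nonneg hv, Real.norm_of_nonneg (by linarith), div_le_iff₀ (by linarith)]
    have := hf n
    nlinarith [mul_nonneg hv (norm_nonneg (f n))]
  refine (Finset.sum_le_sum h1).trans ?_
  have h2 := Chebyshev.psi_sub_theta_le (x := N) (by exact_mod_cast (by omega : 1 ≤ N))
  rw [Chebyshev.psi_sub_theta_eq_sum_not_prime, Nat.floor_natCast] at h2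
  rw [← Finset.mul_sum]
  have h3 : ∑ n ∈ Finset.filter (fun n => ¬ Nat.Prime n) (Finset.Icc 2 N), vonMangoldt n ≤ ∑ n ∈ Finset.filter (fun n => ¬ Nat.Prime n) (Finset.Ioc 0 N), vonMangoldt n := by
    refine Finset.sum_le_sum_of_subset_of_nonneg ?_ (fun _ _ _ => vonMangoldt_nonneg)
    intro n hn
    simp only [Finset.mem_filter, Finset.mem_Icc, Finset.mem_Ioc] at hn ⊢
    exact ⟨⟨by omega, hn.1.2⟩, hn.2⟩
  linarith

lemma Li_sum {N : ℕ} (hN : 2 ≤ N) : |∑ n ∈ Finset.Icc 2 N, 1/Real.log n - Li N| ≤ 4 := by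
  have hl2 := Real.log_two_gt_d9
  have ha : AntitoneOn (fun t : ℝ => 1/Real.log t) (Icc ((2:ℕ):ℝ) (N:ℝ)) := by
    intro x hx y hy hxy
    have h2x : (2:ℝ) ≤ x := by exact_mod_cast hx.1
    have : 0 < Real.log x := Real.log_pos (by linarith)
    simp only
    gcongr
  have h1 := ha.integral_le_sum_Ico hN
  have h2 := ha.sum_le_integral_Ico hN
  have e0 : Finset.Icc 2 N = Finset.Ico 2 (N+1) := rfl
  have e1 : ∑ n ∈ Finset.Icc 2 N, 1/Real.log n = ∑ n ∈ Finset.Ico 2 N, 1/Real.log n + 1/Real.log N := by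
    rw [e0, Finset.sum_Ico_succ_top hN]
  have e2 : ∑ n ∈ Finset.Icc 2 N, 1/Real.log n = 1/Real.log (2:ℕ) + ∑ n ∈ Finset.Ico 2 N, 1/Real.log (n+1:ℕ) := by
    rw [e0, Finset.sum_eq_sum_Ico_succ_bot (by omega), Finset.sum_Ico_add' (fun n : ℕ => 1/Real.log n) 2 N 1]
  have hLi : Li N = ∫ x in ((2:ℕ):ℝ)..N, 1/Real.log x := by simp [Li]
  rw [← hLi] at h1 h2
  have b1 : 0 ≤ 1/Real.log N := by have := Real.log_natCast_nonneg N; positivity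
  have b2 : 1/Real.log (2:ℕ) ≤ 4 := by
    push_cast
    rw [div_le_iff₀ (by linarith)]; linarith
  rw [abs_le]
  constructor <;> linarith

lemma tw_sum (j : ℕ) (hj : 1 ≤ j) : ∃ K : ℝ, 0 < K ∧ ∀ (q : ℕ) [NeZero q] (χ : DirichletCharacter ℂ q), χ ≠ 1 → ∀ N : ℕ, 3 ≤ N →
    ‖∑ p ∈ Finset.filter Nat.Prime (Finset.Icc 2 N), χ p‖ ≤ K * q * rj j N := by
  obtain ⟨K, hK, hs⟩ := sum_main j hj
  obtain ⟨C, hC, ht⟩ := twist_bound (2*j-1)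
  obtain ⟨R, hR, hr⟩ := rj_ge j
  refine ⟨K * (C+1) + 4 * R, by positivity, fun q _ χ hχ N hN => ?_⟩
  have hq : (1:ℝ) ≤ q := by exact_mod_cast Nat.pos_of_neZero q
  have hq2 : (1:ℝ) ≤ (q:ℝ)^(1/2:ℝ) := Real.one_le_rpow hq (by norm_num)
  have hq3 : (q:ℝ)^(1/2:ℝ) ≤ q := by
    calc (q:ℝ)^(1/2:ℝ) ≤ (q:ℝ)^(1:ℝ) := Real.rpow_le_rpow_of_exponent_le hq (by norm_num)
      _ = q := Real.rpow_one _
  have hχ1 : ∀ n : ℕ, ‖χ n‖ ≤ 1 := fun n => χ.norm_le_one _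
  have h1 := hs (tw χ) ((C+1) * (q:ℝ)^(1/2:ℝ)) (by nlinarith) (fun s hs => DirichletCharacter.LSeriesSummable_twist_vonMangoldt χ hs) ?_ ?_ N hN
  · have h2 := prime_sum (f := fun n : ℕ => χ n) hχ1 hN
    have h3 : ‖∑ p ∈ Finset.filter Nat.Prime (Finset.Icc 2 N), χ p‖ ≤ 4 * (√(N:ℝ) * Real.log N) + K * ((C+1) * (q:ℝ)^(1/2:ℝ)) * rj j N := by
      have h2c : ‖∑ p ∈ Finset.filter Nat.Prime (Finset.Icc 2 N), χ p - ∑ n ∈ Finset.Icc 2 N, tw χ n / Real.log n‖ ≤ 4 * (√(N:ℝ) * Real.log N) := h2.trans (by linarith)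
      have h2b := norm_le_insert' (∑ p ∈ Finset.filter Nat.Prime (Finset.Icc 2 N), χ p) (∑ n ∈ Finset.Icc 2 N, tw χ n / Real.log n)
      rw [rj]
      linarith
    have h4 := (hr N hN).1
    have hrj : 0 ≤ rj j N := by 
      have := Real.log_natCast_nonneg N
      rw [rj]; positivity
    have h5 : K * ((C+1) * (q:ℝ)^(1/2:ℝ)) * rj j N ≤ K * ((C+1) * q) * rj j N := by gcongr
    have h6 : R * rj j N ≤ R * q * rj j N := by
      have := mul_nonneg hR.le hrj
      nlinarith
    nlinarith
  · intro s hs1 hs2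
    refine (ht q χ hχ s hs1 hs2).trans ?_
    rw [Real.mul_rpow (by positivity) (by positivity), ← mul_assoc]
    gcongr
    linarith
  · intro n hn
    have h0 : 0 ≤ Real.log n := Real.log_natCast_nonneg n
    have h1 := ArithmeticFunction.vonMangoldt_le_log (n := n)
    have hv : 0 ≤ ArithmeticFunction.vonMangoldt n := ArithmeticFunction.vonMangoldt_nonneg
    rw [tw, Pi.mul_apply, norm_mul, Complex.norm_real, Real.norm_of_nonneg hv]
    have := hχ1 n
    nlinarith

lemma pnt (j : ℕ) (hj : 1 ≤ j) : ∃ K : ℝ, 0 < K ∧ ∀ N : ℕ, 3 ≤ N →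
    |((Finset.filter Nat.Prime (Finset.Icc 2 N)).card : ℝ) - Li N| ≤ K * rj j N := by
  obtain ⟨K, hK, hs⟩ := sum_main j hj
  obtain ⟨C, hC, ht⟩ := zw_bound (2*j-1)
  obtain ⟨R, hR, hr⟩ := rj_ge j
  refine ⟨K * (C+1) + 8 * R, by positivity, fun N hN => ?_⟩
  have h1 := hs zw (C+1) (by linarith) (fun s hs => zw_summable hs) ?_ ?_ N hN
  · have h2 := prime_sum (f := fun _ : ℕ => 1) (fun _ => by simp) hN
    have h3 := Li_sum (N := N) (by omega)
    have h4 := hr N hN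
    have e : ∑ n ∈ Finset.Icc 2 N, zw n / Real.log n = ∑ n ∈ Finset.Icc 2 N, 1 * (ArithmeticFunction.vonMangoldt n : ℂ) / Real.log n - ((∑ n ∈ Finset.Icc 2 N, 1/Real.log n : ℝ):ℂ) := by
      push_cast
      rw [← Finset.sum_sub_distrib]
      refine Finset.sum_congr rfl fun n _ => ?_
      simp only [zw, Pi.sub_apply, Pi.one_apply]
      ring
    rw [e] at h1
    have h5 : |((Finset.filter Nat.Prime (Finset.Icc 2 N)).card : ℝ) - ∑ n ∈ Finset.Icc 2 N, 1/Real.log n| ≤ 4 * (√(N:ℝ) * Real.log N) + K * (C+1) * rj j N := by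
      rw [← Real.norm_eq_abs, ← Complex.norm_real]
      have := (norm_add_le _ _).trans (add_le_add h2 h1)
      rw [rj]
      refine le_trans (le_of_eq ?_) this
      congr 1
      push_cast
      simp
    have := (abs_sub_le ((Finset.filter Nat.Prime (Finset.Icc 2 N)).card : ℝ) (∑ n ∈ Finset.Icc 2 N, 1/Real.log n) (Li N))
    linarith
  · intro s hs1 hs2
    refine (ht s hs1 hs2).trans ?_
    gcongr
    linarith
  · intro n hn
    have h0 : 0 ≤ Real.log n := Real.log_natCast_nonneg n
    have h1 := ArithmeticFunction.vonMangoldt_le_log (n := n)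
    have hv : 0 ≤ ArithmeticFunction.vonMangoldt n := ArithmeticFunction.vonMangoldt_nonneg
    simp only [zw, Pi.sub_apply, Pi.one_apply]
    refine (norm_sub_le _ _).trans ?_
    rw [Complex.norm_real, Real.norm_of_nonneg hv, norm_one]
    linarith

noncomputable def piAP (q N : ℕ) : ℕ := (Finset.filter (fun p => Nat.Prime p ∧ q ∣ p - 1) (Finset.Icc 2 N)).card

lemma pi_ap (j : ℕ) (hj : 1 ≤ j) : ∃ K : ℝ, 0 < K ∧ ∀ (q : ℕ), 1 ≤ q → ∀ N : ℕ, 3 ≤ N →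
    |(piAP q N : ℝ) - Li N / q.totient| ≤ K * q * rj j N := by
  obtain ⟨K1, hK1, h1⟩ := tw_sum j hj
  obtain ⟨K2, hK2, h2⟩ := pnt j hj
  obtain ⟨R, hR, hr⟩ := rj_ge j
  refine ⟨K1 + K2 + R, by positivity, fun q hq N hN => ?_⟩
  haveI : NeZero q := ⟨by omega⟩
  have hq1 : (1:ℝ) ≤ q := by exact_mod_cast hq
  set P := Finset.filter Nat.Prime (Finset.Icc 2 N) with hP
  have hφ : (0:ℝ) < q.totient := by exact_mod_cast Nat.totient_pos.2 hq
  have hφ1 : (1:ℝ) ≤ q.totient := by exact_mod_cast Nat.totient_pos.2 hq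
  have hrj : 0 ≤ rj j N := by 
    have := Real.log_natCast_nonneg N
    rw [rj]; positivity
  have e1 : ∑ χ : DirichletCharacter ℂ q, ∑ p ∈ P, χ p = q.totient * (piAP q N : ℂ) := by
    rw [Finset.sum_comm]
    simp_rw [DirichletCharacter.sum_characters_eq ℂ]
    rw [← Finset.sum_filter, Finset.sum_const, nsmul_eq_mul, mul_comm, piAP, hP, Finset.filter_filter]
    congr 3
    refine Finset.filter_congr fun p hp => ?_
    rw [Finset.mem_Icc] at hp
    have : (p : ZMod q) = 1 ↔ q ∣ p - 1 := by
      rw [← Nat.cast_one, eq_comm, ZMod.natCast_eq_natCast_iff, Nat.modEq_iff_dvd' (by omega)]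
    rw [this]
  rw [← Finset.add_sum_erase _ _ (Finset.mem_univ (1 : DirichletCharacter ℂ q))] at e1
  have h3 : ‖∑ χ ∈ Finset.univ.erase (1 : DirichletCharacter ℂ q), ∑ p ∈ P, χ p‖ ≤ q.totient * (K1 * q * rj j N) := by
    refine (norm_sum_le _ _).trans ?_
    refine (Finset.sum_le_card_nsmul _ _ (K1 * q * rj j N) (fun χ hχ => h1 q χ (Finset.ne_of_mem_erase hχ) N hN)).trans ?_
    rw [nsmul_eq_mul]
    gcongr
    refine (Finset.card_le_univ _).trans ?_
    rw [← Nat.card_eq_fintype_card, DirichletCharacter.card_eq_totient_of_hasEnoughRootsOfUnity]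
  have h4 : ‖∑ p ∈ P, (1 : DirichletCharacter ℂ q) p - (P.card : ℂ)‖ ≤ q := by
    have : (P.card : ℂ) = ∑ p ∈ P, 1 := by simp
    rw [this, ← Finset.sum_sub_distrib]
    refine (norm_sum_le _ _).trans ?_
    have hle : ∀ p ∈ P, ‖(1 : DirichletCharacter ℂ q) p - 1‖ ≤ if p ∈ q.primeFactors then 1 else 0 := by
      intro p hp
      rw [hP, Finset.mem_filter] at hp
      split_ifs with h
      · rw [Nat.mem_primeFactors] at h
        rw [char_zero _ p (fun h' => Nat.Prime.not_dvd_one h.1 (h'.symm.gcd_eq_one ▸ Nat.dvd_gcd h.2.1 dvd_rfl))]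
        simp
      · have hco : p.Coprime q := by
          rw [Nat.Prime.coprime_iff_not_dvd hp.2]
          intro hd
          exact h (Nat.mem_primeFactors.2 ⟨hp.2, hd, by omega⟩)
        rw [MulChar.one_apply ((ZMod.isUnit_iff_coprime p q).2 hco)]
        simp
    refine (Finset.sum_le_sum hle).trans ?_
    rw [← Finset.sum_filter, Finset.sum_const, nsmul_eq_mul, mul_one]
    have : (Finset.filter (fun p => p ∈ q.primeFactors) P).card ≤ (Finset.Icc 1 q).card := by
      apply Finset.card_le_card
      intro p hp
      rw [Finset.mem_filter, Nat.mem_primeFactors] at hp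
      rw [Finset.mem_Icc]
      exact ⟨hp.2.1.one_le, Nat.le_of_dvd (by omega) hp.2.2.1⟩
    rw [Nat.card_Icc] at this
    exact_mod_cast this
  have h5 := h2 N hN
  have h6 : ‖(q.totient * (piAP q N : ℂ)) - (Li N : ℂ)‖ ≤ q.totient * (K1 * q * rj j N) + q + K2 * rj j N := by
    rw [← e1]
    have e2 : ∑ p ∈ P, (1 : DirichletCharacter ℂ q) p + ∑ χ ∈ Finset.univ.erase (1 : DirichletCharacter ℂ q), ∑ p ∈ P, χ p - (Li N : ℂ) = 
      ∑ χ ∈ Finset.univ.erase (1 : DirichletCharacter ℂ q), ∑ p ∈ P, χ p + (∑ p ∈ P, (1 : DirichletCharacter ℂ q) p - (P.card : ℂ)) + (((P.card : ℝ) - Li N : ℝ) : ℂ) := by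
      push_cast; ring
    rw [e2]
    refine (norm_add_le _ _).trans (add_le_add ((norm_add_le _ _).trans (add_le_add h3 h4)) ?_)
    rw [Complex.norm_real]; exact h5
  have h7 : q.totient * |(piAP q N : ℝ) - Li N / q.totient| = ‖(q.totient * (piAP q N : ℂ)) - (Li N : ℂ)‖ := by
    have : (q.totient * (piAP q N : ℂ)) - (Li N : ℂ) = ((q.totient * ((piAP q N : ℝ) - Li N / q.totient) : ℝ) : ℂ) := by
      rw [mul_sub, mul_div_cancel₀ _ hφ.ne']; push_cast; ring
    rw [this, Complex.norm_real, Real.norm_eq_abs, abs_mul, abs_of_pos hφ]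
  have h8 := (hr N hN).2
  have h9 : q.totient * |(piAP q N : ℝ) - Li N / q.totient| ≤ q.totient * ((K1 + K2 + R) * q * rj j N) := by
    rw [h7]
    refine h6.trans ?_
    have a1 : (q:ℝ) ≤ q.totient * (R * q * rj j N) := by
      calc (q:ℝ) = 1 * (q * 1) := by ring
        _ ≤ q.totient * (q * (R * rj j N)) := by gcongr
        _ = _ := by ring
    have a2 : K2 * rj j N ≤ q.totient * (K2 * q * rj j N) := by
      calc K2 * rj j N = 1 * (K2 * 1 * rj j N) := by ring
        _ ≤ q.totient * (K2 * q * rj j N) := by gcongr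
    linarith
  exact le_of_mul_le_mul_left h9 hφ
end SW

namespace SW
open Complex Topology Set

lemma divisor_bound (ε : ℝ) (hε : 0 < ε) : ∃ C : ℝ, 1 ≤ C ∧ ∀ q : ℕ, q ≠ 0 → (q.divisors.card : ℝ) ≤ C * (q:ℝ)^ε := by
  set P := ⌈(2:ℝ)^(1/ε)⌉₊ with hP
  have hl2 : 0 < Real.log 2 := Real.log_pos (by norm_num)
  set A := 1 + 1/(ε * Real.log 2) with hA
  have hA1 : 1 ≤ A := by rw [hA]; have : 0 < 1/(ε * Real.log 2) := by positivity
                         linarith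
  refine ⟨A^P, one_le_pow₀ hA1, fun q hq => ?_⟩
  have h1 : ∀ p ∈ q.primeFactors, ((q.factorization p + 1 : ℕ):ℝ) ≤ (if p < P then A else 1) * ((p:ℝ)^(q.factorization p))^ε := by
    intro p hp
    have hpp := Nat.prime_of_mem_primeFactors hp
    have hp2 : (2:ℝ) ≤ p := by exact_mod_cast hpp.two_le
    set k := q.factorization p
    rw [← Real.rpow_natCast_mul (by positivity), mul_comm (k:ℝ) ε]
    split_ifs with h
    · have e1 : (2:ℝ)^(ε*k) ≤ (p:ℝ)^(ε*k) := by gcongr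
      have e2 : (ε * k) * Real.log 2 + 1 ≤ (2:ℝ)^(ε*k) := by
        rw [Real.rpow_def_of_pos (by norm_num), mul_comm (ε*k)]
        exact Real.add_one_le_exp _
      have e3 : ((k+1:ℕ):ℝ) ≤ A * ((ε * k) * Real.log 2 + 1) := by
        have : A * ((ε * k) * Real.log 2 + 1) = k + 1 + ε * k * Real.log 2 + 1/(ε * Real.log 2) := by
          rw [hA]; field_simp; ring
        rw [this]; push_cast
        have : 0 < 1/(ε * Real.log 2) := by positivity
        have : 0 ≤ ε * k * Real.log 2 := by positivity
        linarith
      calc _ ≤ _ := e3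
        _ ≤ A * (p:ℝ)^(ε*k) := by gcongr; linarith
    · have : (2:ℝ)^(1/ε) ≤ p := (Nat.le_ceil _).trans (by exact_mod_cast not_lt.1 h)
      have := Real.rpow_le_rpow (by positivity) this hε.le
      rw [← Real.rpow_mul (by norm_num), one_div_mul_cancel hε.ne', Real.rpow_one] at this
      rw [one_mul, Real.rpow_mul (by positivity), Real.rpow_natCast]
      have h3 : ((k+1:ℕ):ℝ) ≤ 2^k := by exact_mod_cast Nat.lt_two_pow_self
      exact h3.trans (by gcongr)
  rw [Nat.card_divisors hq, Nat.cast_prod]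
  calc _ ≤ ∏ p ∈ q.primeFactors, ((if p < P then A else 1) * ((p:ℝ)^(q.factorization p))^ε) := Finset.prod_le_prod (by intros; positivity) h1
    _ = (∏ p ∈ q.primeFactors, (if p < P then A else 1)) * ∏ p ∈ q.primeFactors, ((p:ℝ)^(q.factorization p))^ε := Finset.prod_mul_distrib
    _ ≤ A^P * (q:ℝ)^ε := by
      gcongr
      · rw [← Finset.prod_filter, Finset.prod_const]
        refine pow_le_pow_right₀ hA1 ?_
        calc _ ≤ (Finset.range P).card := Finset.card_le_card (fun p hp => by
                simp only [Finset.mem_filter] at hp; simpa using hp.2)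
          _ = P := by simp
      · rw [Real.finsetProd_rpow _ _ (by intros; positivity)]
        refine Real.rpow_le_rpow (Finset.prod_nonneg (by intros; positivity)) ?_ hε.le
        have := Nat.prod_factorization_pow_eq_self hq
        have h5 : ((q.factorization.prod fun a b => a ^ b : ℕ):ℝ) = q := by rw [this]
        rw [Nat.prod_factorization_eq_prod_primeFactors] at h5
        push_cast at h5
        exact h5.le

lemma norm_gauss {p : ℕ} [Fact p.Prime] (χ : DirichletCharacter ℂ p) (hχ : χ ≠ 1) :
    ‖gaussSum χ (ZMod.stdAddChar (N := p))‖ = √(p:ℝ) := by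
  have h := gaussSum_mul_gaussSum_eq_card hχ (ZMod.isPrimitive_stdAddChar p)
  rw [← star_gaussSum_eq, ZMod.card] at h
  have h2 := congrArg norm h
  rw [norm_mul, norm_star, Complex.norm_natCast] at h2
  rw [← h2, Real.sqrt_mul_self (norm_nonneg _)]

lemma sin_lower {x : ℝ} (h0 : 0 < x) (h1 : x < 1) : 2 * (x * (1-x)) ≤ Real.sin (Real.pi * x) := by
  have hpi := Real.pi_pos
  rcases le_total x (1/2) with h | h
  · have := Real.mul_le_sin (x := Real.pi * x) (by positivity) (by nlinarith)
    have e : 2 / Real.pi * (Real.pi * x) = 2 * x := by field_simp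
    rw [e] at this
    nlinarith
  · have := Real.mul_le_sin (x := Real.pi * (1-x)) (by nlinarith) (by nlinarith)
    have e : 2 / Real.pi * (Real.pi * (1-x)) = 2 * (1-x) := by field_simp
    have e2 : Real.pi * (1-x) = Real.pi - Real.pi * x := by ring
    rw [e, e2, Real.sin_pi_sub] at this
    nlinarith

lemma geom_bd {p : ℕ} [Fact p.Prime] (K a : ℕ) (ha : 1 ≤ a) (hap : a < p) :
    ‖∑ k ∈ Finset.Icc 1 K, ZMod.stdAddChar (N := p) ((a:ZMod p) * k)‖ ≤ (1/2) * (p * (1/(a:ℝ)) + p * (1/((p - a : ℕ):ℝ))) := by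
  set w := ZMod.stdAddChar (N := p) (a:ZMod p) with hw
  have ha' : (1:ℝ) ≤ a := by exact_mod_cast ha
  have hap' : (a:ℝ) < p := by exact_mod_cast hap
  have e1 : ∑ k ∈ Finset.Icc 1 K, ZMod.stdAddChar (N := p) ((a:ZMod p) * k) = ∑ k ∈ Finset.Ico 1 (K+1), w^k := by
    refine Finset.sum_congr rfl fun k _ => ?_
    rw [hw, ← AddChar.map_nsmul_eq_pow, nsmul_eq_mul, mul_comm]
  have hx0 : 0 < (a:ℝ)/p := div_pos (by linarith) (by linarith)
  have hx1 : (a:ℝ)/p < 1 := by rw [div_lt_one (by linarith)]; exact hap'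
  have hs := sin_lower hx0 hx1
  have hwe : w = Complex.exp (Complex.I * ((2 * (Real.pi * (a/p)) : ℝ))) := by
    have := ZMod.stdAddChar_coe (N := p) (a:ℤ)
    rw [hw]; push_cast at this ⊢
    rw [this]; congr 1; ring
  have hn : ‖w - 1‖ = 2 * Real.sin (Real.pi * (a/p)) := by
    rw [hwe, Complex.norm_exp_I_mul_ofReal_sub_one, mul_div_cancel_left₀ _ (by norm_num), Real.norm_of_nonneg]
    have : 0 ≤ (a:ℝ)/p * (1 - a/p) := mul_nonneg hx0.le (by linarith)
    linarith
  have hpos : 0 < (a:ℝ)/p * (1 - a/p) := mul_pos hx0 (by linarith)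
  have hw1 : ‖w‖ = 1 := by rw [hw, ZMod.stdAddChar_apply]; exact Circle.norm_coe _
  have hne : w ≠ 1 := by
    intro h; rw [h, sub_self, norm_zero] at hn; linarith
  rw [e1, geom_sum_Ico hne (by omega), norm_div, hn]
  have hnum : ‖w^(K+1) - w^1‖ ≤ 2 := by
    refine (norm_sub_le _ _).trans ?_
    rw [norm_pow, norm_pow, hw1]; norm_num
  calc _ ≤ 2 / (2 * (2 * ((a:ℝ)/p * (1 - a/p)))) := by gcongr
    _ = _ := by
      rw [Nat.cast_sub hap.le]
      have h1 : (p:ℝ) ≠ 0 := by linarith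
      have h2 : (a:ℝ) ≠ 0 := by linarith
      have h3 : (p:ℝ) - a ≠ 0 := by linarith
      have h4 : 1 - (a:ℝ)/p = (p-a)/p := by field_simp
      rw [h4]
      field_simp
      ring

lemma harm_bd (n : ℕ) (hn : 1 ≤ n) : ∑ a ∈ Finset.Icc 1 (n-1), 1/(a:ℝ) ≤ 1 + Real.log n := by
  have h := harmonic_le_one_add_log n
  rw [harmonic_eq_sum_Icc] at h
  push_cast at h
  refine le_trans ?_ h
  simp only [one_div]
  exact Finset.sum_le_sum_of_subset_of_nonneg (Finset.Icc_subset_Icc_right (by omega)) (by intros; positivity)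

lemma polya_vin {p : ℕ} [hp : Fact p.Prime] (χ : DirichletCharacter ℂ p) (hχ : χ ≠ 1) (K : ℕ) (hK : K ≤ p - 1) :
    ‖∑ k ∈ Finset.Icc 1 K, χ k‖ ≤ √(p:ℝ) * (1 + Real.log p) := by
  have hp1 := hp.out.one_lt
  have hχ' : χ⁻¹ ≠ 1 := by simpa using hχ
  set g := gaussSum χ⁻¹ (ZMod.stdAddChar (N := p)) with hg
  have hgn : ‖g‖ = √(p:ℝ) := norm_gauss _ hχ'
  have h1 : g * ∑ k ∈ Finset.Icc 1 K, χ k = ∑ a : ZMod p, χ⁻¹ a * ∑ k ∈ Finset.Icc 1 K, ZMod.stdAddChar (N := p) (a * k) := by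
    rw [Finset.mul_sum]
    simp_rw [Finset.mul_sum]
    rw [Finset.sum_comm]
    refine Finset.sum_congr rfl fun k hk => ?_
    rw [Finset.mem_Icc] at hk
    have hk0 : (k:ZMod p) ≠ 0 := by
      rw [Ne, ZMod.natCast_eq_zero_iff]
      exact Nat.not_dvd_of_pos_of_lt (by omega) (by omega)
    have := gaussSum_mulShift_eq χ⁻¹ (ZMod.stdAddChar (N := p)) (Units.mk0 (k:ZMod p) hk0)
    rw [inv_inv, Units.val_mk0] at this
    rw [hg, mul_comm, ← this, gaussSum]
    refine Finset.sum_congr rfl fun a _ => ?_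
    rw [AddChar.mulShift_apply, mul_comm a]
  have h2 : ‖∑ a : ZMod p, χ⁻¹ a * ∑ k ∈ Finset.Icc 1 K, ZMod.stdAddChar (N := p) (a * k)‖ ≤ p * (1 + Real.log p) := by
    have e1 : ∑ a : ZMod p, χ⁻¹ a * ∑ k ∈ Finset.Icc 1 K, ZMod.stdAddChar (N := p) (a * k)
      = ∑ a ∈ Finset.Icc 1 (p-1), χ⁻¹ (a:ZMod p) * ∑ k ∈ Finset.Icc 1 K, ZMod.stdAddChar (N := p) ((a:ZMod p) * k) := by
      rw [← Finset.sum_subset (Finset.subset_univ (Finset.univ.erase (0:ZMod p)))]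
      · symm
        refine Finset.sum_bij (fun (a:ℕ) _ => (a:ZMod p)) ?_ ?_ ?_ ?_
        · intro a ha
          rw [Finset.mem_Icc] at ha
          simp only [Finset.mem_erase, Finset.mem_univ, and_true]
          rw [Ne, ZMod.natCast_eq_zero_iff]
          exact Nat.not_dvd_of_pos_of_lt (by omega) (by omega)
        · intro a ha b hb hab
          rw [Finset.mem_Icc] at ha hb
          rw [ZMod.natCast_eq_natCast_iff'] at hab
          rwa [Nat.mod_eq_of_lt (by omega), Nat.mod_eq_of_lt (by omega)] at hab
        · intro b hb
          simp only [Finset.mem_erase, Finset.mem_univ, and_true] at hb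
          refine ⟨b.val, ?_, ZMod.natCast_zmod_val b⟩
          have := ZMod.val_lt b
          have h3 : b.val ≠ 0 := by rwa [Ne, ZMod.val_eq_zero]
          rw [Finset.mem_Icc]; omega
        · intros; rfl
      · intro x _ hx
        simp only [Finset.mem_erase, Finset.mem_univ, and_true, not_not] at hx
        rw [hx, MulChar.map_zero, zero_mul]
    rw [e1]
    refine (norm_sum_le _ _).trans ?_
    calc _ ≤ ∑ a ∈ Finset.Icc 1 (p-1), (1/2) * (p * (1/(a:ℝ)) + p * (1/((p - a : ℕ):ℝ))) := by
          refine Finset.sum_le_sum fun a ha => ?_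
          rw [Finset.mem_Icc] at ha
          rw [norm_mul]
          have := geom_bd (p := p) K a ha.1 (by omega)
          have h3 := χ⁻¹.norm_le_one (a:ZMod p)
          have h4 := norm_nonneg (∑ k ∈ Finset.Icc 1 K, ZMod.stdAddChar (N := p) ((a:ZMod p) * k))
          nlinarith
      _ = (1/2) * (p * ∑ a ∈ Finset.Icc 1 (p-1), 1/(a:ℝ) + p * ∑ a ∈ Finset.Icc 1 (p-1), 1/((p - a : ℕ):ℝ)) := by
          rw [Finset.mul_sum, Finset.mul_sum, ← Finset.sum_add_distrib, Finset.mul_sum]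
      _ = (1/2) * (p * ∑ a ∈ Finset.Icc 1 (p-1), 1/(a:ℝ) + p * ∑ a ∈ Finset.Icc 1 (p-1), 1/(a:ℝ)) := by
          congr 3
          refine Finset.sum_bij (fun a _ => p - a) ?_ ?_ ?_ ?_
          · intro a ha; rw [Finset.mem_Icc] at ha ⊢; omega
          · intro a ha b hb hab; rw [Finset.mem_Icc] at ha hb; omega
          · intro b hb; rw [Finset.mem_Icc] at hb
            exact ⟨p - b, by rw [Finset.mem_Icc]; omega, by omega⟩
          · intros; rfl
      _ ≤ _ := by
          have := harm_bd p (by omega)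
          have : (p:ℝ) * ∑ a ∈ Finset.Icc 1 (p-1), 1/(a:ℝ) ≤ p * (1 + Real.log p) := by gcongr
          linarith
  rw [← h1, norm_mul, hgn] at h2
  have hsq : 0 < √(p:ℝ) := Real.sqrt_pos.2 (by exact_mod_cast hp.out.pos)
  have : √(p:ℝ) * ‖∑ k ∈ Finset.Icc 1 K, χ k‖ ≤ √(p:ℝ) * (√(p:ℝ) * (1 + Real.log p)) := by
    rw [← mul_assoc, Real.mul_self_sqrt (by positivity)]; exact h2
  exact le_of_mul_le_mul_left this hsq

end SW

namespace SW
open Complex Topology Set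

lemma card_char_pow {p : ℕ} [hp : Fact p.Prime] (M : ℕ) (hM : M ∣ p - 1) :
    (Finset.univ.filter (fun χ : DirichletCharacter ℂ p => χ^M = 1)).card = M := by
  obtain ⟨e⟩ := DirichletCharacter.mulEquiv_units ℂ p
  have hc : IsCyclic (DirichletCharacter ℂ p) := isCyclic_of_surjective e.symm e.symm.surjective
  have h := IsCyclic.card_powMonoidHom_ker (G := DirichletCharacter ℂ p) M
  have hcard : Nat.card (DirichletCharacter ℂ p) = p - 1 := by
    rw [Nat.card_congr e.toEquiv, Nat.card_eq_fintype_card, ZMod.card_units]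
  rw [hcard, Nat.gcd_eq_right hM] at h
  rw [Nat.card_eq_fintype_card, Fintype.card_subtype] at h
  refine Eq.trans (congrArg _ ?_) h
  ext χ
  simp [MonoidHom.mem_ker]

lemma count_pow {p : ℕ} [hp : Fact p.Prime] (M c K : ℕ) (hM : M ∣ p - 1) (hc : (c : ZMod p) ≠ 0) (hK : K ≤ p - 1) :
    |(((Finset.Icc 1 K).filter (fun k : ℕ => ((c * k : ℕ) : ZMod p)^M = 1)).card : ℝ) - K * M / ((p-1 : ℕ):ℝ)| ≤ √(p:ℝ) * (1 + Real.log p) := by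
  have hp1 := hp.out.one_lt
  set n : ℕ := p - 1 with hn
  have hn0 : (0:ℝ) < n := by exact_mod_cast (by omega : 0 < p - 1)
  have hnC : (n:ℂ) ≠ 0 := by exact_mod_cast hn0.ne'
  have hcu : IsUnit (c : ZMod p) := isUnit_iff_ne_zero.2 hc
  set S : DirichletCharacter ℂ p → ℂ := fun χ => (χ^M) c * ∑ k ∈ Finset.Icc 1 K, (χ^M) k with hS
  have h1 : (n:ℂ) * (((Finset.Icc 1 K).filter (fun k : ℕ => ((c * k : ℕ) : ZMod p)^M = 1)).card : ℂ) = ∑ χ, S χ := by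
    rw [Finset.card_filter, Nat.cast_sum, Finset.mul_sum]
    simp only [hS, Finset.mul_sum]
    rw [Finset.sum_comm]
    refine Finset.sum_congr rfl fun k hk => ?_
    rw [Finset.mem_Icc] at hk
    have hk0 : (k:ZMod p) ≠ 0 := by
      rw [Ne, ZMod.natCast_eq_zero_iff]
      exact Nat.not_dvd_of_pos_of_lt (by omega) (by omega)
    have hu : IsUnit ((c * k : ℕ) : ZMod p) := by
      rw [Nat.cast_mul]; exact isUnit_iff_ne_zero.2 (mul_ne_zero hc hk0)
    have := DirichletCharacter.sum_characters_eq ℂ (((c * k : ℕ) : ZMod p)^M)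
    rw [Nat.totient_prime hp.out] at this
    have e : ∀ χ : DirichletCharacter ℂ p, (χ^M) c * (χ^M) k = χ (((c * k : ℕ) : ZMod p)^M) := by
      intro χ
      obtain ⟨u, hu⟩ := hu
      rw [← map_mul, ← Nat.cast_mul, ← hu, MulChar.pow_apply_coe, map_pow]
    simp_rw [e, this]
    split_ifs <;> simp [hn]
  have h2 : ∑ χ ∈ Finset.univ.filter (fun χ : DirichletCharacter ℂ p => χ^M = 1), S χ = (K * M : ℂ) := by
    rw [Finset.sum_congr rfl (g := fun _ => (K:ℂ)), Finset.sum_const, card_char_pow M hM, nsmul_eq_mul, mul_comm]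
    intro χ hχ
    rw [Finset.mem_filter] at hχ
    simp only [hS]
    rw [hχ.2, MulChar.one_apply hcu, one_mul, Finset.sum_congr rfl (g := fun _ => (1:ℂ))]
    · simp
    · intro k hk
      rw [Finset.mem_Icc] at hk
      refine MulChar.one_apply (isUnit_iff_ne_zero.2 ?_)
      rw [Ne, ZMod.natCast_eq_zero_iff]
      exact Nat.not_dvd_of_pos_of_lt (by omega) (by omega)
  have h3 : ‖∑ χ ∈ Finset.univ.filter (fun χ : DirichletCharacter ℂ p => ¬ χ^M = 1), S χ‖ ≤ n * (√(p:ℝ) * (1 + Real.log p)) := by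
    have hl : 0 ≤ Real.log p := Real.log_natCast_nonneg p
    refine (norm_sum_le _ _).trans ?_
    calc _ ≤ ∑ χ ∈ Finset.univ.filter (fun χ : DirichletCharacter ℂ p => ¬ χ^M = 1), (√(p:ℝ) * (1 + Real.log p)) := by
          refine Finset.sum_le_sum fun χ hχ => ?_
          rw [Finset.mem_filter] at hχ
          simp only [hS, norm_mul]
          have a1 := polya_vin (χ^M) hχ.2 K hK
          have a2 := (χ^M).norm_le_one (c : ZMod p)
          have a3 := norm_nonneg (∑ k ∈ Finset.Icc 1 K, (χ^M) k)
          nlinarith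
      _ = (Finset.univ.filter (fun χ : DirichletCharacter ℂ p => ¬ χ^M = 1)).card * (√(p:ℝ) * (1 + Real.log p)) := by
          rw [Finset.sum_const, nsmul_eq_mul]
      _ ≤ _ := by
          gcongr
          calc _ ≤ (Finset.univ : Finset (DirichletCharacter ℂ p)).card := Finset.card_filter_le _ _
            _ = n := by
              have := DirichletCharacter.card_eq_totient_of_hasEnoughRootsOfUnity ℂ p
              rw [Nat.totient_prime hp.out, Nat.card_eq_fintype_card] at this
              exact this
  set X := (((Finset.Icc 1 K).filter (fun k : ℕ => ((c * k : ℕ) : ZMod p)^M = 1)).card : ℕ) with hX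
  rw [← Finset.sum_filter_add_sum_filter_not Finset.univ (fun χ : DirichletCharacter ℂ p => χ^M = 1), h2] at h1
  have h4 : ((n * (X - K * M / n : ℝ) : ℝ) : ℂ) = ∑ χ ∈ Finset.univ.filter (fun χ : DirichletCharacter ℂ p => ¬ χ^M = 1), S χ := by
    push_cast
    rw [mul_sub, h1]
    field_simp
    ring
  rw [← h4, Complex.norm_real, Real.norm_eq_abs, abs_mul, abs_of_pos hn0] at h3
  exact le_of_mul_le_mul_left h3 hn0

lemma sum_mu (n : ℕ) (hn : n ≠ 0) : ∑ e ∈ n.divisors, (ArithmeticFunction.moebius e : ℝ) = if n = 1 then 1 else 0 := by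
  have h := congrArg (fun f : ArithmeticFunction ℝ => f n) (ArithmeticFunction.coe_zeta_mul_coe_moebius (R := ℝ))
  simp only [ArithmeticFunction.coe_zeta_mul_apply, ArithmeticFunction.one_apply] at h
  simpa using h

lemma cop_ind (k m : ℕ) (hm : m ≠ 0) :
    (if k.Coprime m then (1:ℝ) else 0) = ∑ e ∈ m.divisors, if e ∣ k then (ArithmeticFunction.moebius e : ℝ) else 0 := by
  have h := sum_mu (k.gcd m) (by intro h; exact hm (Nat.eq_zero_of_gcd_eq_zero_right h))
  rw [← Finset.sum_filter]
  have : m.divisors.filter (fun e => e ∣ k) = (k.gcd m).divisors := by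
    ext e
    simp only [Finset.mem_filter, Nat.mem_divisors, Nat.dvd_gcd_iff]
    constructor
    · rintro ⟨⟨h1, h2⟩, h3⟩; exact ⟨⟨h3, h1⟩, fun h => hm (Nat.eq_zero_of_gcd_eq_zero_right h)⟩
    · rintro ⟨⟨h1, h2⟩, h3⟩; exact ⟨⟨h2, hm⟩, h1⟩
  rw [this, h]

lemma ord_ind {G : Type*} [Monoid G] (u : G) (m : ℕ) (hm : m ≠ 0) [DecidableEq G] :
    (if orderOf u = m then (1:ℝ) else 0) = ∑ f ∈ m.divisors, if u^(m/f) = 1 then (ArithmeticFunction.moebius f : ℝ) else 0 := by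
  rw [← Finset.sum_filter]
  by_cases ho : orderOf u ∣ m
  · obtain ⟨t, ht⟩ := ho
    have ht0 : t ≠ 0 := by rintro rfl; simp at ht; exact hm ht
    have ho0 : orderOf u ≠ 0 := by intro h; rw [h] at ht; simp at ht; exact hm ht
    have : m.divisors.filter (fun f => u^(m/f) = 1) = t.divisors := by
      ext f
      simp only [Finset.mem_filter, Nat.mem_divisors]
      rw [← orderOf_dvd_iff_pow_eq_one]
      constructor
      · rintro ⟨⟨h1, -⟩, h3⟩
        refine ⟨?_, ht0⟩
        obtain ⟨s, hs⟩ := h1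
        have hf : 0 < f := by rcases Nat.eq_zero_or_pos f with h | h
                              · rw [h] at hs; simp at hs; exact absurd hs hm
                              · exact h
        rw [hs, Nat.mul_div_cancel_left _ hf] at h3
        obtain ⟨r, hr⟩ := h3
        refine ⟨r, ?_⟩
        have : orderOf u * t = orderOf u * (f * r) := by rw [← ht, hs, hr]; ring
        exact Nat.eq_of_mul_eq_mul_left (Nat.pos_of_ne_zero ho0) this
      · rintro ⟨⟨r, hr⟩, -⟩
        have hf : 0 < f := by rcases Nat.eq_zero_or_pos f with h | h
                              · rw [h] at hr; simp at hr; exact absurd hr ht0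
                              · exact h
        refine ⟨⟨⟨orderOf u * r, by rw [ht, hr]; ring⟩, hm⟩, ?_⟩
        rw [ht, hr, show orderOf u * (f * r) = f * (orderOf u * r) by ring, Nat.mul_div_cancel_left _ hf]
        exact dvd_mul_right _ _
    rw [this, sum_mu t ht0]
    congr 1
    rw [eq_iff_iff]
    constructor
    · intro h; rw [h] at ht
      have : m * t = m * 1 := by omega
      exact Nat.eq_of_mul_eq_mul_left (Nat.pos_of_ne_zero hm) this
    · intro h; rw [ht, h, mul_one]
  · rw [if_neg (by rintro h; exact ho (h ▸ dvd_rfl)), Finset.sum_eq_zero]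
    intro f hf
    simp only [Finset.mem_filter, Nat.mem_divisors] at hf
    rw [← orderOf_dvd_iff_pow_eq_one] at hf
    exact absurd (hf.2.trans (Nat.div_dvd_of_dvd hf.1.1)) ho

lemma tot_mu (m : ℕ) (hm : m ≠ 0) : (m.totient : ℝ) = ∑ e ∈ m.divisors, (ArithmeticFunction.moebius e : ℝ) * ((m / e : ℕ):ℝ) := by
  have h := (ArithmeticFunction.sum_eq_iff_sum_mul_moebius_eq (R := ℝ) (f := fun n => (n.totient:ℝ)) (g := fun n => (n:ℝ))).1 (by
    intro n _
    exact_mod_cast Nat.sum_totient n) m (Nat.pos_of_ne_zero hm)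
  rw [← h, Nat.sum_divisorsAntidiagonal (fun a b => (ArithmeticFunction.moebius a : ℝ) * (b:ℝ))]

end SW

namespace SW
open Complex Topology Set

lemma E_iff {p : ℕ} [hp : Fact p.Prime] (h : ℕ) (h1 : 1 ≤ h) (h2 : h ≤ p - 1) :
    (∃ g : ℕ, 1 ≤ g ∧ g ≤ p - 1 ∧ IsPrimitiveRoot (g : ZMod p) (p - 1) ∧ g ^ h ≡ h [MOD p]) ↔
      orderOf (h : ZMod p) = (p - 1) / h.gcd (p - 1) := by
  have hp1 := hp.out.one_lt
  set n := p - 1 with hn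
  have hn0 : 0 < n := by omega
  constructor
  · rintro ⟨g, -, -, hg, hgh⟩
    rw [← ZMod.natCast_eq_natCast_iff, Nat.cast_pow] at hgh
    rw [← hgh, orderOf_pow' _ (by omega), ← hg.eq_orderOf, Nat.gcd_comm]
  · intro ho
    set m := n / h.gcd n with hm
    have hd : h.gcd n ∣ n := Nat.gcd_dvd_right _ _
    have hm0 : m ≠ 0 := (Nat.div_pos (Nat.le_of_dvd hn0 hd) (Nat.gcd_pos_of_pos_right _ hn0)).ne'
    have hmn : m ∣ n := Nat.div_dvd_of_dvd hd
    obtain ⟨γ, hγ⟩ := IsCyclic.exists_ofOrder_eq_natCard (α := (ZMod p)ˣ)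
    rw [Nat.card_eq_fintype_card, ZMod.card_units, ← hn] at hγ
    have hγ2 : orderOf (γ : ZMod p) = n := by rw [orderOf_units, hγ]
    have hx : orderOf ((γ : ZMod p)^h) = m := by
      rw [orderOf_pow' _ (by omega), hγ2, Nat.gcd_comm]
    have px : IsPrimitiveRoot ((γ : ZMod p)^h) m := hx ▸ IsPrimitiveRoot.orderOf _
    have py : IsPrimitiveRoot (h : ZMod p) m := ho ▸ IsPrimitiveRoot.orderOf _
    have : NeZero m := ⟨hm0⟩
    obtain ⟨j, -, hjc, hj⟩ := px.isPrimitiveRoot_iff.1 py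
    have : NeZero n := ⟨hn0.ne'⟩
    obtain ⟨b, hb⟩ := ZMod.unitsMap_surjective hmn (ZMod.unitOfCoprime j hjc)
    set B := (b : ZMod n).val with hB
    have hBc : B.Coprime n := ZMod.val_coe_unit_coprime b
    have hBj : ((B:ℕ) : ZMod m) = j := by
      have := congrArg Units.val hb
      rw [ZMod.unitsMap_val, ZMod.coe_unitOfCoprime] at this
      rw [← this, hB, ZMod.natCast_val]
    have hg0 : (γ : ZMod p)^B ≠ 0 := pow_ne_zero _ γ.ne_zero
    refine ⟨((γ : ZMod p)^B).val, ?_, ?_, ?_, ?_⟩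
    · have : ((γ : ZMod p)^B).val ≠ 0 := by rwa [Ne, ZMod.val_eq_zero]
      omega
    · have := ZMod.val_lt ((γ : ZMod p)^B)
      omega
    · rw [ZMod.natCast_zmod_val]
      have pγ : IsPrimitiveRoot (γ : ZMod p) n := hγ2 ▸ IsPrimitiveRoot.orderOf _
      exact pγ.pow_of_coprime B hBc
    · rw [← ZMod.natCast_eq_natCast_iff, Nat.cast_pow, ZMod.natCast_zmod_val, ← pow_mul, mul_comm, pow_mul, ← hj]
      rw [← pow_mod_orderOf _ B, ← pow_mod_orderOf _ j, hx, (ZMod.natCast_eq_natCast_iff' _ _ _).1 hBj]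

noncomputable def Gp (p : ℕ) : ℕ := Nat.card {h : ℕ // 1 ≤ h ∧ h ≤ p - 1 ∧ ∃ g : ℕ, 1 ≤ g ∧ g ≤ p - 1 ∧
              IsPrimitiveRoot (g : ZMod p) (p - 1) ∧ g ^ h ≡ h [MOD p]}

lemma G_card {p : ℕ} [hp : Fact p.Prime] : Gp p = ((Finset.Icc 1 (p-1)).filter (fun h : ℕ => orderOf (h : ZMod p) = (p - 1) / h.gcd (p - 1))).card := by
  rw [Gp, ← Nat.card_eq_finsetCard]
  refine Nat.card_congr (Equiv.subtypeEquivRight fun h => ?_)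
  rw [Finset.mem_filter, Finset.mem_Icc]
  constructor
  · rintro ⟨h1, h2, h3⟩; exact ⟨⟨h1, h2⟩, (E_iff h h1 h2).1 h3⟩
  · rintro ⟨⟨h1, h2⟩, h3⟩; exact ⟨h1, h2, (E_iff h h1 h2).2 h3⟩

lemma G_sum {p : ℕ} [hp : Fact p.Prime] : (Gp p : ℝ) = ∑ d ∈ (p-1).divisors, ∑ k ∈ Finset.Icc 1 ((p-1)/d),
    (if k.Coprime ((p-1)/d) then (1:ℝ) else 0) * (if orderOf ((d*k:ℕ):ZMod p) = (p-1)/d then 1 else 0) := by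
  have hp1 := hp.out.one_lt
  rw [G_card]
  set n := p - 1 with hn
  have hn0 : 0 < n := by omega
  rw [Finset.card_eq_sum_card_fiberwise (f := fun h => h.gcd n) (t := n.divisors)]
  · rw [Nat.cast_sum]
    refine Finset.sum_congr rfl fun d hd => ?_
    obtain ⟨hdn, -⟩ := Nat.mem_divisors.1 hd
    have hd0 : 0 < d := Nat.pos_of_dvd_of_pos hdn hn0
    obtain ⟨m, hm⟩ := hdn
    have hm' : n / d = m := by rw [hm, Nat.mul_div_cancel_left _ hd0]
    have : ∀ k : ℕ, (if k.Coprime (n/d) then (1:ℝ) else 0) * (if orderOf ((d*k:ℕ):ZMod p) = n/d then 1 else 0)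
       = if k.Coprime (n/d) ∧ orderOf ((d*k:ℕ):ZMod p) = n/d then 1 else 0 := by
      intro k; split_ifs <;> simp_all
    simp_rw [this]
    rw [← Finset.sum_filter, Finset.sum_const, nsmul_eq_mul, mul_one]
    congr 1
    symm
    refine Finset.card_bij (fun k _ => d * k) ?_ ?_ ?_
    · intro k hk
      simp only [Finset.mem_filter, Finset.mem_Icc, hm'] at hk ⊢
      obtain ⟨⟨k1, k2⟩, k3, k4⟩ := hk
      have hg : (d * k).gcd n = d := by
        rw [hm, Nat.gcd_mul_left, k3, mul_one]
      refine ⟨⟨⟨Nat.mul_pos hd0 k1, ?_⟩, ?_⟩, hg⟩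
      · rw [hm]; exact Nat.mul_le_mul_left _ k2
      · rw [hg, hm', k4]
    · intro a _ b _ hab
      exact Nat.eq_of_mul_eq_mul_left hd0 hab
    · intro h hh
      simp only [Finset.mem_filter, Finset.mem_Icc] at hh
      obtain ⟨⟨⟨a1, a2⟩, a3⟩, a4⟩ := hh
      obtain ⟨k, hk⟩ : d ∣ h := a4 ▸ Nat.gcd_dvd_left _ _
      refine ⟨k, ?_, hk.symm⟩
      simp only [Finset.mem_filter, Finset.mem_Icc, hm']
      refine ⟨⟨?_, ?_⟩, ?_, ?_⟩
      · rcases Nat.eq_zero_or_pos k with h0 | h0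
        · rw [h0] at hk; omega
        · exact h0
      · rw [hk, hm] at a2; exact Nat.le_of_mul_le_mul_left a2 hd0
      · rw [hk, hm, Nat.gcd_mul_left] at a4
        exact Nat.eq_of_mul_eq_mul_left hd0 (a4.trans (mul_one d).symm)
      · rw [a4, hm', hk] at a3; exact a3
  · intro h _
    simp only [Finset.mem_coe, Nat.mem_divisors]
    exact ⟨Nat.gcd_dvd_right _ _, hn0.ne'⟩

lemma mu_abs (e : ℕ) : |(ArithmeticFunction.moebius e : ℝ)| ≤ 1 := by
  have := ArithmeticFunction.abs_moebius_le_one (n := e)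
  exact_mod_cast this

lemma inner_bd {p : ℕ} [hp : Fact p.Prime] (d m : ℕ) (hdm : p - 1 = d * m) :
    |∑ k ∈ Finset.Icc 1 m, (if k.Coprime m then (1:ℝ) else 0) * (if orderOf ((d*k:ℕ):ZMod p) = m then 1 else 0)
      - (m.totient:ℝ)^2/((p-1:ℕ):ℝ)| ≤ ((p-1).divisors.card:ℝ)^2 * (√(p:ℝ) * (1 + Real.log p)) := by
  have hp1 := hp.out.one_lt
  set n := p - 1 with hn
  have hn0 : 0 < n := by omega
  have hm : m ≠ 0 := by rintro rfl; simp at hdm; omega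
  have hd : d ≠ 0 := by rintro rfl; simp at hdm; omega
  have hmn : m ∣ n := ⟨d, by rw [hdm]; ring⟩
  set E := √(p:ℝ) * (1 + Real.log p) with hE
  have hl : 0 ≤ Real.log p := Real.log_natCast_nonneg p
  have hE0 : 0 ≤ E := by positivity
  set cnt : ℕ → ℕ → ℝ := fun e f => (((Finset.Icc 1 (m/e)).filter (fun k : ℕ => (((d*e) * k : ℕ) : ZMod p)^(m/f) = 1)).card : ℝ) with hcnt
  have key : ∀ e ∈ m.divisors, ∀ f ∈ m.divisors, |cnt e f - ((m/e:ℕ):ℝ) * ((m/f:ℕ):ℝ) / n| ≤ E := by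
    intro e he f hf
    obtain ⟨he1, -⟩ := Nat.mem_divisors.1 he
    obtain ⟨hf1, -⟩ := Nat.mem_divisors.1 hf
    refine count_pow (m/f) (d*e) (m/e) ((Nat.div_dvd_of_dvd hf1).trans hmn) ?_ ?_
    · rw [Ne, ZMod.natCast_eq_zero_iff]
      have : d * e ≤ n := by rw [hdm]; exact Nat.mul_le_mul_left _ (Nat.le_of_dvd (Nat.pos_of_ne_zero hm) he1)
      have h0 : 0 < d * e := Nat.mul_pos (Nat.pos_of_ne_zero hd) (Nat.pos_of_mem_divisors he)
      exact Nat.not_dvd_of_pos_of_lt h0 (by omega)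
    · exact (Nat.div_le_self _ _).trans (Nat.le_of_dvd hn0 hmn)
  have h1 : ∑ k ∈ Finset.Icc 1 m, (if k.Coprime m then (1:ℝ) else 0) * (if orderOf ((d*k:ℕ):ZMod p) = m then 1 else 0)
      = ∑ e ∈ m.divisors, ∑ f ∈ m.divisors, (ArithmeticFunction.moebius e : ℝ) * (ArithmeticFunction.moebius f : ℝ) * cnt e f := by
    have a1 : ∀ k : ℕ, (if k.Coprime m then (1:ℝ) else 0) * (if orderOf ((d*k:ℕ):ZMod p) = m then 1 else 0)
       = ∑ e ∈ m.divisors, ∑ f ∈ m.divisors, (ArithmeticFunction.moebius e : ℝ) * (ArithmeticFunction.moebius f : ℝ) * (if e ∣ k ∧ ((d*k:ℕ):ZMod p)^(m/f) = 1 then 1 else 0) := by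
      intro k
      rw [cop_ind k m hm, ord_ind _ m hm, Finset.sum_mul_sum]
      refine Finset.sum_congr rfl fun e _ => Finset.sum_congr rfl fun f _ => ?_
      split_ifs <;> simp_all
    simp_rw [a1]
    rw [Finset.sum_comm]
    refine Finset.sum_congr rfl fun e he => ?_
    rw [Finset.sum_comm]
    refine Finset.sum_congr rfl fun f hf => ?_
    rw [← Finset.mul_sum]
    congr 1
    rw [← Finset.sum_filter, Finset.sum_const, nsmul_eq_mul, mul_one, hcnt]
    congr 1
    symm
    have he0 := Nat.pos_of_mem_divisors he
    refine Finset.card_bij (fun k _ => e * k) ?_ ?_ ?_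
    · intro k hk
      simp only [Finset.mem_filter, Finset.mem_Icc] at hk ⊢
      refine ⟨⟨Nat.mul_pos he0 hk.1.1, ?_⟩, dvd_mul_right _ _, ?_⟩
      · rw [mul_comm]; exact (Nat.le_div_iff_mul_le he0).1 hk.1.2
      · rw [← mul_assoc]; exact hk.2
    · intro a _ b _ hab
      exact Nat.eq_of_mul_eq_mul_left he0 hab
    · intro h hh
      simp only [Finset.mem_filter, Finset.mem_Icc] at hh
      obtain ⟨⟨b1, b2⟩, ⟨k, hk⟩, b4⟩ := hh
      refine ⟨k, ?_, hk.symm⟩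
      simp only [Finset.mem_filter, Finset.mem_Icc]
      refine ⟨⟨?_, ?_⟩, ?_⟩
      · rcases Nat.eq_zero_or_pos k with h0 | h0
        · rw [h0] at hk; omega
        · exact h0
      · rw [Nat.le_div_iff_mul_le he0, mul_comm, ← hk]; exact b2
      · rw [mul_assoc, ← hk]; exact b4
  have h2 : (m.totient:ℝ)^2/(n:ℝ) = ∑ e ∈ m.divisors, ∑ f ∈ m.divisors, (ArithmeticFunction.moebius e : ℝ) * (ArithmeticFunction.moebius f : ℝ) * (((m/e:ℕ):ℝ) * ((m/f:ℕ):ℝ) / n) := by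
    rw [sq, tot_mu m hm, Finset.sum_mul_sum, Finset.sum_div]
    refine Finset.sum_congr rfl fun e _ => ?_
    rw [Finset.sum_div]
    refine Finset.sum_congr rfl fun f _ => ?_
    ring
  rw [h1, h2, ← Finset.sum_sub_distrib]
  refine (Finset.abs_sum_le_sum_abs _ _).trans ?_
  have hc : (m.divisors.card:ℝ) ≤ n.divisors.card := by
    exact_mod_cast Finset.card_le_card (Nat.divisors_subset_of_dvd hn0.ne' hmn)
  calc _ ≤ ∑ e ∈ m.divisors, ∑ f ∈ m.divisors, E := by
        refine Finset.sum_le_sum fun e he => ?_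
        rw [← Finset.sum_sub_distrib]
        refine (Finset.abs_sum_le_sum_abs _ _).trans (Finset.sum_le_sum fun f hf => ?_)
        rw [← mul_sub, abs_mul, abs_mul]
        have a1 := key e he f hf
        have a2 : |(ArithmeticFunction.moebius e : ℝ)| * |(ArithmeticFunction.moebius f : ℝ)| ≤ 1 :=
          mul_le_one₀ (mu_abs e) (abs_nonneg _) (mu_abs f)
        calc _ ≤ 1 * E := mul_le_mul a2 a1 (abs_nonneg _) zero_le_one
          _ = E := one_mul _
    _ = (m.divisors.card:ℝ)^2 * E := by simp only [Finset.sum_const, nsmul_eq_mul]; ring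
    _ ≤ _ := by gcongr

/-- the main estimate for a single prime -/
lemma G_bd {p : ℕ} [hp : Fact p.Prime] :
    |(Gp p : ℝ) - ∑ d ∈ (p-1).divisors, (((p-1)/d).totient:ℝ)^2/((p-1:ℕ):ℝ)| ≤ ((p-1).divisors.card:ℝ)^3 * (√(p:ℝ) * (1 + Real.log p)) := by
  rw [G_sum, ← Finset.sum_sub_distrib]
  refine (Finset.abs_sum_le_sum_abs _ _).trans ?_
  calc _ ≤ ∑ d ∈ (p-1).divisors, ((p-1).divisors.card:ℝ)^2 * (√(p:ℝ) * (1 + Real.log p)) := by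
        refine Finset.sum_le_sum fun d hd => ?_
        exact inner_bd d ((p-1)/d) (Nat.mul_div_cancel' (Nat.dvd_of_mem_divisors hd)).symm
    _ = _ := by rw [Finset.sum_const, nsmul_eq_mul]; ring

end SW

namespace SW
open Complex Topology Set

noncomputable def phi2 : ArithmeticFunction ℝ := ⟨fun n => (n.totient:ℝ)^2, by simp⟩
noncomputable def inv2 : ArithmeticFunction ℝ := ⟨fun n => 1/(n:ℝ)^2, by simp⟩
noncomputable def invphi : ArithmeticFunction ℝ := ⟨fun n => 1/(n.totient:ℝ), by simp⟩
noncomputable def zR : ArithmeticFunction ℝ := ((ArithmeticFunction.zeta : ArithmeticFunction ℕ) : ArithmeticFunction ℝ)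
noncomputable def mR : ArithmeticFunction ℝ := ((ArithmeticFunction.moebius : ArithmeticFunction ℤ) : ArithmeticFunction ℝ)
noncomputable def FF : ArithmeticFunction ℝ := (zR * phi2).pmul inv2
noncomputable def aa : ArithmeticFunction ℝ := mR * FF
noncomputable def bb : ArithmeticFunction ℝ := aa.pmul invphi

lemma phi2_mult : phi2.IsMultiplicative :=
  ⟨by simp [phi2], fun {m n} h => by simp only [phi2, ArithmeticFunction.coe_mk, Nat.totient_mul h]; push_cast; ring⟩
lemma inv2_mult : inv2.IsMultiplicative :=
  ⟨by simp [inv2], fun {m n} h => by simp only [inv2, ArithmeticFunction.coe_mk]; push_cast; ring⟩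
lemma invphi_mult : invphi.IsMultiplicative :=
  ⟨by simp [invphi], fun {m n} h => by simp only [invphi, ArithmeticFunction.coe_mk, Nat.totient_mul h]; push_cast; ring⟩
lemma FF_mult : FF.IsMultiplicative :=
  (ArithmeticFunction.isMultiplicative_zeta.natCast.mul phi2_mult).pmul inv2_mult
lemma aa_mult : aa.IsMultiplicative := ArithmeticFunction.isMultiplicative_moebius.intCast.mul FF_mult
lemma bb_mult : bb.IsMultiplicative := aa_mult.pmul invphi_mult

lemma FF_eq : FF = zR * aa := by
  rw [aa, ← mul_assoc, zR, mR, ArithmeticFunction.coe_zeta_mul_coe_moebius, one_mul]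

lemma FF_sum (n : ℕ) : FF n = ∑ d ∈ n.divisors, aa d := by
  rw [FF_eq, zR, ArithmeticFunction.coe_zeta_mul_apply]

lemma FF_val (n : ℕ) : FF n = (∑ d ∈ n.divisors, (d.totient:ℝ)^2) / (n:ℝ)^2 := by
  rw [FF, ArithmeticFunction.pmul_apply, zR, ArithmeticFunction.coe_zeta_mul_apply]
  simp only [phi2, inv2, ArithmeticFunction.coe_mk]
  ring

lemma S_pow (q k : ℕ) (hq : q.Prime) : ∑ d ∈ (q^k).divisors, (d.totient:ℝ)^2 = ((q:ℝ)-1)/(q+1) * (q:ℝ)^(2*k) + 2/(q+1) := by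
  have hq0 : (0:ℝ) < q + 1 := by positivity
  rw [Nat.sum_divisors_prime_pow hq]
  induction k with
  | zero => simp; field_simp; ring
  | succ k ih =>
    rw [Finset.sum_range_succ, ih, Nat.totient_prime_pow_succ hq, Nat.cast_mul, Nat.cast_sub hq.one_le]
    push_cast
    field_simp
    ring

lemma FF_pow (q k : ℕ) (hq : q.Prime) : FF (q^k) = ((q:ℝ)-1)/(q+1) + 2/(q+1) / (q:ℝ)^(2*k) := by
  have hq0 : (0:ℝ) < q := by exact_mod_cast hq.pos
  rw [FF_val, S_pow q k hq]
  push_cast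
  field_simp
  ring

lemma aa_pow (q k : ℕ) (hq : q.Prime) : aa (q^(k+1)) = -2*((q:ℝ)-1)/(q:ℝ)^(2*(k+1)) := by
  have hq0 : (0:ℝ) < q := by exact_mod_cast hq.pos
  have h1 := FF_sum (q^(k+1))
  have h2 := FF_sum (q^k)
  rw [Nat.sum_divisors_prime_pow hq, FF_pow q _ hq] at h1 h2
  rw [Finset.sum_range_succ, ← h2] at h1
  have : aa (q^(k+1)) = 2/((q:ℝ)+1) / (q:ℝ)^(2*(k+1)) - 2/(q+1) / (q:ℝ)^(2*k) := by linarith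
  rw [this]
  field_simp
  ring

lemma bb_pow (q k : ℕ) (hq : q.Prime) : bb (q^(k+1)) = -2 * (q:ℝ) * (1/(q:ℝ)^3)^(k+1) := by
  have hq0 : (1:ℝ) < q := by exact_mod_cast hq.one_lt
  have h1 : (q:ℝ) - 1 ≠ 0 := by linarith
  have h0 : (q:ℝ) ≠ 0 := by linarith
  rw [bb, ArithmeticFunction.pmul_apply, aa_pow q k hq]
  simp only [invphi, ArithmeticFunction.coe_mk, Nat.totient_prime_pow_succ hq]
  rw [Nat.cast_mul, Nat.cast_sub hq.one_le]
  push_cast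
  rw [one_div_pow, ← pow_mul]
  field_simp
  ring

lemma mult_bd (f : ArithmeticFunction ℝ) (hf : f.IsMultiplicative) (r : ℕ)
    (h : ∀ q k : ℕ, q.Prime → |f (q^(k+1))| ≤ ((k+1+1:ℕ):ℝ) / ((q:ℝ)^(k+1))^r) (n : ℕ) (hn : n ≠ 0) :
    |f n| ≤ (n.divisors.card : ℝ) / (n:ℝ)^r := by
  rw [hf.multiplicative_factorization f hn, Nat.prod_factorization_eq_prod_primeFactors, Finset.abs_prod, Nat.card_divisors hn, Nat.cast_prod]
  have h5 : (n:ℝ) = ∏ p ∈ n.primeFactors, (p:ℝ)^(n.factorization p) := by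
    have := Nat.prod_factorization_pow_eq_self hn
    rw [Nat.prod_factorization_eq_prod_primeFactors] at this
    conv_lhs => rw [← this]
    push_cast; rfl
  conv_rhs => rw [h5]
  rw [← Finset.prod_pow, ← Finset.prod_div_distrib]
  refine Finset.prod_le_prod (fun _ _ => abs_nonneg _) fun q hq => ?_
  have hk : n.factorization q ≠ 0 := by
    rw [← Finsupp.mem_support_iff, Nat.support_factorization]; exact hq
  obtain ⟨k, hk⟩ := Nat.exists_eq_succ_of_ne_zero hk
  rw [hk]
  exact h q k (Nat.prime_of_mem_primeFactors hq)

lemma aa_bd (n : ℕ) (hn : n ≠ 0) : |aa n| ≤ (n.divisors.card : ℝ) / (n:ℝ)^1 := by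
  refine mult_bd aa aa_mult 1 (fun q k hq => ?_) n hn
  have hq2 : (2:ℝ) ≤ q := by exact_mod_cast hq.two_le
  have hq0 : (0:ℝ) < q := by linarith
  rw [aa_pow q k hq, abs_div, abs_of_pos (by positivity : 0 < (q:ℝ)^(2*(k+1))), show -2*((q:ℝ)-1) = -(2*(q-1)) by ring, abs_neg,
    abs_of_nonneg (by linarith), pow_one, div_le_div_iff₀ (by positivity) (by positivity), two_mul (k+1), pow_add _ (k+1) (k+1), ← mul_assoc]
  refine mul_le_mul_of_nonneg_right ?_ (by positivity)
  have h1 : (q:ℝ) ≤ (q:ℝ)^(k+1) := by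
    calc (q:ℝ) = q^1 := (pow_one _).symm
      _ ≤ _ := pow_le_pow_right₀ (by linarith) (by omega)
  have h2 : (2:ℝ) ≤ ((k+1+1:ℕ):ℝ) := by push_cast; have := Nat.cast_nonneg (α := ℝ) k; linarith
  nlinarith

lemma bb_bd (n : ℕ) (hn : n ≠ 0) : |bb n| ≤ (n.divisors.card : ℝ) / (n:ℝ)^2 := by
  refine mult_bd bb bb_mult 2 (fun q k hq => ?_) n hn
  have hq2 : (2:ℝ) ≤ q := by exact_mod_cast hq.two_le
  have hq0 : (0:ℝ) < q := by linarith
  have h1 : (q:ℝ) ≤ (q:ℝ)^(k+1) := by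
    calc (q:ℝ) = q^1 := (pow_one _).symm
      _ ≤ _ := pow_le_pow_right₀ (by linarith) (by omega)
  have h2 : (2:ℝ) ≤ ((k+1+1:ℕ):ℝ) := by push_cast; have := Nat.cast_nonneg (α := ℝ) k; linarith
  have e : (1/(q:ℝ)^3)^(k+1) = 1 / (((q:ℝ)^(k+1))^2 * (q:ℝ)^(k+1)) := by
    rw [one_div_pow]; congr 1; ring
  rw [bb_pow q k hq, e, abs_mul, abs_of_pos (by positivity : 0 < 1 / (((q:ℝ)^(k+1))^2 * (q:ℝ)^(k+1))), show -2*(q:ℝ) = -(2*q) by ring, abs_neg,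
    abs_of_nonneg (by linarith), mul_one_div, div_le_div_iff₀ (by positivity) (by positivity)]
  have : 0 < ((q:ℝ)^(k+1))^2 := by positivity
  have h3 : 2 * (q:ℝ) ≤ ((k+1+1:ℕ):ℝ) * (q:ℝ)^(k+1) := by nlinarith
  nlinarith

lemma ab_bd : ∃ C : ℝ, 1 ≤ C ∧ (∀ n : ℕ, n ≠ 0 → |aa n| ≤ C * (n:ℝ)^(-(3/4):ℝ)) ∧ ∀ n : ℕ, n ≠ 0 → |bb n| ≤ C * (n:ℝ)^(-(7/4):ℝ) := by
  obtain ⟨C, hC, h⟩ := divisor_bound (1/4) (by norm_num)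
  refine ⟨C, hC, fun n hn => ?_, fun n hn => ?_⟩
  · have h0 : (0:ℝ) < n := by exact_mod_cast Nat.pos_of_ne_zero hn
    refine (aa_bd n hn).trans ?_
    calc _ ≤ C * (n:ℝ)^(1/4:ℝ) / (n:ℝ)^1 := by gcongr; exact h n hn
      _ = C * ((n:ℝ)^(1/4:ℝ) / (n:ℝ)^((1:ℕ):ℝ)) := by rw [Real.rpow_natCast]; ring
      _ = _ := by rw [← Real.rpow_sub h0]; norm_num
  · have h0 : (0:ℝ) < n := by exact_mod_cast Nat.pos_of_ne_zero hn
    refine (bb_bd n hn).trans ?_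
    calc _ ≤ C * (n:ℝ)^(1/4:ℝ) / (n:ℝ)^2 := by gcongr; exact h n hn
      _ = C * ((n:ℝ)^(1/4:ℝ) / (n:ℝ)^((2:ℕ):ℝ)) := by rw [Real.rpow_natCast]; ring
      _ = _ := by rw [← Real.rpow_sub h0]; norm_num

lemma bb_summable : Summable (fun n : ℕ => ‖bb n‖) := by
  obtain ⟨C, hC, -, h⟩ := ab_bd
  refine Summable.of_nonneg_of_le (fun n => norm_nonneg _) (fun n => ?_) ((Real.summable_nat_rpow.2 (by norm_num : (-(7/4):ℝ) < -1)).mul_left C)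
  rcases eq_or_ne n 0 with rfl | hn
  · simp
  · exact h n hn

noncomputable def BB : ℝ := ∏' q : Nat.Primes, (1 - 2 * ((q : ℕ) : ℝ) / (((q : ℕ) : ℝ) ^ 3 - 1))

lemma BB_eq : BB = ∑' n, bb n := by
  have h := EulerProduct.eulerProduct_hasProd (f := fun n => bb n) bb_mult.1 (fun {m n} h => bb_mult.2 h) bb_summable (by simp)
  rw [← h.tprod_eq, BB]
  congr 1
  ext q
  have hq := q.2
  have hq2 : (2:ℝ) ≤ (q:ℕ) := by exact_mod_cast hq.two_le
  have hlt : 1/((q:ℕ):ℝ)^3 < 1 := by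
    rw [div_lt_one (by positivity)]
    nlinarith [sq_nonneg (((q:ℕ):ℝ))]
  have hg := hasSum_geometric_of_lt_one (r := 1/((q:ℕ):ℝ)^3) (by positivity) hlt
  have hg2 := (hg.mul_left (-2 * ((q:ℕ):ℝ) * (1/((q:ℕ):ℝ)^3)))
  have hs : HasSum (fun e : ℕ => bb ((q:ℕ)^(e+1))) (-2 * ((q:ℕ):ℝ) * (1/((q:ℕ):ℝ)^3) * (1 - 1/((q:ℕ):ℝ)^3)⁻¹) := by
    refine hg2.congr_fun ?_
    intro e
    rw [bb_pow _ _ hq, pow_succ]; ring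
  have hs2 := (hasSum_nat_add_iff (f := fun e : ℕ => bb ((q:ℕ)^e)) 1).1 hs
  rw [hs2.tsum_eq]
  simp only [Finset.sum_range_one, pow_zero, bb_mult.1]
  have h3 : ((q:ℕ):ℝ)^3 - 1 ≠ 0 := by
    have : (1:ℝ) < ((q:ℕ):ℝ)^3 := by nlinarith [sq_nonneg (((q:ℕ):ℝ))]
    linarith
  have h4 : (1 - 1/((q:ℕ):ℝ)^3) = (((q:ℕ):ℝ)^3 - 1)/((q:ℕ):ℝ)^3 := by field_simp
  rw [h4]
  field_simp
  ring

end SW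

namespace SW
open Complex Topology Set

lemma Li_abs {x : ℝ} {y : ℝ} (hx : 2 ≤ x) (hxy : x ≤ y) : |∫ t in x..y, 1/Real.log t| ≤ 2 * (y - x) := by
  have h := intervalIntegral.norm_integral_le_of_norm_le_const (a := x) (b := y) (C := 2) (f := fun t : ℝ => 1/Real.log t) (by
    intro t ht
    rw [uIoc_of_le hxy] at ht
    have h1 : Real.log 2 ≤ Real.log t := Real.log_le_log (by norm_num) (by linarith [ht.1])
    have h2 := Real.log_two_gt_d9
    rw [Real.norm_of_nonneg (by have : 0 ≤ Real.log t := by linarith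
                                positivity), div_le_iff₀ (by linarith)]
    linarith)
  rw [Real.norm_eq_abs, abs_of_nonneg (by linarith : 0 ≤ y - x)] at h
  exact h

lemma Li_le (N : ℕ) (hN : 2 ≤ N) : |Li N| ≤ 2 * N := by
  have hN' : (2:ℝ) ≤ N := by exact_mod_cast hN
  have := Li_abs (x := 2) (y := N) le_rfl hN'
  rw [Li]; linarith

lemma piAP_le (n N : ℕ) (hn : n ≠ 0) : (piAP n N : ℝ) ≤ N / n := by
  have h : piAP n N ≤ N / n := by
    rw [piAP]
    calc _ ≤ (Finset.Icc 1 (N/n)).card := by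
          refine Finset.card_le_card_of_injOn (fun p => (p-1)/n) ?_ ?_
          · intro p hp
            simp only [Finset.coe_filter, Finset.mem_Icc, Set.mem_ofPred_eq] at hp
            simp only [Finset.coe_Icc, Set.mem_Icc]
            refine ⟨?_, Nat.div_le_div_right (by omega)⟩
            exact Nat.div_pos (Nat.le_of_dvd (by omega) hp.2.2) (Nat.pos_of_ne_zero hn)
          · intro p hp p' hp' h
            simp only [Finset.coe_filter, Finset.mem_Icc, Set.mem_ofPred_eq] at hp hp'
            have e1 := Nat.div_mul_cancel hp.2.2
            have e2 := Nat.div_mul_cancel hp'.2.2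
            simp only at h
            rw [h] at e1
            omega
      _ = N / n := by simp
  calc (piAP n N : ℝ) ≤ ((N/n : ℕ) : ℝ) := by exact_mod_cast h
    _ ≤ N / n := Nat.cast_div_le

lemma piAP_zero (n N : ℕ) (h : N < n) : piAP n N = 0 := by
  have := piAP_le n N (by omega)
  have hn : (0:ℝ) < n := by exact_mod_cast (by omega : 0 < n)
  have h2 : (N:ℝ)/n < 1 := by rw [div_lt_one hn]; exact_mod_cast h
  have : (piAP n N : ℝ) < 1 := by linarith
  have : piAP n N < 1 := by exact_mod_cast this
  omega

lemma FF_total (N : ℕ) : ∑ p ∈ Finset.filter Nat.Prime (Finset.Icc 2 N), FF (p-1) = ∑ n ∈ Finset.Icc 1 N, aa n * piAP n N := by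
  have h1 : ∀ p ∈ Finset.filter Nat.Prime (Finset.Icc 2 N), FF (p-1) = ∑ n ∈ Finset.Icc 1 N, if n ∣ p - 1 then aa n else 0 := by
    intro p hp
    rw [Finset.mem_filter, Finset.mem_Icc] at hp
    rw [FF_sum, ← Finset.sum_filter]
    refine Finset.sum_congr ?_ fun _ _ => rfl
    ext n
    rw [Nat.mem_divisors, Finset.mem_filter, Finset.mem_Icc]
    constructor
    · rintro ⟨a, b⟩
      have := Nat.le_of_dvd (by omega) a
      have := Nat.pos_of_dvd_of_pos a (by omega)
      exact ⟨by omega, a⟩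
    · rintro ⟨a, b⟩; exact ⟨b, by omega⟩
  rw [Finset.sum_congr rfl h1, Finset.sum_comm]
  refine Finset.sum_congr rfl fun n _ => ?_
  rw [← Finset.sum_filter, Finset.sum_const, nsmul_eq_mul, mul_comm, piAP, Finset.filter_filter]

lemma sum_FF (J : ℕ) (hJ : 1 ≤ J) : ∃ K : ℝ, 0 < K ∧ ∀ N : ℕ, 3 ≤ N →
    |∑ p ∈ Finset.filter Nat.Prime (Finset.Icc 2 N), FF (p-1) - BB * Li N| ≤ K * rj J N := by
  obtain ⟨K, hK, hpi⟩ := pi_ap (4*J) (by omega)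
  obtain ⟨C, hC, ha, hb⟩ := ab_bd
  have hZ := (Real.summable_nat_rpow.2 (by norm_num : (-(5/4):ℝ) < -1))
  set Z := ∑' n : ℕ, (n:ℝ)^(-(5/4):ℝ) with hZd
  have hZ0 : 0 ≤ Z := tsum_nonneg fun n => by positivity
  refine ⟨(Z+1) * (C * K + 3 * C), by positivity, fun N hN => ?_⟩
  have hL := log3 hN
  set L := Real.log N with hLd
  have hL0 : 0 < L := by linarith
  have hN0 : (0:ℝ) < N := by exact_mod_cast (by omega : 0 < N)
  have hLi := Li_le N (by omega)
  set w : ℕ → ℝ := fun n => aa n * piAP n N - bb n * Li N with hw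
  have hs1 : HasSum (fun n : ℕ => aa n * piAP n N) (∑ p ∈ Finset.filter Nat.Prime (Finset.Icc 2 N), FF (p-1)) := by
    rw [FF_total]
    refine hasSum_sum_of_ne_finset_zero fun n hn => ?_
    rw [Finset.mem_Icc] at hn
    rcases Nat.eq_zero_or_pos n with rfl | h
    · simp
    · rw [piAP_zero n N (by omega)]; simp
  have hs2 : HasSum (fun n : ℕ => bb n * Li N) (BB * Li N) := by
    rw [BB_eq]
    exact (bb_summable.of_norm.hasSum).mul_right _
  have hs := hs1.sub hs2
  have hrj : rj J N = N / L^J := rfl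
  have hbd : ∀ n : ℕ, ‖w n‖ ≤ ((C * K + 3 * C) * rj J N) * (n:ℝ)^(-(5/4):ℝ) := by
    intro n
    rcases eq_or_ne n 0 with rfl | hn
    · simp [hw]
    have hn0 : (0:ℝ) < n := by exact_mod_cast Nat.pos_of_ne_zero hn
    have hn1 : (1:ℝ) ≤ n := by exact_mod_cast Nat.pos_of_ne_zero hn
    have han := ha n hn
    have hbn := hb n hn
    have hp54 : 0 < (n:ℝ)^(-(5/4):ℝ) := by positivity
    have hrj0 : 0 ≤ rj J N := by rw [hrj]; positivity
    rcases le_total (n:ℝ) (L^(2*J)) with hY | hY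
    · have e1 : w n = aa n * (piAP n N - Li N / n.totient) := by
        have e0 : bb n = aa n * (1/(n.totient:ℝ)) := by
          first
          | rfl
          | simp [bb, invphi]
        simp only [hw]
        rw [e0]; ring
      rw [e1, norm_mul, Real.norm_eq_abs, Real.norm_eq_abs]
      have hpn := hpi n (Nat.pos_of_ne_zero hn) N hN
      have e2 : rj (4*J) N = rj J N / L^(3*J) := by
        rw [hrj, rj, ← hLd, show 4*J = J + 3*J by ring, pow_add, div_div]
      have e3 : (n:ℝ)^(-(3/4):ℝ) * n = (n:ℝ)^(3/2:ℝ) * (n:ℝ)^(-(5/4):ℝ) := by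
        rw [← Real.rpow_add_one hn0.ne', ← Real.rpow_add hn0]; norm_num
      have e4 : (n:ℝ)^(3/2:ℝ) ≤ L^(3*J) := by
        calc (n:ℝ)^(3/2:ℝ) ≤ (L^(2*J))^(3/2:ℝ) := by gcongr
          _ = L^(3*J) := by
            rw [← Real.rpow_natCast_mul hL0.le, ← Real.rpow_natCast]; congr 1; push_cast; ring
      calc |aa n| * |(piAP n N:ℝ) - Li N / n.totient| ≤ (C * (n:ℝ)^(-(3/4):ℝ)) * (K * n * rj (4*J) N) := by gcongr
        _ = C * K * ((n:ℝ)^(-(3/4):ℝ) * n) * (rj J N / L^(3*J)) := by rw [e2]; ring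
        _ = C * K * rj J N * ((n:ℝ)^(3/2:ℝ) / L^(3*J)) * (n:ℝ)^(-(5/4):ℝ) := by rw [e3]; ring
        _ ≤ C * K * rj J N * 1 * (n:ℝ)^(-(5/4):ℝ) := by
          gcongr
          rw [div_le_one (by positivity)]; exact e4
        _ ≤ _ := by
          have : 0 ≤ 3 * C * rj J N * (n:ℝ)^(-(5/4):ℝ) := by positivity
          nlinarith
    · have hpn := piAP_le n N hn
      have hp0 : (0:ℝ) ≤ piAP n N := Nat.cast_nonneg _
      have e1 : (n:ℝ)^(-(3/4):ℝ) * (N/n) = N * (n:ℝ)^(-(7/4):ℝ) := by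
        rw [show (-(7/4):ℝ) = -(3/4) - 1 by norm_num, Real.rpow_sub_one hn0.ne']; ring
      have e2 : (n:ℝ)^(-(7/4):ℝ) = (n:ℝ)^(-(1/2):ℝ) * (n:ℝ)^(-(5/4):ℝ) := by
        rw [← Real.rpow_add hn0]; norm_num
      have e3 : (n:ℝ)^(-(1/2):ℝ) ≤ 1 / L^J := by
        calc (n:ℝ)^(-(1/2):ℝ) ≤ (L^(2*J))^(-(1/2):ℝ) := Real.rpow_le_rpow_of_nonpos (by positivity) hY (by norm_num)
          _ = 1 / L^J := by
            have h0 : ((2*J:ℕ):ℝ) * (-(1/2)) + (J:ℝ) = 0 := by push_cast; ring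
            rw [← Real.rpow_natCast_mul hL0.le, ← Real.rpow_natCast L J, eq_div_iff (by positivity), ← Real.rpow_add hL0, h0, Real.rpow_zero]
      calc ‖w n‖ ≤ |aa n| * piAP n N + |bb n| * |Li N| := by
            rw [Real.norm_eq_abs]
            refine (abs_sub _ _).trans ?_
            rw [abs_mul, abs_mul, abs_of_nonneg hp0]
        _ ≤ (C * (n:ℝ)^(-(3/4):ℝ)) * (N/n) + (C * (n:ℝ)^(-(7/4):ℝ)) * (2 * N) := by gcongr
        _ = C * ((n:ℝ)^(-(3/4):ℝ) * (N/n)) + (C * (n:ℝ)^(-(7/4):ℝ)) * (2 * N) := by ring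
        _ = 3 * C * N * (n:ℝ)^(-(1/2):ℝ) * (n:ℝ)^(-(5/4):ℝ) := by rw [e1, e2]; ring
        _ ≤ 3 * C * N * (1 / L^J) * (n:ℝ)^(-(5/4):ℝ) := by gcongr
        _ = 3 * C * rj J N * (n:ℝ)^(-(5/4):ℝ) := by rw [hrj]; ring
        _ ≤ _ := by
          have : 0 ≤ C * K * rj J N * (n:ℝ)^(-(5/4):ℝ) := by positivity
          nlinarith
  have hfin := tsum_of_norm_bounded (hZ.hasSum.mul_left ((C * K + 3 * C) * rj J N)) hbd
  rw [hs.tsum_eq, Real.norm_eq_abs] at hfin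
  refine hfin.trans ?_
  have hrj0 : 0 ≤ rj J N := by rw [hrj]; positivity
  have : 0 ≤ (C * K + 3 * C) * rj J N := by positivity
  nlinarith

lemma G_term : ∃ A : ℝ, 0 < A ∧ ∀ p : ℕ, p.Prime → |(Gp p : ℝ)/((p-1:ℕ):ℝ) - FF (p-1)| ≤ A * (p:ℝ)^(-(1/4):ℝ) := by
  obtain ⟨C, hC, hd⟩ := divisor_bound (1/24) (by norm_num)
  refine ⟨18 * C^3, by positivity, fun p hp => ?_⟩
  haveI : Fact p.Prime := ⟨hp⟩
  have hp2 : (2:ℝ) ≤ p := by exact_mod_cast hp.two_le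
  have hp0 : (0:ℝ) < p := by linarith
  have hn : ((p-1:ℕ):ℝ) = p - 1 := by rw [Nat.cast_sub hp.one_le]; simp
  have hn0 : (0:ℝ) < ((p-1:ℕ):ℝ) := by rw [hn]; linarith
  have hG := G_bd (p := p)
  have hF : ∑ d ∈ (p-1).divisors, (((p-1)/d).totient:ℝ)^2/((p-1:ℕ):ℝ) = ((p-1:ℕ):ℝ) * FF (p-1) := by
    rw [FF_val, ← Finset.sum_div, Nat.sum_div_divisors (p-1) (fun d => (d.totient:ℝ)^2)]
    field_simp
  rw [hF] at hG
  have e1 : (Gp p : ℝ)/((p-1:ℕ):ℝ) - FF (p-1) = ((Gp p : ℝ) - ((p-1:ℕ):ℝ) * FF (p-1)) / ((p-1:ℕ):ℝ) := by field_simp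
  rw [e1, abs_div, abs_of_pos hn0, div_le_iff₀ hn0]
  refine hG.trans ?_
  have h1 : ((p-1).divisors.card:ℝ) ≤ C * (p:ℝ)^(1/24:ℝ) := by
    refine (hd (p-1) (by have := hp.two_le; omega)).trans ?_
    gcongr
    omega
  have h2 : 1 + Real.log p ≤ 9 * (p:ℝ)^(1/8:ℝ) := by
    have a := Real.log_le_rpow_div hp0.le (by norm_num : (0:ℝ) < 1/8)
    have b : 1 ≤ (p:ℝ)^(1/8:ℝ) := Real.one_le_rpow (by linarith) (by norm_num)
    have c : (p:ℝ)^(1/8:ℝ) / (1/8) = 8 * (p:ℝ)^(1/8:ℝ) := by ring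
    linarith
  have hl : 0 ≤ Real.log p := Real.log_natCast_nonneg p
  have e2 : ((p:ℝ)^(1/24:ℝ))^3 * ((p:ℝ)^(1/2:ℝ) * (p:ℝ)^(1/8:ℝ)) = (p:ℝ)^(-(1/4):ℝ) * p := by
    rw [← Real.rpow_mul_natCast hp0.le, ← Real.rpow_add_one hp0.ne', ← Real.rpow_add hp0, ← Real.rpow_add hp0]
    norm_num
  calc _ ≤ (C * (p:ℝ)^(1/24:ℝ))^3 * ((p:ℝ)^(1/2:ℝ) * (9 * (p:ℝ)^(1/8:ℝ))) := by
        rw [← Real.sqrt_eq_rpow]; gcongr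
    _ = 9 * C^3 * (((p:ℝ)^(1/24:ℝ))^3 * ((p:ℝ)^(1/2:ℝ) * (p:ℝ)^(1/8:ℝ))) := by ring
    _ = 9 * C^3 * (p:ℝ)^(-(1/4):ℝ) * p := by rw [e2]; ring
    _ ≤ 9 * C^3 * (p:ℝ)^(-(1/4):ℝ) * (2 * ((p-1:ℕ):ℝ)) := by
        gcongr; rw [hn]; linarith
    _ = _ := by ring

lemma sum_err (J : ℕ) : ∃ K : ℝ, 0 < K ∧ ∀ N : ℕ, 3 ≤ N →
    ∑ p ∈ Finset.filter Nat.Prime (Finset.Icc 2 N), |(Gp p : ℝ)/((p-1:ℕ):ℝ) - FF (p-1)| ≤ K * rj J N := by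
  obtain ⟨A, hA, h⟩ := G_term
  refine ⟨A * 2 * (2^(J+1) * (2*(J+1:ℕ))^(J+1)), by positivity, fun N hN => ?_⟩
  have hL := log3 hN
  have hN3 : (3:ℝ) ≤ N := by exact_mod_cast hN
  have hN0 : (0:ℝ) < N := by linarith
  set L := Real.log N with hLd
  have hL0 : 0 < L := by linarith
  have h1 : ∑ p ∈ Finset.filter Nat.Prime (Finset.Icc 2 N), |(Gp p : ℝ)/((p-1:ℕ):ℝ) - FF (p-1)| ≤ A * (N:ℝ)^(3/4:ℝ) * (1 + L) := by
    calc _ ≤ ∑ p ∈ Finset.filter Nat.Prime (Finset.Icc 2 N), A * (N:ℝ)^(3/4:ℝ) * (p:ℝ)⁻¹ := by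
          refine Finset.sum_le_sum fun p hp => ?_
          rw [Finset.mem_filter, Finset.mem_Icc] at hp
          refine (h p hp.2).trans ?_
          have hp0 : (0:ℝ) < p := by exact_mod_cast hp.2.pos
          rw [show (-(1/4):ℝ) = 3/4 - 1 by norm_num, Real.rpow_sub_one hp0.ne', mul_assoc, div_eq_mul_inv]
          gcongr
          exact hp.1.2
      _ ≤ ∑ p ∈ Finset.Icc 1 N, A * (N:ℝ)^(3/4:ℝ) * (p:ℝ)⁻¹ := by
          refine Finset.sum_le_sum_of_subset_of_nonneg ?_ (by intros; positivity)
          intro p hp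
          rw [Finset.mem_filter, Finset.mem_Icc] at hp
          rw [Finset.mem_Icc]; omega
      _ = A * (N:ℝ)^(3/4:ℝ) * ∑ p ∈ Finset.Icc 1 N, (p:ℝ)⁻¹ := by rw [Finset.mul_sum]
      _ ≤ _ := by
          gcongr
          have h := harmonic_le_one_add_log N
          rw [harmonic_eq_sum_Icc] at h
          push_cast at h
          exact h
  have h2 := log_pow_le (J+1) (by omega) (x := (N:ℝ)^(1/2:ℝ)) (Real.one_le_rpow (by linarith) (by norm_num))
  rw [Real.log_rpow hN0, ← Real.rpow_mul hN0.le, ← hLd, mul_pow] at h2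
  have h3 : L^(J+1) ≤ 2^(J+1) * ((2*(J+1:ℕ))^(J+1) * (N:ℝ)^(1/2*(1/2):ℝ)) := by
    calc L^(J+1) = 2^(J+1) * ((1/2)^(J+1) * L^(J+1)) := by
          rw [← mul_assoc, ← mul_pow]; norm_num
      _ ≤ _ := by gcongr
  refine h1.trans ?_
  have e : (N:ℝ)^(3/4:ℝ) * (N:ℝ)^(1/2*(1/2):ℝ) = N := by
    rw [← Real.rpow_add hN0]; norm_num
  have h4 : (N:ℝ)^(3/4:ℝ) * L ≤ (2^(J+1) * (2*(J+1:ℕ))^(J+1)) * rj J N := by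
    rw [rj, ← hLd, ← mul_div_assoc, le_div_iff₀ (by positivity)]
    calc (N:ℝ)^(3/4:ℝ) * L * L^J = (N:ℝ)^(3/4:ℝ) * L^(J+1) := by ring
      _ ≤ (N:ℝ)^(3/4:ℝ) * (2^(J+1) * ((2*(J+1:ℕ))^(J+1) * (N:ℝ)^(1/2*(1/2):ℝ))) := by gcongr
      _ = (2^(J+1) * (2*(J+1:ℕ))^(J+1)) * ((N:ℝ)^(3/4:ℝ) * (N:ℝ)^(1/2*(1/2):ℝ)) := by ring
      _ = _ := by rw [e]
  calc A * (N:ℝ)^(3/4:ℝ) * (1 + L) ≤ A * (N:ℝ)^(3/4:ℝ) * (L + L) := by gcongr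
    _ = A * 2 * ((N:ℝ)^(3/4:ℝ) * L) := by ring
    _ ≤ A * 2 * ((2^(J+1) * (2*(J+1:ℕ))^(J+1)) * rj J N) := by gcongr
    _ = _ := by ring

lemma main_nat (J : ℕ) (hJ : 1 ≤ J) : ∃ K : ℝ, 0 < K ∧ ∀ N : ℕ, 3 ≤ N →
    |∑ p ∈ Finset.filter Nat.Prime (Finset.Icc 2 N), (Gp p : ℝ)/((p-1:ℕ):ℝ) - BB * Li N| ≤ K * rj J N := by
  obtain ⟨K1, h1, H1⟩ := sum_FF J hJ
  obtain ⟨K2, h2, H2⟩ := sum_err J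
  refine ⟨K2 + K1, by positivity, fun N hN => ?_⟩
  have a := H1 N hN
  have b := (Finset.abs_sum_le_sum_abs _ _).trans (H2 N hN)
  rw [Finset.sum_sub_distrib] at b
  refine (abs_sub_le _ _ _).trans ((add_le_add b a).trans (by linarith))

end SW

theorem averaged_G_gPR_hANY (C : ℝ) (hC : 0 < C) :
    ∃ K : ℝ, ∀ x : ℝ, 2 ≤ x →
      |(∑ p ∈ Finset.filter Nat.Prime (Finset.Iic ⌊x⌋₊),
          (Nat.card {h : ℕ // 1 ≤ h ∧ h ≤ p - 1 ∧ ∃ g : ℕ, 1 ≤ g ∧ g ≤ p - 1 ∧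
              IsPrimitiveRoot (g : ZMod p) (p - 1) ∧ g ^ h ≡ h [MOD p]} : ℝ) /
            ((p - 1 : ℕ) : ℝ)) -
        (∏' q : Nat.Primes, (1 - 2 * ((q : ℕ) : ℝ) / (((q : ℕ) : ℝ) ^ 3 - 1))) *
          ∫ t in (2 : ℝ)..x, 1 / Real.log t| ≤ K * x / Real.log x ^ C := by
  set J : ℕ := ⌈C⌉₊ + 1 with hJ
  have hCJ : C ≤ (J:ℝ) := by rw [hJ]; push_cast; linarith [Nat.le_ceil C]
  obtain ⟨K, hK, hmain⟩ := SW.main_nat J (by omega)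
  obtain ⟨R, hR, hr⟩ := SW.rj_ge J
  set T : ℕ → ℝ := fun N => ∑ p ∈ Finset.filter Nat.Prime (Finset.Icc 2 N), (SW.Gp p : ℝ)/((p-1:ℕ):ℝ) with hT
  have hTe : ∀ N : ℕ, (∑ p ∈ Finset.filter Nat.Prime (Finset.Iic N),
          (Nat.card {h : ℕ // 1 ≤ h ∧ h ≤ p - 1 ∧ ∃ g : ℕ, 1 ≤ g ∧ g ≤ p - 1 ∧
              IsPrimitiveRoot (g : ZMod p) (p - 1) ∧ g ^ h ≡ h [MOD p]} : ℝ) /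
            ((p - 1 : ℕ) : ℝ)) = T N := by
    intro N
    refine Finset.sum_congr ?_ fun _ _ => rfl
    ext p
    simp only [Finset.mem_filter, Finset.mem_Iic, Finset.mem_Icc]
    constructor
    · rintro ⟨a, b⟩; exact ⟨⟨b.two_le, a⟩, b⟩
    · rintro ⟨a, b⟩; exact ⟨a.2, b⟩
  set B := SW.BB with hB
  have hBe : (∏' q : Nat.Primes, (1 - 2 * ((q : ℕ) : ℝ) / (((q : ℕ) : ℝ) ^ 3 - 1))) = B := rfl
  set D := |T 2| + |B| * 2 with hD
  have hl3 : 0 < Real.log 3 := Real.log_pos (by norm_num)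
  have hD0 : 0 ≤ D := by positivity
  refine ⟨D * (Real.log 3)^C + (K + |B| * 2 * R) * 2^J, fun x hx => ?_⟩
  rw [hTe, hBe]
  have hlx : 0 < Real.log x := Real.log_pos (by linarith)
  have hx0 : 0 ≤ x := by linarith
  set N := ⌊x⌋₊ with hN
  have hNx : (N:ℝ) ≤ x := Nat.floor_le hx0
  have hxN : x < N + 1 := Nat.lt_floor_add_one x
  have hN2 : 2 ≤ N := Nat.le_floor (by exact_mod_cast hx)
  have hN2' : (2:ℝ) ≤ N := by exact_mod_cast hN2
  have hK2 : 0 ≤ (K + |B| * 2 * R) * 2^J := by positivity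
  rcases Nat.lt_or_ge N 3 with h3 | h3
  · have hNe : N = 2 := by omega
    have hx3 : x ≤ 3 := by rw [hNe] at hxN; push_cast at hxN; linarith
    have h1 : |T N - B * ∫ t in (2 : ℝ)..x, 1 / Real.log t| ≤ D := by
      rw [hNe]
      refine (abs_sub _ _).trans ?_
      rw [abs_mul, hD]
      have := SW.Li_abs (x := 2) (y := x) le_rfl hx
      gcongr
      linarith
    refine h1.trans ?_
    rw [le_div_iff₀ (by positivity)]
    have h2 : Real.log x ^ C ≤ Real.log 3 ^ C :=
      Real.rpow_le_rpow hlx.le (Real.log_le_log (by linarith) hx3) hC.le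
    have h4 : 0 ≤ D * (Real.log 3)^C := by positivity
    calc D * Real.log x ^ C ≤ D * Real.log 3 ^ C := by gcongr
      _ ≤ (D * (Real.log 3)^C + (K + |B| * 2 * R) * 2^J) * 1 := by linarith
      _ ≤ _ := by gcongr; linarith
  · have hm := hmain N h3
    have hL := SW.log3 h3
    have hN3' : (3:ℝ) ≤ N := by exact_mod_cast h3
    have hintg : (∫ t in (2 : ℝ)..x, 1 / Real.log t) = SW.Li N + ∫ t in (N : ℝ)..x, 1 / Real.log t := by
      rw [SW.Li]
      have hii : ∀ a b : ℝ, 2 ≤ a → a ≤ b → IntervalIntegrable (fun t : ℝ => 1 / Real.log t) MeasureTheory.volume a b := by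
        intro a b ha hab
        refine ContinuousOn.intervalIntegrable ?_
        rw [Set.uIcc_of_le hab]
        refine ContinuousOn.div continuousOn_const (Real.continuousOn_log.mono ?_) ?_
        · intro t ht; have := ht.1
          simp only [Set.mem_compl_iff, Set.mem_singleton_iff]; intro h; rw [h] at this; linarith
        · intro t ht; exact (Real.log_pos (by linarith [ht.1])).ne'
      exact (intervalIntegral.integral_add_adjacent_intervals (hii 2 N le_rfl hN2') (hii N x hN2' hNx)).symm
    have hrj0 : 0 ≤ SW.rj J N := by rw [SW.rj]; positivity
    have hlast := SW.Li_abs (x := N) (y := x) hN2' hNx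
    have h1 : |T N - B * ∫ t in (2 : ℝ)..x, 1 / Real.log t| ≤ (K + |B| * 2 * R) * SW.rj J N := by
      rw [hintg, show T N - B * (SW.Li N + ∫ t in (N : ℝ)..x, 1 / Real.log t) = (T N - B * SW.Li N) - B * ∫ t in (N : ℝ)..x, 1 / Real.log t by ring]
      refine (abs_sub _ _).trans ?_
      rw [abs_mul B]
      have h5 := (hr N h3).2
      have h6 : |B| * |∫ t in (N : ℝ)..x, 1 / Real.log t| ≤ |B| * (2 * (R * SW.rj J N)) := by
        gcongr
        linarith
      linarith
    have h7 : SW.rj J N ≤ 2^J * x / Real.log x ^ C := by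
      have hlogx : Real.log x ≤ 2 * Real.log N := by
        have : Real.log x ≤ Real.log ((N:ℝ)^2) := Real.log_le_log (by linarith) (by nlinarith)
        rwa [Real.log_pow] at this
      have hlx1 : 1 ≤ Real.log x := hL.trans (Real.log_le_log (by linarith) hNx)
      have h8 : Real.log x ^ C ≤ (2 * Real.log N)^J := by
        calc Real.log x ^ C ≤ Real.log x ^ (J:ℝ) := Real.rpow_le_rpow_of_exponent_le hlx1 hCJ
          _ = Real.log x ^ J := Real.rpow_natCast _ _
          _ ≤ _ := by gcongr
      rw [SW.rj, div_le_div_iff₀ (by positivity) (by positivity)]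
      calc (N:ℝ) * Real.log x ^ C ≤ x * (2 * Real.log N)^J := by gcongr
        _ = _ := by rw [mul_pow]; ring
    refine h1.trans ?_
    calc (K + |B| * 2 * R) * SW.rj J N ≤ (K + |B| * 2 * R) * (2^J * x / Real.log x ^ C) := by gcongr
      _ = (K + |B| * 2 * R) * 2^J * x / Real.log x ^ C := by ring
      _ ≤ _ := by
        gcongr
        have : 0 ≤ D * (Real.log 3)^C := by positivity
        linarith
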